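/- arXiv:1508.02598 — 5 statements merged into one kernel-verified Lean document; each statement's English description precedes it below -/
import Mathlib

section
/- Let T be an unrooted binary phylogenetic tree on n ≥ 2 taxa. Then the total number of convex characters on T equals the Fibonacci number F(2n−1). -/
open SimpleGraph

/-- The degree of a vertex in a simple graph, as the cardinality of its neighbour set. -/
noncomputable def vdeg {V : Type} (G : SimpleGraph V) (v : V) : ℕ :=
  (G.neighborSet v).ncard

/-- An unrooted binary phylogenetic tree on taxon set `X` with vertex type `V`:
a tree in which every vertex has degree 1 or 3, whose degree-1 vertices (leaves)
are bijectively labelled by the taxa in `X`. -/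
structure UnrootedBinaryTree (V X : Type) where
  graph : SimpleGraph V
  isTree : graph.IsTree
  degOneOrThree : ∀ v : V, vdeg graph v = 1 ∨ vdeg graph v = 3
  label : X → V
  label_inj : Function.Injective label
  label_leaf : ∀ x : X, vdeg graph (label x) = 1
  leaf_label : ∀ v : V, vdeg graph v = 1 → ∃ x : X, label x = v

/-- A character on `X`: a partition of `X` into nonempty blocks (the states). -/
def IsCharacter {X : Type} (P : Finset (Finset X)) : Prop :=
  (∀ B ∈ P, B.Nonempty) ∧
  (∀ B ∈ P, ∀ B' ∈ P, B ≠ B' → Disjoint B B') ∧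
  (∀ x : X, ∃ B ∈ P, x ∈ B)

/-- A character `P` is convex on `T` if states can be assigned to all vertices of `T`,
agreeing with `P` on the leaves, so that each state induces a connected subgraph. -/
def IsConvexChar {V X : Type} (T : UnrootedBinaryTree V X) (P : Finset (Finset X)) : Prop :=
  ∃ h : V → Finset X,
    (∀ v : V, h v ∈ P) ∧
    (∀ (x : X) (B : Finset X), B ∈ P → x ∈ B → h (T.label x) = B) ∧
    (∀ B ∈ P, (T.graph.induce {v : V | h v = B}).Connected)

/-- `gCount T k r` : the number of convex characters on `T` with exactly `r` states,
each state appearing on at least `k` taxa. -/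
noncomputable def gCount {V X : Type} (T : UnrootedBinaryTree V X) (k r : ℕ) : ℕ :=
  Nat.card {P : Finset (Finset X) //
    IsCharacter P ∧ IsConvexChar T P ∧ P.card = r ∧ ∀ B ∈ P, k ≤ B.card}

/-- `gTotal T k = ∑_{r=1}^{n} gCount T k r`, where `n` is the number of taxa. -/
noncomputable def gTotal {V X : Type} (T : UnrootedBinaryTree V X) (k : ℕ) : ℕ :=
  ∑ r ∈ Finset.Icc 1 (Nat.card X), gCount T k r

/-- The vertex set of the minimal connecting subtree of a set `A` of taxa:
the union of the vertex sets of all paths between pairs of leaves labelled by `A`. -/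
def connSubtree {V X : Type} (T : UnrootedBinaryTree V X) (A : Set X) : Set V :=
  {v : V | ∃ x ∈ A, ∃ y ∈ A,
    ∃ p : T.graph.Walk (T.label x) (T.label y), p.IsPath ∧ v ∈ p.support}

/-- Isomorphism of phylogenetic trees on the same taxon set, fixing each taxon. -/
def PhyloIsomorphic {V₁ V₂ X : Type}
    (T₁ : UnrootedBinaryTree V₁ X) (T₂ : UnrootedBinaryTree V₂ X) : Prop :=
  ∃ e : T₁.graph ≃g T₂.graph, ∀ x : X, e (T₁.label x) = T₂.label x


namespace ConvexCount

open Classical in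
/-- Rooted binary trees with leaves labelled in `X`. -/
inductive BT (X : Type) : Type
  | leaf (x : X) : BT X
  | node (l r : BT X) : BT X

open Classical in
noncomputable def lv {X : Type} : BT X → Finset X
  | .leaf x => {x}
  | .node l r => lv l ∪ lv r

def Valid {X : Type} : BT X → Prop
  | .leaf _ => True
  | .node l r => Valid l ∧ Valid r ∧ Disjoint (lv l) (lv r)

def size {X : Type} : BT X → ℕ
  | .leaf _ => 0
  | .node l r => size l + size r + 1

open Classical in
/-- First component: closed characters; second: characters with a marked block. -/
noncomputable def ch {X : Type} :
    BT X → Finset (Finset (Finset X)) × Finset (Finset X × Finset (Finset X))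
  | .leaf x => ({{{x}}}, {({x}, ∅)})
  | .node l r =>
    ( ((ch l).1 ×ˢ (ch r).1).image (fun p => p.1 ∪ p.2) ∪
      ((ch l).2 ×ˢ (ch r).2).image (fun p => insert (p.1.1 ∪ p.2.1) (p.1.2 ∪ p.2.2)),
      (((ch l).2 ×ˢ (ch r).1).image (fun p => (p.1.1, p.1.2 ∪ p.2)) ∪
      ((ch l).1 ×ˢ (ch r).2).image (fun p => (p.2.1, p.1 ∪ p.2.2))) ∪
      ((ch l).2 ×ˢ (ch r).2).image (fun p => (p.1.1 ∪ p.2.1, p.1.2 ∪ p.2.2)) )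

/-- nonempty subset -/
def NS {X : Type} (A C : Finset X) : Prop := C.Nonempty ∧ C ⊆ A

section
open Classical
variable {X : Type}

lemma NS.mono {A A' C : Finset X} (h : NS A C) (hA : A ⊆ A') : NS A' C :=
  ⟨h.1, h.2.trans hA⟩

lemma NS.disj {A A' C : Finset X} (hd : Disjoint A A') (h : NS A C) : ¬ NS A' C := by
  rintro ⟨⟨x, hx⟩, h2⟩
  exact Finset.disjoint_left.1 hd (h.2 hx) (h2 hx)

lemma NS.union_not {A A' C C' : Finset X} (hd : Disjoint A A') (h : NS A C) (h' : NS A' C') :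
    ¬ NS A (C ∪ C') ∧ ¬ NS A' (C ∪ C') := by
  constructor
  · intro h3
    exact NS.disj hd (A := A) (C := C') ⟨h'.1, Finset.union_subset_right h3.2⟩ h'
  · intro h3
    exact NS.disj hd h ⟨h.1, Finset.union_subset_left h3.2⟩

lemma NS.union_inj {A A' B C B' C' : Finset X} (hd : Disjoint A A')
    (h1 : NS A B) (h2 : NS A B') (h3 : NS A' C) (h4 : NS A' C')
    (h : B ∪ C = B' ∪ C') : B = B' ∧ C = C' := by
  have hd' := Finset.disjoint_left.1 hd
  constructor
  · ext x
    have := congrArg (x ∈ ·) h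
    simp only [Finset.mem_union, eq_iff_iff] at this
    have := @h1.2 x; have := @h2.2 x; have := @h3.2 x; have := @h4.2 x; have := @hd' x
    tauto
  · ext x
    have := congrArg (x ∈ ·) h
    simp only [Finset.mem_union, eq_iff_iff] at this
    have := @h1.2 x; have := @h2.2 x; have := @h3.2 x; have := @h4.2 x; have := @hd' x
    tauto

lemma mem_ch1_node {l r : BT X} {P : Finset (Finset X)} :
    P ∈ (ch (.node l r)).1 ↔
      (∃ P1 ∈ (ch l).1, ∃ P2 ∈ (ch r).1, P = P1 ∪ P2) ∨
      (∃ B1 Q1 B2 Q2, (B1, Q1) ∈ (ch l).2 ∧ (B2, Q2) ∈ (ch r).2 ∧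
        P = insert (B1 ∪ B2) (Q1 ∪ Q2)) := by
  simp only [ch, Finset.mem_union, Finset.mem_image, Finset.mem_product, Prod.exists]
  grind

lemma mem_ch2_node {l r : BT X} {B : Finset X} {Q : Finset (Finset X)} :
    (B, Q) ∈ (ch (.node l r)).2 ↔
      (∃ Q1 Q2, (B, Q1) ∈ (ch l).2 ∧ Q2 ∈ (ch r).1 ∧ Q = Q1 ∪ Q2) ∨
      (∃ Q1 Q2, Q1 ∈ (ch l).1 ∧ (B, Q2) ∈ (ch r).2 ∧ Q = Q1 ∪ Q2) ∨
      (∃ B1 Q1 B2 Q2, (B1, Q1) ∈ (ch l).2 ∧ (B2, Q2) ∈ (ch r).2 ∧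
        B = B1 ∪ B2 ∧ Q = Q1 ∪ Q2) := by
  simp only [ch, Finset.mem_union, Finset.mem_image, Finset.mem_product, Prod.exists,
    Prod.mk.injEq]
  grind

/-- partition of `A` -/
def Part (A : Finset X) (P : Finset (Finset X)) : Prop :=
  (∀ B ∈ P, B.Nonempty) ∧ (∀ B ∈ P, ∀ C ∈ P, B ≠ C → Disjoint B C) ∧
  (∀ x, x ∈ A ↔ ∃ B ∈ P, x ∈ B)

lemma Part.ns {A : Finset X} {P : Finset (Finset X)} (h : Part A P) : ∀ B ∈ P, NS A B :=
  fun B hB => ⟨h.1 B hB, fun x hx => (h.2.2 x).2 ⟨B, hB, hx⟩⟩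

lemma disj_of_ns {A A' B C : Finset X} (hd : Disjoint A A') (h : NS A B) (h' : NS A' C) :
    Disjoint B C := hd.mono h.2 h'.2

lemma Part.union {A1 A2 : Finset X} {P1 P2 : Finset (Finset X)} (hd : Disjoint A1 A2)
    (h1 : Part A1 P1) (h2 : Part A2 P2) : Part (A1 ∪ A2) (P1 ∪ P2) := by
  have n1 := h1.ns
  have n2 := h2.ns
  refine ⟨?_, ?_, ?_⟩
  · intro B hB
    rcases Finset.mem_union.1 hB with h | h
    · exact h1.1 B h
    · exact h2.1 B h
  · intro B hB C hC hne
    rcases Finset.mem_union.1 hB with h | h <;> rcases Finset.mem_union.1 hC with h' | h'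
    · exact h1.2.1 B h C h' hne
    · exact disj_of_ns hd (n1 B h) (n2 C h')
    · exact (disj_of_ns hd (n1 C h') (n2 B h)).symm
    · exact h2.2.1 B h C h' hne
  · intro x
    rw [Finset.mem_union, h1.2.2, h2.2.2]
    simp only [Finset.mem_union]
    grind

lemma Part.merge {A1 A2 B1 B2 : Finset X} {Q1 Q2 : Finset (Finset X)} (hd : Disjoint A1 A2)
    (h1 : Part A1 (insert B1 Q1)) (h2 : Part A2 (insert B2 Q2))
    (hb1 : B1 ∉ Q1) (hb2 : B2 ∉ Q2) :
    B1 ∪ B2 ∉ Q1 ∪ Q2 ∧ Part (A1 ∪ A2) (insert (B1 ∪ B2) (Q1 ∪ Q2)) := by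
  have n1 := h1.ns
  have n2 := h2.ns
  have nb1 := n1 B1 (by simp)
  have nb2 := n2 B2 (by simp)
  have nn := NS.union_not hd nb1 nb2
  have key : ∀ C ∈ Q1 ∪ Q2, Disjoint (B1 ∪ B2) C := by
    intro C hC
    rw [Finset.disjoint_union_left]
    rcases Finset.mem_union.1 hC with h | h
    · exact ⟨h1.2.1 _ (by simp) _ (by simp [h]) (by grind),
        (disj_of_ns hd (n1 C (by simp [h])) nb2).symm⟩
    · exact ⟨disj_of_ns hd nb1 (n2 C (by simp [h])),
        h2.2.1 _ (by simp) _ (by simp [h]) (by grind)⟩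
  refine ⟨?_, ?_, ?_, ?_⟩
  · grind
  · intro B hB
    have := h1.1; have := h2.1
    have := nb1.1
    rcases Finset.mem_insert.1 hB with rfl | hB
    · exact this.mono Finset.subset_union_left
    · grind
  · intro B hB C hC hne
    rcases Finset.mem_insert.1 hB with rfl | hB <;> rcases Finset.mem_insert.1 hC with rfl | hC
    · exact absurd rfl hne
    · exact key C hC
    · exact (key B hB).symm
    · rcases Finset.mem_union.1 hB with h | h <;> rcases Finset.mem_union.1 hC with h' | h'
      · exact h1.2.1 B (by simp [h]) C (by simp [h']) hne
      · exact disj_of_ns hd (n1 B (by simp [h])) (n2 C (by simp [h']))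
      · exact (disj_of_ns hd (n1 C (by simp [h'])) (n2 B (by simp [h]))).symm
      · exact h2.2.1 B (by simp [h]) C (by simp [h']) hne
  · intro x
    rw [Finset.mem_union, h1.2.2, h2.2.2]
    simp only [Finset.mem_union, Finset.mem_insert]
    grind

lemma ch_part (t : BT X) (hv : Valid t) :
    (∀ P ∈ (ch t).1, Part (lv t) P) ∧
    (∀ B Q, (B, Q) ∈ (ch t).2 → B ∉ Q ∧ Part (lv t) (insert B Q)) := by
  induction t with
  | leaf x => simp [ch, Part, lv]
  | node l r ihl ihr =>
    obtain ⟨vl, vr, hd⟩ := hv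
    obtain ⟨l1, l2⟩ := ihl vl
    obtain ⟨r1, r2⟩ := ihr vr
    constructor
    · intro P hP
      rcases mem_ch1_node.1 hP with ⟨P1, h1, P2, h2, rfl⟩ | ⟨B1, Q1, B2, Q2, h1, h2, rfl⟩
      · exact Part.union hd (l1 _ h1) (r1 _ h2)
      · exact (Part.merge hd (l2 _ _ h1).2 (r2 _ _ h2).2 (l2 _ _ h1).1 (r2 _ _ h2).1).2
    · intro B Q hP
      rcases mem_ch2_node.1 hP with ⟨Q1, Q2, h1, h2, rfl⟩ | ⟨Q1, Q2, h1, h2, rfl⟩ |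
        ⟨B1, Q1, B2, Q2, h1, h2, rfl, rfl⟩
      · refine ⟨?_, ?_⟩
        · intro hB
          rcases Finset.mem_union.1 hB with h | h
          · exact (l2 _ _ h1).1 h
          · exact NS.disj hd ((l2 _ _ h1).2.ns B (by simp)) ((r1 _ h2).ns B h)
        · rw [← Finset.insert_union]
          exact Part.union hd (l2 _ _ h1).2 (r1 _ h2)
      · refine ⟨?_, ?_⟩
        · intro hB
          rcases Finset.mem_union.1 hB with h | h
          · exact NS.disj hd ((l1 _ h1).ns B h) ((r2 _ _ h2).2.ns B (by simp))
          · exact (r2 _ _ h2).1 h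
        · rw [← Finset.union_insert]
          exact Part.union hd (l1 _ h1) (r2 _ _ h2).2
      · exact (Part.merge hd (l2 _ _ h1).2 (r2 _ _ h2).2 (l2 _ _ h1).1 (r2 _ _ h2).1)

lemma ch_ns (t : BT X) (hv : Valid t) :
    (∀ P ∈ (ch t).1, ∀ C ∈ P, NS (lv t) C) ∧
    (∀ B Q, (B, Q) ∈ (ch t).2 → NS (lv t) B ∧ ∀ C ∈ Q, NS (lv t) C) := by
  obtain ⟨h1, h2⟩ := ch_part t hv
  refine ⟨fun P hP => (h1 P hP).ns, fun B Q h => ⟨(h2 B Q h).2.ns B (by simp), fun C hC =>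
    (h2 B Q h).2.ns C (by simp [hC])⟩⟩

lemma union_inj_aux {A A' : Finset X} (hd : Disjoint A A') {Q1 Q2 Q1' Q2' : Finset (Finset X)}
    (h1 : ∀ C ∈ Q1, NS A C) (h2 : ∀ C ∈ Q2, NS A' C)
    (h1' : ∀ C ∈ Q1', NS A C) (h2' : ∀ C ∈ Q2', NS A' C)
    (h : Q1 ∪ Q2 = Q1' ∪ Q2') : Q1 = Q1' ∧ Q2 = Q2' := by
  have hn : ∀ C, NS A C → ¬ NS A' C := fun C => NS.disj hd
  have h0 : ∀ C, (C ∈ Q1 ∨ C ∈ Q2) ↔ (C ∈ Q1' ∨ C ∈ Q2') := by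
    intro C
    rw [← Finset.mem_union, ← Finset.mem_union, h]
  constructor <;> ext C <;> have := h1 C <;> have := h2 C <;> have := h1' C <;>
    have := h2' C <;> have := hn C <;> have := h0 C <;> tauto

lemma merge_inj_aux {A A' : Finset X} (hd : Disjoint A A') {Q1 Q2 Q1' Q2' : Finset (Finset X)}
    {B1 B2 B1' B2' : Finset X}
    (b1 : NS A B1) (b2 : NS A' B2) (b1' : NS A B1') (b2' : NS A' B2')
    (h1 : ∀ C ∈ Q1, NS A C) (h2 : ∀ C ∈ Q2, NS A' C)
    (h1' : ∀ C ∈ Q1', NS A C) (h2' : ∀ C ∈ Q2', NS A' C)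
    (h : insert (B1 ∪ B2) (Q1 ∪ Q2) = insert (B1' ∪ B2') (Q1' ∪ Q2')) :
    (B1 = B1' ∧ B2 = B2') ∧ Q1 = Q1' ∧ Q2 = Q2' := by
  have hn : ∀ C, NS A C → ¬ NS A' C := fun C => NS.disj hd
  have n := NS.union_not hd b1 b2
  have n' := NS.union_not hd b1' b2'
  have h0 : ∀ C, (C = B1 ∪ B2 ∨ C ∈ Q1 ∨ C ∈ Q2) ↔ (C = B1' ∪ B2' ∨ C ∈ Q1' ∨ C ∈ Q2') := by
    intro C
    rw [← Finset.mem_union, ← Finset.mem_union, ← Finset.mem_insert, ← Finset.mem_insert, h]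
  have e : B1 ∪ B2 = B1' ∪ B2' := by
    have := (h0 (B1 ∪ B2)).1 (Or.inl rfl)
    rcases this with h | h | h
    · exact h
    · exact absurd (h1' _ h) n.1
    · exact absurd (h2' _ h) n.2
  refine ⟨NS.union_inj hd b1 b1' b2 b2' e, union_inj_aux hd h1 h2 h1' h2' ?_⟩
  ext C
  have := h0 C
  rw [← e] at this
  simp only [Finset.mem_union]
  by_cases hC : C = B1 ∪ B2
  · subst hC
    grind
  · tauto

lemma ch_card (t : BT X) (hv : Valid t) :
    (ch t).1.card = Nat.fib (2 * size t + 1) ∧ (ch t).2.card = Nat.fib (2 * size t + 2) := by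
  induction t with
  | leaf x => simp [ch, size]
  | node l r ihl ihr =>
    obtain ⟨vl, vr, hd⟩ := hv
    obtain ⟨cl1, cl2⟩ := ihl vl
    obtain ⟨cr1, cr2⟩ := ihr vr
    obtain ⟨l1, l2⟩ := ch_ns l vl
    obtain ⟨r1, r2⟩ := ch_ns r vr
    have e1 : Nat.fib (2 * (size l + size r + 1) + 1) =
        Nat.fib (2 * size l + 1) * Nat.fib (2 * size r + 1) +
        Nat.fib (2 * size l + 2) * Nat.fib (2 * size r + 2) := by
      rw [← Nat.fib_add]; congr 1; ring
    have e2 : Nat.fib (2 * (size l + size r + 1) + 2) =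
        Nat.fib (2 * size l + 2) * Nat.fib (2 * size r + 1) +
        Nat.fib (2 * size l + 1) * Nat.fib (2 * size r + 2) +
        Nat.fib (2 * size l + 2) * Nat.fib (2 * size r + 2) := by
      have := Nat.fib_add (2 * size l + 2) (2 * size r + 1)
      have h3 : Nat.fib (2 * size l + 2 + 1) = Nat.fib (2 * size l + 1) + Nat.fib (2 * size l + 2) :=
        Nat.fib_add_two
      rw [h3] at this
      rw [show 2 * (size l + size r + 1) + 2 = 2 * size l + 2 + (2 * size r + 1) + 1 by ring, this]
      ring
    simp only [size]
    rw [e1, e2]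
    constructor
    · simp only [ch]
      rw [Finset.card_union_of_disjoint, Finset.card_image_of_injOn, Finset.card_image_of_injOn,
        Finset.card_product, Finset.card_product, cl1, cl2, cr1, cr2]
      · rintro ⟨⟨B1, Q1⟩, B2, Q2⟩ h ⟨⟨B1', Q1'⟩, B2', Q2'⟩ h' heq
        simp only [Finset.coe_product, Set.mem_prod, Finset.mem_coe] at h h'
        simp only at heq
        obtain ⟨⟨rfl, rfl⟩, rfl, rfl⟩ := merge_inj_aux hd (l2 _ _ h.1).1 (r2 _ _ h.2).1
          (l2 _ _ h'.1).1 (r2 _ _ h'.2).1 (l2 _ _ h.1).2 (r2 _ _ h.2).2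
          (l2 _ _ h'.1).2 (r2 _ _ h'.2).2 heq
        rfl
      · rintro ⟨Q1, Q2⟩ h ⟨Q1', Q2'⟩ h' heq
        simp only [Finset.coe_product, Set.mem_prod, Finset.mem_coe] at h h'
        simp only at heq
        obtain ⟨rfl, rfl⟩ := union_inj_aux hd (l1 _ h.1) (r1 _ h.2) (l1 _ h'.1) (r1 _ h'.2) heq
        rfl
      · rw [Finset.disjoint_left]
        intro P hP hP'
        simp only [Finset.mem_image, Finset.mem_product, Prod.exists] at hP hP'
        obtain ⟨Q1, Q2, ⟨h1, h2⟩, rfl⟩ := hP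
        obtain ⟨B1, Q1', B2, Q2', ⟨h1', h2'⟩, heq⟩ := hP'
        have n := NS.union_not hd (l2 _ _ h1').1 (r2 _ _ h2').1
        have : B1 ∪ B2 ∈ Q1 ∪ Q2 := by rw [← heq]; simp
        rcases Finset.mem_union.1 this with h | h
        · exact n.1 (l1 _ h1 _ h)
        · exact n.2 (r1 _ h2 _ h)
    · simp only [ch]
      rw [Finset.card_union_of_disjoint, Finset.card_union_of_disjoint,
        Finset.card_image_of_injOn, Finset.card_image_of_injOn, Finset.card_image_of_injOn,
        Finset.card_product, Finset.card_product, Finset.card_product, cl1, cl2, cr1, cr2]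
      · rintro ⟨⟨B1, Q1⟩, B2, Q2⟩ h ⟨⟨B1', Q1'⟩, B2', Q2'⟩ h' heq
        simp only [Finset.coe_product, Set.mem_prod, Finset.mem_coe] at h h'
        simp only [Prod.mk.injEq] at heq
        obtain ⟨rfl, rfl⟩ := union_inj_aux hd (l2 _ _ h.1).2 (r2 _ _ h.2).2
          (l2 _ _ h'.1).2 (r2 _ _ h'.2).2 heq.2
        obtain ⟨rfl, rfl⟩ := NS.union_inj hd (l2 _ _ h.1).1 (l2 _ _ h'.1).1 (r2 _ _ h.2).1
          (r2 _ _ h'.2).1 heq.1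
        rfl
      · rintro ⟨Q1, B2, Q2⟩ h ⟨Q1', B2', Q2'⟩ h' heq
        simp only [Finset.coe_product, Set.mem_prod, Finset.mem_coe] at h h'
        simp only [Prod.mk.injEq] at heq
        obtain ⟨rfl, rfl⟩ := union_inj_aux hd (l1 _ h.1) (r2 _ _ h.2).2
          (l1 _ h'.1) (r2 _ _ h'.2).2 heq.2
        rw [heq.1]
      · rintro ⟨⟨B1, Q1⟩, Q2⟩ h ⟨⟨B1', Q1'⟩, Q2'⟩ h' heq
        simp only [Finset.coe_product, Set.mem_prod, Finset.mem_coe] at h h'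
        simp only [Prod.mk.injEq] at heq
        obtain ⟨rfl, rfl⟩ := union_inj_aux hd (l2 _ _ h.1).2 (r1 _ h.2)
          (l2 _ _ h'.1).2 (r1 _ h'.2) heq.2
        rw [heq.1]
      · rw [Finset.disjoint_left]
        rintro ⟨B, Q⟩ hP hP'
        simp only [Finset.mem_image, Finset.mem_product, Prod.exists, Prod.mk.injEq] at hP hP'
        obtain ⟨B1, Q1, Q2, ⟨h1, h2⟩, rfl, rfl⟩ := hP
        obtain ⟨Q1', B2, Q2', ⟨h1', h2'⟩, rfl, heq⟩ := hP'
        exact NS.disj hd (l2 _ _ h1).1 (r2 _ _ h2').1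
      · rw [Finset.disjoint_left]
        rintro ⟨B, Q⟩ hP hP'
        simp only [Finset.mem_union, Finset.mem_image, Finset.mem_product, Prod.exists,
          Prod.mk.injEq] at hP hP'
        obtain ⟨B1, Q1, B2, Q2, ⟨h1, h2⟩, rfl, rfl⟩ := hP'
        have n := NS.union_not hd (l2 _ _ h1).1 (r2 _ _ h2).1
        rcases hP with ⟨B1', Q1', Q2', ⟨h1', h2'⟩, h, -⟩ | ⟨Q1', B2', Q2', ⟨h1', h2'⟩, h, -⟩
        · exact n.1 (h ▸ (l2 _ _ h1').1)
        · exact n.2 (h ▸ (r2 _ _ h2').1)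

lemma lv_card (t : BT X) (hv : Valid t) : (lv t).card = size t + 1 := by
  induction t with
  | leaf x => simp [lv, size]
  | node l r ihl ihr =>
    obtain ⟨vl, vr, hd⟩ := hv
    simp only [lv, size]
    rw [Finset.card_union_of_disjoint hd, ihl vl, ihr vr]
    ring

end

section
open Classical
variable {V X : Type}

/-- every walk from `a` to `b` visits `v` -/
def Btw (G : SimpleGraph V) (a v b : V) : Prop := ∀ w : G.Walk a b, v ∈ w.support

lemma Btw.symm {G : SimpleGraph V} {a v b : V} (h : Btw G a v b) : Btw G b v a := by
  intro w
  have := h w.reverse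
  simpa using this

lemma Btw.trans {G : SimpleGraph V} {a v c b : V} (h : Btw G a v c) (h' : Btw G a c b) :
    Btw G a v b := by
  intro w
  exact w.support_takeUntil_subset_support (h' w) (h (w.takeUntil c (h' w)))

def InHull (T : UnrootedBinaryTree V X) (B : Finset X) (v : V) : Prop :=
  ∃ x ∈ B, ∃ y ∈ B, Btw T.graph (T.label x) v (T.label y)

lemma InHull.mono {T : UnrootedBinaryTree V X} {B C : Finset X} {v : V} (h : B ⊆ C)
    (hB : InHull T B v) : InHull T C v := by
  obtain ⟨x, hx, y, hy, hb⟩ := hB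
  exact ⟨x, h hx, y, h hy, hb⟩

def HD (T : UnrootedBinaryTree V X) (P : Finset (Finset X)) : Prop :=
  ∀ B ∈ P, ∀ C ∈ P, B ≠ C → ∀ v, InHull T B v → ¬ InHull T C v

lemma HD.subset {T : UnrootedBinaryTree V X} {P P' : Finset (Finset X)} (h : HD T P)
    (hs : P' ⊆ P) : HD T P' :=
  fun B hB C hC => h B (hs hB) C (hs hC)

lemma HD.shrink {T : UnrootedBinaryTree V X} {B B' : Finset X} {Q Q' : Finset (Finset X)}
    (h : HD T (insert B Q)) (hB : B ∉ Q) (hB' : B' ⊆ B) (hQ : Q' ⊆ Q) :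
    HD T (insert B' Q') := by
  intro C hC D hD hne v hv hv'
  rcases Finset.mem_insert.1 hC with e1 | hC1 <;> rcases Finset.mem_insert.1 hD with e2 | hD1
  · exact hne (e1.trans e2.symm)
  · subst e1
    exact h B (by simp) D (by simp [hQ hD1]) (fun e => hB (e ▸ hQ hD1)) v (hv.mono hB') hv'
  · subst e2
    exact h B (by simp) C (by simp [hQ hC1]) (fun e => hB (e ▸ hQ hC1)) v (hv'.mono hB') hv
  · exact h C (by simp [hQ hC1]) D (by simp [hQ hD1]) hne v hv hv'

lemma part_restrict1 {A1 A2 : Finset X} {P : Finset (Finset X)} (hd : Disjoint A1 A2)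
    (h : Part (A1 ∪ A2) P) (hnc : ∀ C ∈ P, C ⊆ A1 ∨ C ⊆ A2) :
    Part A1 (P.filter (· ⊆ A1)) := by
  have hd' := Finset.disjoint_left.1 hd
  refine ⟨fun B hB => h.1 B (Finset.mem_filter.1 hB).1, fun B hB C hC =>
    h.2.1 B (Finset.mem_filter.1 hB).1 C (Finset.mem_filter.1 hC).1, fun x => ⟨fun hx => ?_, ?_⟩⟩
  · obtain ⟨B, hB, hxB⟩ := (h.2.2 x).1 (by simp [hx])
    refine ⟨B, Finset.mem_filter.2 ⟨hB, ?_⟩, hxB⟩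
    rcases hnc B hB with h' | h'
    · exact h'
    · exact absurd (h' hxB) (hd' hx)
  · rintro ⟨B, hB, hx⟩
    exact (Finset.mem_filter.1 hB).2 hx

lemma part_restrict2 {A1 A2 : Finset X} {B : Finset X} {Q : Finset (Finset X)}
    (hd : Disjoint A1 A2)
    (h : Part (A1 ∪ A2) (insert B Q)) (hB : B ∉ Q) (hne : (B ∩ A1).Nonempty)
    (hnc : ∀ C ∈ Q, C ⊆ A1 ∨ C ⊆ A2) :
    Part A1 (insert (B ∩ A1) (Q.filter (· ⊆ A1))) ∧ B ∩ A1 ∉ Q.filter (· ⊆ A1) := by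
  have hd' := Finset.disjoint_left.1 hd
  have hBC : ∀ C ∈ Q.filter (· ⊆ A1), Disjoint (B ∩ A1) C := by
    intro C hC
    have hCQ := (Finset.mem_filter.1 hC).1
    exact (h.2.1 B (by simp) C (by simp [hCQ]) (fun e => hB (e ▸ hCQ))).mono_left
      Finset.inter_subset_left
  refine ⟨⟨?_, ?_, ?_⟩, ?_⟩
  · intro C hC
    rcases Finset.mem_insert.1 hC with rfl | hC
    · exact hne
    · exact h.1 C (by simp [(Finset.mem_filter.1 hC).1])
  · intro C hC D hD hne'
    rcases Finset.mem_insert.1 hC with rfl | hC <;> rcases Finset.mem_insert.1 hD with rfl | hD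
    · exact absurd rfl hne'
    · exact hBC D hD
    · exact (hBC C hC).symm
    · exact h.2.1 C (by simp [(Finset.mem_filter.1 hC).1]) D
        (by simp [(Finset.mem_filter.1 hD).1]) hne'
  · intro x
    constructor
    · intro hx
      obtain ⟨C, hC, hxC⟩ := (h.2.2 x).1 (by simp [hx])
      rcases Finset.mem_insert.1 hC with rfl | hC
      · exact ⟨_, Finset.mem_insert_self _ _, by simp [hx, hxC]⟩
      · refine ⟨C, Finset.mem_insert_of_mem (Finset.mem_filter.2 ⟨hC, ?_⟩), hxC⟩
        rcases hnc C hC with h' | h'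
        · exact h'
        · exact absurd (h' hxC) (hd' hx)
    · rintro ⟨C, hC, hx⟩
      rcases Finset.mem_insert.1 hC with rfl | hC
      · exact (Finset.mem_inter.1 hx).2
      · exact (Finset.mem_filter.1 hC).2 hx
  · intro hmem
    have := hBC _ hmem
    rw [disjoint_self] at this
    simp [this] at hne

lemma filter_union_eq {A1 A2 : Finset X} {Q : Finset (Finset X)}
    (hnc : ∀ C ∈ Q, C ⊆ A1 ∨ C ⊆ A2) :
    Q = Q.filter (· ⊆ A1) ∪ Q.filter (· ⊆ A2) := by
  ext C
  have := hnc C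
  simp only [Finset.mem_union, Finset.mem_filter]
  tauto

lemma cross_exists {A1 A2 C : Finset X} (hC : C ⊆ A1 ∪ A2) (h : ¬ (C ⊆ A1 ∨ C ⊆ A2)) :
    (C ∩ A1).Nonempty ∧ (C ∩ A2).Nonempty := by
  push Not at h
  obtain ⟨x, hx, hx'⟩ := Finset.not_subset.1 h.1
  obtain ⟨y, hy, hy'⟩ := Finset.not_subset.1 h.2
  have := hC hx
  have := hC hy
  simp only [Finset.mem_union] at *
  exact ⟨⟨y, by simp; tauto⟩, ⟨x, by simp; tauto⟩⟩

def Sep (T : UnrootedBinaryTree V X) (A1 A2 : Finset X) (z : V) : Prop :=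
  ∀ x ∈ A1, ∀ y ∈ A2, Btw T.graph (T.label x) z (T.label y)

lemma Sep.symm {T : UnrootedBinaryTree V X} {A1 A2 : Finset X} {z : V} (h : Sep T A1 A2 z) :
    Sep T A2 A1 z := fun x hx y hy => (h y hy x hx).symm

lemma Sep.inHull {T : UnrootedBinaryTree V X} {A1 A2 : Finset X} {z : V} (h : Sep T A1 A2 z)
    {C : Finset X} (hC : C ⊆ A1 ∪ A2) (hc : ¬ (C ⊆ A1 ∨ C ⊆ A2)) : InHull T C z := by
  obtain ⟨⟨x, hx⟩, ⟨y, hy⟩⟩ := cross_exists hC hc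
  rw [Finset.mem_inter] at hx hy
  exact ⟨x, hx.1, y, hy.1, h x hx.2 y hy.2⟩

def Reach (T : UnrootedBinaryTree V X) (c : V) (B : Finset X) (Q : Finset (Finset X)) : Prop :=
  ∀ x ∈ B, ∀ v, Btw T.graph (T.label x) v c → ∀ C ∈ Q, ¬ InHull T C v

def IHF (T : UnrootedBinaryTree V X) (A : Finset X) (t : BT X) : Prop :=
  ∀ P, Part A P → HD T P → P ∈ (ch t).1

def IHG (T : UnrootedBinaryTree V X) (A : Finset X) (c : V) (t : BT X) : Prop :=
  ∀ B Q, Part A (insert B Q) → B ∉ Q → HD T (insert B Q) → Reach T c B Q → (B, Q) ∈ (ch t).2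

lemma use_ihg {T : UnrootedBinaryTree V X} {A1 A2 : Finset X} {c1 : V} {l : BT X}
    (hd : Disjoint A1 A2) (g1 : IHG T A1 c1 l)
    {B : Finset X} {Q : Finset (Finset X)} (hP : Part (A1 ∪ A2) (insert B Q)) (hB : B ∉ Q)
    (hH : HD T (insert B Q)) (hne : (B ∩ A1).Nonempty)
    (hnc : ∀ C ∈ Q, C ⊆ A1 ∨ C ⊆ A2) (hr : Reach T c1 (B ∩ A1) Q) :
    (B ∩ A1, Q.filter (· ⊆ A1)) ∈ (ch l).2 := by
  obtain ⟨p1, p2⟩ := part_restrict2 hd hP hB hne hnc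
  exact g1 _ _ p1 p2 (hH.shrink hB Finset.inter_subset_left (Finset.filter_subset _ _))
    (fun x hx v hv C hC => hr x hx v hv C (Finset.mem_filter.1 hC).1)

lemma reach_of_sep {T : UnrootedBinaryTree V X} {A1 A2 : Finset X} {c1 : V}
    (s1 : Sep T A1 A2 c1) {B : Finset X} {Q : Finset (Finset X)} (hB : B ∉ Q)
    (hH : HD T (insert B Q)) (hne : (B ∩ A2).Nonempty) : Reach T c1 (B ∩ A1) Q := by
  intro x hx v hv C hC
  obtain ⟨y, hy⟩ := hne
  rw [Finset.mem_inter] at hx hy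
  exact hH B (by simp) C (by simp [hC]) (fun e => hB (e ▸ hC)) v
    ⟨x, hx.1, y, hy.1, hv.trans (s1 x hx.2 y hy.2)⟩

lemma stepF {T : UnrootedBinaryTree V X} {A1 A2 : Finset X} {c1 c2 : V} {l r : BT X}
    (hd : Disjoint A1 A2) (f1 : IHF T A1 l) (g1 : IHG T A1 c1 l)
    (f2 : IHF T A2 r) (g2 : IHG T A2 c2 r)
    (s1 : Sep T A1 A2 c1) (s2 : Sep T A1 A2 c2) : IHF T (A1 ∪ A2) (.node l r) := by
  intro P hP hH
  rw [mem_ch1_node]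
  by_cases hc : ∀ C ∈ P, C ⊆ A1 ∨ C ⊆ A2
  · left
    refine ⟨P.filter (· ⊆ A1), f1 _ (part_restrict1 hd hP hc)
      (hH.subset (Finset.filter_subset _ _)), P.filter (· ⊆ A2),
      f2 _ (part_restrict1 hd.symm (by rwa [Finset.union_comm]) (fun C hC => (hc C hC).symm))
      (hH.subset (Finset.filter_subset _ _)), filter_union_eq hc⟩
  · right
    push Not at hc
    obtain ⟨B, hB, hB1⟩ := hc
    have hBc : ¬ (B ⊆ A1 ∨ B ⊆ A2) := by tauto
    have hBs := (hP.ns B hB).2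
    obtain ⟨n1, n2⟩ := cross_exists hBs hBc
    obtain ⟨Q, hBQ, rfl⟩ : ∃ Q, B ∉ Q ∧ P = insert B Q :=
      ⟨P.erase B, by simp, (Finset.insert_erase hB).symm⟩
    have hnc : ∀ C ∈ Q, C ⊆ A1 ∨ C ⊆ A2 := by
      intro C hC
      by_contra hcc
      exact hH B (by simp) C (by simp [hC]) (fun e => hBQ (e ▸ hC)) c1
        (s1.inHull hBs hBc) (s1.inHull (hP.ns C (by simp [hC])).2 hcc)
    refine ⟨_, _, _, _, use_ihg hd g1 hP hBQ hH n1 hnc (reach_of_sep s1 hBQ hH n2),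
      use_ihg hd.symm g2 (by rwa [Finset.union_comm]) hBQ hH n2 (fun C hC => (hnc C hC).symm)
      (reach_of_sep s2.symm hBQ hH n1), ?_⟩
    rw [← filter_union_eq hnc, ← Finset.inter_union_distrib_left, Finset.inter_eq_left.2 hBs]

lemma stepG {T : UnrootedBinaryTree V X} {A1 A2 : Finset X} {c1 c2 z : V} {l r : BT X}
    (hd : Disjoint A1 A2) (f1 : IHF T A1 l) (g1 : IHG T A1 c1 l)
    (f2 : IHF T A2 r) (g2 : IHG T A2 c2 r) (sz : Sep T A1 A2 z)
    (b1 : ∀ x ∈ A1, Btw T.graph (T.label x) c1 z)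
    (b2 : ∀ x ∈ A2, Btw T.graph (T.label x) c2 z) : IHG T (A1 ∪ A2) z (.node l r) := by
  intro B Q hP hB hH hR
  rw [mem_ch2_node]
  have hBns := hP.ns B (by simp)
  have hP' : Part (A2 ∪ A1) (insert B Q) := by rwa [Finset.union_comm]
  have hnc : ∀ C ∈ Q, C ⊆ A1 ∨ C ⊆ A2 := by
    intro C hC
    by_contra hcc
    obtain ⟨x, hx⟩ := hBns.1
    exact hR x hx z (fun w => w.end_mem_support) C hC
      (sz.inHull (hP.ns C (by simp [hC])).2 hcc)
  have hnc' : ∀ C ∈ Q, C ⊆ A2 ∨ C ⊆ A1 := fun C hC => (hnc C hC).symm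
  have r1 : Reach T c1 (B ∩ A1) Q := fun x hx v hv C hC =>
    hR x (Finset.mem_inter.1 hx).1 v (hv.trans (b1 x (Finset.mem_inter.1 hx).2)) C hC
  have r2 : Reach T c2 (B ∩ A2) Q := fun x hx v hv C hC =>
    hR x (Finset.mem_inter.1 hx).1 v (hv.trans (b2 x (Finset.mem_inter.1 hx).2)) C hC
  by_cases hc1 : B ⊆ A1
  · left
    have e : B ∩ A1 = B := Finset.inter_eq_left.2 hc1
    have n2 : ¬ B ⊆ A2 := fun h => NS.disj hd ⟨hBns.1, hc1⟩ ⟨hBns.1, h⟩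
    have m1 := use_ihg hd g1 hP hB hH (by rw [e]; exact hBns.1) hnc r1
    rw [e] at m1
    refine ⟨_, Q.filter (· ⊆ A2), m1, ?_, filter_union_eq hnc⟩
    have := part_restrict1 hd.symm hP' (by
      intro C hC
      rcases Finset.mem_insert.1 hC with rfl | hC
      · exact Or.inr hc1
      · exact hnc' C hC)
    rw [Finset.filter_insert, if_neg n2] at this
    exact f2 _ this (hH.subset ((Finset.filter_subset _ _).trans (Finset.subset_insert _ _)))
  by_cases hc2 : B ⊆ A2
  · right; left
    have e : B ∩ A2 = B := Finset.inter_eq_left.2 hc2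
    have m1 := use_ihg hd.symm g2 hP' hB hH (by rw [e]; exact hBns.1) hnc' r2
    rw [e] at m1
    refine ⟨Q.filter (· ⊆ A1), _, ?_, m1, filter_union_eq hnc⟩
    have := part_restrict1 hd hP (by
      intro C hC
      rcases Finset.mem_insert.1 hC with rfl | hC
      · exact Or.inr hc2
      · exact hnc C hC)
    rw [Finset.filter_insert, if_neg hc1] at this
    exact f1 _ this (hH.subset ((Finset.filter_subset _ _).trans (Finset.subset_insert _ _)))
  · right; right
    obtain ⟨n1, n2⟩ := cross_exists hBns.2 (by tauto)
    refine ⟨_, _, _, _, use_ihg hd g1 hP hB hH n1 hnc r1,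
      use_ihg hd.symm g2 hP' hB hH n2 hnc' r2, ?_, filter_union_eq hnc⟩
    rw [← Finset.inter_union_distrib_left, Finset.inter_eq_left.2 hBns.2]

/-- A vertex set `S` hanging off `p` through the edge `r - p`. -/
structure Good (T : UnrootedBinaryTree V X) (p r : V) (S : Set V) : Prop where
  adj : T.graph.Adj r p
  pn : p ∉ S
  rm : r ∈ S
  bd : ∀ a ∈ S, ∀ b ∉ S, T.graph.Adj a b → a = r ∧ b = p

lemma Good.btw {T : UnrootedBinaryTree V X} {p r : V} {S : Set V} (g : Good T p r S) {a b : V}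
    (ha : a ∈ S) (hb : b ∉ S) : Btw T.graph a r b ∧ Btw T.graph a p b := by
  have key : ∀ w : T.graph.Walk a b, r ∈ w.support ∧ p ∈ w.support := by
    intro w
    obtain ⟨d, hd, h1, h2⟩ := w.exists_boundary_dart S ha hb
    obtain ⟨e1, e2⟩ := g.bd _ h1 _ h2 d.adj
    exact ⟨e1 ▸ w.dart_fst_mem_support_of_mem_darts hd,
      e2 ▸ w.dart_snd_mem_support_of_mem_darts hd⟩
  exact ⟨fun w => (key w).1, fun w => (key w).2⟩

inductive Rep (T : UnrootedBinaryTree V X) : V → V → Set V → BT X → Prop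
  | leaf (p : V) (x : X) (g : Good T p (T.label x) {T.label x}) :
      Rep T p (T.label x) {T.label x} (.leaf x)
  | node (p r c1 c2 : V) (S1 S2 : Set V) (t1 t2 : BT X)
      (g : Good T p r (insert r (S1 ∪ S2)))
      (h1 : Rep T r c1 S1 t1) (h2 : Rep T r c2 S2 t2) (hd : Disjoint S1 S2)
      (hl : ∀ x, T.label x ≠ r) : Rep T p r (insert r (S1 ∪ S2)) (.node t1 t2)

lemma Rep.good {T : UnrootedBinaryTree V X} {p r : V} {S : Set V} {t : BT X}
    (h : Rep T p r S t) : Good T p r S := by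
  cases h <;> assumption

lemma Rep.mem {T : UnrootedBinaryTree V X} {p r : V} {S : Set V} {t : BT X}
    (h : Rep T p r S t) : ∀ x, T.label x ∈ S ↔ x ∈ lv t := by
  induction h with
  | leaf p x g =>
    intro y
    simp [lv, T.label_inj.eq_iff]
  | node p r c1 c2 S1 S2 t1 t2 g h1 h2 hd hl ih1 ih2 =>
    intro x
    simp [lv, hl x, ih1 x, ih2 x]

lemma lv_disj {T : UnrootedBinaryTree V X} {p r p' r' : V} {S S' : Set V} {t t' : BT X}
    (h : Rep T p r S t) (h' : Rep T p' r' S' t') (hd : Disjoint S S') :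
    Disjoint (lv t) (lv t') := by
  rw [Finset.disjoint_left]
  intro x hx hx'
  exact Set.disjoint_left.1 hd ((h.mem x).2 hx) ((h'.mem x).2 hx')

lemma Rep.valid {T : UnrootedBinaryTree V X} {p r : V} {S : Set V} {t : BT X}
    (h : Rep T p r S t) : Valid t := by
  induction h with
  | leaf p x g => trivial
  | node p r c1 c2 S1 S2 t1 t2 g h1 h2 hd hl ih1 ih2 => exact ⟨ih1, ih2, lv_disj h1 h2 hd⟩

lemma Rep.sep {T : UnrootedBinaryTree V X} {p r p' r' : V} {S S' : Set V} {t t' : BT X}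
    (h : Rep T p r S t) (h' : Rep T p' r' S' t') (hd : Disjoint S S') :
    Sep T (lv t) (lv t') r ∧ Sep T (lv t) (lv t') p := by
  have : ∀ x ∈ lv t, ∀ y ∈ lv t', T.label x ∈ S ∧ T.label y ∉ S := fun x hx y hy =>
    ⟨(h.mem x).2 hx, fun hh => Set.disjoint_left.1 hd hh ((h'.mem y).2 hy)⟩
  exact ⟨fun x hx y hy => (h.good.btw (this x hx y hy).1 (this x hx y hy).2).1,
    fun x hx y hy => (h.good.btw (this x hx y hy).1 (this x hx y hy).2).2⟩

lemma Rep.bwd {T : UnrootedBinaryTree V X} {p r : V} {S : Set V} {t : BT X}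
    (h : Rep T p r S t) : IHF T (lv t) t ∧ IHG T (lv t) r t := by
  induction h with
  | leaf p x g =>
    have key : ∀ P, Part {x} P → P = {({x} : Finset X)} := by
      intro P hP
      have h1 : ∀ C ∈ P, C = {x} := by
        intro C hC
        have := hP.ns C hC
        exact (Finset.Nonempty.subset_singleton_iff this.1).1 this.2
      ext C
      constructor
      · intro hC; simp [h1 C hC]
      · intro hC
        obtain ⟨D, hD, -⟩ := (hP.2.2 x).1 (by simp)
        rw [Finset.mem_singleton.1 hC, ← h1 D hD]
        exact hD
    constructor
    · intro P hP _
      simp [ch, key P hP]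
    · intro B Q hP hB _ _
      have := key _ hP
      have hBx : B = {x} := by
        have : B ∈ insert B Q := by simp
        simpa [key _ hP] using this
      have hQ : Q = ∅ := by
        rw [Finset.eq_empty_iff_forall_notMem]
        intro C hC
        have : C ∈ insert B Q := by simp [hC]
        rw [key _ hP, Finset.mem_singleton] at this
        exact hB (by rw [hBx, ← this]; exact hC)
      simp [ch, hBx, hQ]
  | node p r c1 c2 S1 S2 t1 t2 g h1 h2 hd hl ih1 ih2 =>
    have s1 := h1.sep h2 hd
    have s2 := h2.sep h1 hd.symm
    have hdl := lv_disj h1 h2 hd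
    exact ⟨stepF hdl ih1.1 ih1.2 ih2.1 ih2.2 s1.1 s2.1.symm,
      stepG hdl ih1.1 ih1.2 ih2.1 ih2.2 s1.2
        (fun x hx => (h1.good.btw ((h1.mem x).2 hx) h1.good.pn).1)
        (fun x hx => (h2.good.btw ((h2.mem x).2 hx) h2.good.pn).1)⟩

end

section
open Classical
variable {V X : Type}

def cg (T : UnrootedBinaryTree V X) (h : V → Finset X) (S : Set V) : SimpleGraph V where
  Adj a b := T.graph.Adj a b ∧ a ∈ S ∧ b ∈ S ∧ h a = h b
  symm := ⟨fun _ _ hh => ⟨hh.1.symm, hh.2.2.1, hh.2.1, hh.2.2.2.symm⟩⟩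
  loopless := ⟨fun _ hh => hh.1.ne rfl⟩

lemma cg_mono {T : UnrootedBinaryTree V X} {h h' : V → Finset X} {S S' : Set V} (hS : S ⊆ S')
    (hh : ∀ a ∈ S, ∀ b ∈ S, h a = h b → h' a = h' b) : cg T h S ≤ cg T h' S' := by
  intro a b hab
  exact ⟨hab.1, hS hab.2.1, hS hab.2.2.1, hh a hab.2.1 b hab.2.2.1 hab.2.2.2⟩

def Full (T : UnrootedBinaryTree V X) (S : Set V) (P : Finset (Finset X)) (h : V → Finset X) :
    Prop :=
  (∀ v ∈ S, h v ∈ P) ∧ (∀ B ∈ P, ∀ x ∈ B, h (T.label x) = B) ∧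
  ∀ u ∈ S, ∀ v ∈ S, h u = h v → (cg T h S).Reachable u v

def Join (T : UnrootedBinaryTree V X) (S S1 S2 : Set V) (c1 c2 : V) : Prop :=
  (S = S1 ∪ S2 ∧ T.graph.Adj c1 c2) ∨
  ∃ z, z ∉ S1 ∧ z ∉ S2 ∧ S = insert z (S1 ∪ S2) ∧ T.graph.Adj z c1 ∧ T.graph.Adj z c2

lemma conn_glue {T : UnrootedBinaryTree V X} {S S1 S2 : Set V} {c1 c2 : V}
    {h h1 h2 : V → Finset X} (hS1 : S1 ⊆ S) (hS2 : S2 ⊆ S) (hc1 : c1 ∈ S1) (hc2 : c2 ∈ S2)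
    (i1 : ∀ a ∈ S1, ∀ b ∈ S1, h a = h b ↔ h1 a = h1 b)
    (i2 : ∀ a ∈ S2, ∀ b ∈ S2, h a = h b ↔ h2 a = h2 b)
    (k1 : ∀ u ∈ S1, ∀ v ∈ S1, h1 u = h1 v → (cg T h1 S1).Reachable u v)
    (k2 : ∀ u ∈ S2, ∀ v ∈ S2, h2 u = h2 v → (cg T h2 S2).Reachable u v)
    (cross : ∀ u ∈ S1, ∀ v ∈ S2, h u = h v → h u = h c1 ∧ h v = h c2)
    (link : h c1 = h c2 → (cg T h S).Reachable c1 c2)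
    (rest : ∀ v ∈ S, v ∈ S1 ∨ v ∈ S2 ∨ (h v = h c1 ∧ (cg T h S).Reachable v c1) ∨
      (h v = h c2 ∧ (cg T h S).Reachable v c2)) :
    ∀ u ∈ S, ∀ v ∈ S, h u = h v → (cg T h S).Reachable u v := by
  have k1' : ∀ u ∈ S1, ∀ v ∈ S1, h u = h v → (cg T h S).Reachable u v := fun u hu v hv e =>
    (k1 u hu v hv ((i1 u hu v hv).1 e)).mono (cg_mono hS1 (fun a ha b hb => (i1 a ha b hb).2))
  have k2' : ∀ u ∈ S2, ∀ v ∈ S2, h u = h v → (cg T h S).Reachable u v := fun u hu v hv e =>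
    (k2 u hu v hv ((i2 u hu v hv).1 e)).mono (cg_mono hS2 (fun a ha b hb => (i2 a ha b hb).2))
  have k12 : ∀ u ∈ S1, ∀ v ∈ S2, h u = h v → (cg T h S).Reachable u v := by
    intro u hu v hv e
    obtain ⟨e1, e2⟩ := cross u hu v hv e
    exact ((k1' u hu c1 hc1 e1).trans (link (by rw [← e1, ← e2, e]))).trans
      (k2' v hv c2 hc2 e2).symm
  have kk : ∀ u, (u ∈ S1 ∨ u ∈ S2) → ∀ v, (v ∈ S1 ∨ v ∈ S2) → h u = h v →
      (cg T h S).Reachable u v := by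
    rintro u (hu | hu) v (hv | hv) e
    · exact k1' u hu v hv e
    · exact k12 u hu v hv e
    · exact (k12 v hv u hu e.symm).symm
    · exact k2' u hu v hv e
  have rr : ∀ v ∈ S, ∃ v', (v' ∈ S1 ∨ v' ∈ S2) ∧ h v = h v' ∧ (cg T h S).Reachable v v' := by
    intro v hv
    rcases rest v hv with h' | h' | h' | h'
    · exact ⟨v, Or.inl h', rfl, .refl v⟩
    · exact ⟨v, Or.inr h', rfl, .refl v⟩
    · exact ⟨c1, Or.inl hc1, h'⟩
    · exact ⟨c2, Or.inr hc2, h'⟩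
  intro u hu v hv e
  obtain ⟨u', hu', eu, ru⟩ := rr u hu
  obtain ⟨v', hv', ev, rv⟩ := rr v hv
  exact (ru.trans (kk u' hu' v' hv' (by rw [← eu, ← ev, e]))).trans rv.symm

lemma glue {T : UnrootedBinaryTree V X} {S S1 S2 : Set V} {c1 c2 : V}
    {h1 h2 : V → Finset X} {P P1 P2 : Finset (Finset X)} (hd : Disjoint S1 S2)
    (hc1 : c1 ∈ S1) (hc2 : c2 ∈ S2) (J : Join T S S1 S2 c1 c2)
    (F1 : Full T S1 P1 h1) (F2 : Full T S2 P2 h2) (f1 f2 : Finset X → Finset X) (c : Finset X)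
    (inj1 : ∀ B ∈ P1, ∀ C ∈ P1, f1 B = f1 C → B = C)
    (inj2 : ∀ B ∈ P2, ∀ C ∈ P2, f2 B = f2 C → B = C)
    (m1 : ∀ B ∈ P1, f1 B ∈ P) (m2 : ∀ B ∈ P2, f2 B ∈ P)
    (l1 : ∀ B ∈ P1, ∀ x ∈ B, T.label x ∈ S1) (l2 : ∀ B ∈ P2, ∀ x ∈ B, T.label x ∈ S2)
    (lab : ∀ B ∈ P, ∀ x ∈ B, (∃ C ∈ P1, x ∈ C ∧ f1 C = B) ∨ (∃ C ∈ P2, x ∈ C ∧ f2 C = B))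
    (cross : ∀ B ∈ P1, ∀ C ∈ P2, f1 B = f2 C → B = h1 c1 ∧ C = h2 c2)
    (hc : c = f1 (h1 c1) ∨ c = f2 (h2 c2)) :
    ∃ h, Full T S P h ∧ ∀ v, v ∉ S1 → v ∉ S2 → h v = c := by
  obtain ⟨h, hh⟩ : ∃ h : V → Finset X,
    h = fun v => if v ∈ S1 then f1 (h1 v) else if v ∈ S2 then f2 (h2 v) else c := ⟨_, rfl⟩
  have e1 : ∀ v ∈ S1, h v = f1 (h1 v) := fun v hv => by simp [hh, hv]
  have e2 : ∀ v ∈ S2, h v = f2 (h2 v) := fun v hv => by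
    simp [hh, hv, Set.disjoint_right.1 hd hv]
  have e3 : ∀ v, v ∉ S1 → v ∉ S2 → h v = c := fun v hv hv' => by simp [hh, hv, hv']
  have hS1 : S1 ⊆ S := by
    rcases J with ⟨rfl, _⟩ | ⟨z, _, _, rfl, _⟩ <;> intro v hv <;> simp [hv]
  have hS2 : S2 ⊆ S := by
    rcases J with ⟨rfl, _⟩ | ⟨z, _, _, rfl, _⟩ <;> intro v hv <;> simp [hv]
  have hc' : c = h c1 ∨ c = h c2 := by rwa [e1 c1 hc1, e2 c2 hc2]
  refine ⟨h, ⟨?_, ?_, ?_⟩, e3⟩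
  · have q1 : h c1 ∈ P := by rw [e1 _ hc1]; exact m1 _ (F1.1 _ hc1)
    have q2 : h c2 ∈ P := by rw [e2 _ hc2]; exact m2 _ (F2.1 _ hc2)
    intro v hv
    by_cases v1 : v ∈ S1
    · rw [e1 v v1]; exact m1 _ (F1.1 v v1)
    by_cases v2 : v ∈ S2
    · rw [e2 v v2]; exact m2 _ (F2.1 v v2)
    rw [e3 v v1 v2]
    rcases hc' with h' | h' <;> rw [h'] <;> assumption
  · intro B hB x hx
    rcases lab B hB x hx with ⟨C, hC, hxC, rfl⟩ | ⟨C, hC, hxC, rfl⟩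
    · rw [e1 _ (l1 C hC x hxC), F1.2.1 C hC x hxC]
    · rw [e2 _ (l2 C hC x hxC), F2.2.1 C hC x hxC]
  · refine conn_glue hS1 hS2 hc1 hc2 ?_ ?_ F1.2.2 F2.2.2 ?_ ?_ ?_
    · intro a ha b hb
      rw [e1 a ha, e1 b hb]
      exact ⟨inj1 _ (F1.1 a ha) _ (F1.1 b hb), fun e => by rw [e]⟩
    · intro a ha b hb
      rw [e2 a ha, e2 b hb]
      exact ⟨inj2 _ (F2.1 a ha) _ (F2.1 b hb), fun e => by rw [e]⟩
    · intro u hu v hv e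
      rw [e1 u hu, e2 v hv] at e
      obtain ⟨q1, q2⟩ := cross _ (F1.1 u hu) _ (F2.1 v hv) e
      rw [e1 u hu, e1 c1 hc1, e2 v hv, e2 c2 hc2, q1, q2]
      exact ⟨rfl, rfl⟩
    · intro e
      rcases J with ⟨rfl, a⟩ | ⟨z, z1, z2, rfl, a1, a2⟩
      · exact SimpleGraph.Adj.reachable ⟨a, by simp [hc1], by simp [hc2], e⟩
      · have hz := e3 z z1 z2
        have q1 : h z = h c1 := by rw [hz]; rcases hc' with h' | h' <;> rw [h']; exact e.symm
        have q2 : h z = h c2 := by rw [q1, e]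
        have t1 : (cg T h (insert z (S1 ∪ S2))).Adj z c1 := ⟨a1, by simp, by simp [hc1], q1⟩
        have t2 : (cg T h (insert z (S1 ∪ S2))).Adj z c2 := ⟨a2, by simp, by simp [hc2], q2⟩
        exact t1.reachable.symm.trans t2.reachable
    · intro v hv
      rcases J with ⟨rfl, a⟩ | ⟨z, z1, z2, rfl, a1, a2⟩
      · rcases hv with hv | hv <;> simp [hv]
      · rcases hv with rfl | hv | hv
        · right; right
          have hz := e3 v z1 z2
          rw [← hz] at hc'
          rcases hc' with h' | h'
          · exact Or.inl ⟨h', SimpleGraph.Adj.reachable ⟨a1, by simp, by simp [hc1], h'⟩⟩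
          · exact Or.inr ⟨h', SimpleGraph.Adj.reachable ⟨a2, by simp, by simp [hc2], h'⟩⟩
        · simp [hv]
        · simp [hv]

lemma glue_id {T : UnrootedBinaryTree V X} {S S1 S2 : Set V} {c1 c2 : V} {A1 A2 : Finset X}
    {h1 h2 : V → Finset X} {P1 P2 : Finset (Finset X)} (hd : Disjoint S1 S2)
    (hdA : Disjoint A1 A2)
    (hA1 : ∀ x ∈ A1, T.label x ∈ S1) (hA2 : ∀ x ∈ A2, T.label x ∈ S2)
    (p1 : Part A1 P1) (p2 : Part A2 P2)
    (hc1 : c1 ∈ S1) (hc2 : c2 ∈ S2) (J : Join T S S1 S2 c1 c2)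
    (F1 : Full T S1 P1 h1) (F2 : Full T S2 P2 h2) (c : Finset X)
    (hc : c = h1 c1 ∨ c = h2 c2) :
    ∃ h, Full T S (P1 ∪ P2) h ∧ ∀ v, v ∉ S1 → v ∉ S2 → h v = c := by
  refine glue hd hc1 hc2 J F1 F2 id id c (fun _ _ _ _ e => e) (fun _ _ _ _ e => e)
    (fun B hB => by simp [hB]) (fun B hB => by simp [hB])
    (fun B hB x hx => hA1 x ((p1.ns B hB).2 hx)) (fun B hB x hx => hA2 x ((p2.ns B hB).2 hx))
    ?_ ?_ hc
  · intro B hB x hx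
    rcases Finset.mem_union.1 hB with h | h
    · exact Or.inl ⟨B, h, hx, rfl⟩
    · exact Or.inr ⟨B, h, hx, rfl⟩
  · intro B hB C hC e
    obtain rfl : B = C := e
    exact absurd (p2.ns B hC) (NS.disj hdA (p1.ns B hB))

lemma glue_merge {T : UnrootedBinaryTree V X} {S S1 S2 : Set V} {c1 c2 : V} {A1 A2 : Finset X}
    {h1 h2 : V → Finset X} {B1 B2 : Finset X} {Q1 Q2 : Finset (Finset X)} (hd : Disjoint S1 S2)
    (hdA : Disjoint A1 A2)
    (hA1 : ∀ x ∈ A1, T.label x ∈ S1) (hA2 : ∀ x ∈ A2, T.label x ∈ S2)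
    (p1 : Part A1 (insert B1 Q1)) (p2 : Part A2 (insert B2 Q2)) (hB1 : B1 ∉ Q1) (hB2 : B2 ∉ Q2)
    (hc1 : c1 ∈ S1) (hc2 : c2 ∈ S2) (J : Join T S S1 S2 c1 c2)
    (F1 : Full T S1 (insert B1 Q1) h1) (F2 : Full T S2 (insert B2 Q2) h2)
    (k1 : h1 c1 = B1) (k2 : h2 c2 = B2) :
    ∃ h, Full T S (insert (B1 ∪ B2) (Q1 ∪ Q2)) h ∧ ∀ v, v ∉ S1 → v ∉ S2 → h v = B1 ∪ B2 := by
  have n1 := p1.ns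
  have n2 := p2.ns
  have nn := NS.union_not hdA (n1 B1 (by simp)) (n2 B2 (by simp))
  have a1 : ∀ C ∈ insert B1 Q1, C ≠ B1 ∪ B2 := fun C hC e => nn.1 (e ▸ n1 C hC)
  have a2 : ∀ C ∈ insert B2 Q2, C ≠ B1 ∪ B2 := fun C hC e => nn.2 (e ▸ n2 C hC)
  have a3 : ∀ B ∈ insert B1 Q1, ∀ C ∈ insert B2 Q2, B ≠ C := fun B hB C hC e =>
    NS.disj hdA (n1 B hB) (e ▸ n2 C hC)
  refine glue hd hc1 hc2 J F1 F2 (fun C => if C = B1 then B1 ∪ B2 else C)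
    (fun C => if C = B2 then B1 ∪ B2 else C) (B1 ∪ B2) ?_ ?_ ?_ ?_
    (fun B hB x hx => hA1 x ((p1.ns B hB).2 hx)) (fun B hB x hx => hA2 x ((p2.ns B hB).2 hx))
    ?_ ?_ ?_
  · intro B hB C hC e
    have := a1 B hB; have := a1 C hC
    grind
  · intro B hB C hC e
    have := a2 B hB; have := a2 C hC
    grind
  · intro B hB
    grind
  · intro B hB
    grind
  · intro B hB x hx
    rcases Finset.mem_insert.1 hB with rfl | h
    · rcases Finset.mem_union.1 hx with h | h
      · exact Or.inl ⟨B1, by simp, h, by simp⟩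
      · exact Or.inr ⟨B2, by simp, h, by simp⟩
    · rcases Finset.mem_union.1 h with h | h
      · exact Or.inl ⟨B, by simp [h], hx, by
          have hne : B ≠ B1 := fun e => hB1 (e ▸ h)
          simp [hne]⟩
      · exact Or.inr ⟨B, by simp [h], hx, by
          have hne : B ≠ B2 := fun e => hB2 (e ▸ h)
          simp [hne]⟩
  · intro B hB C hC e
    have := a1 B hB; have := a2 C hC; have := a3 B hB C hC
    grind
  · simp [k1]

def FwdF (T : UnrootedBinaryTree V X) (S : Set V) (t : BT X) : Prop :=
  ∀ P ∈ (ch t).1, ∃ h, Full T S P h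

def FwdG (T : UnrootedBinaryTree V X) (S : Set V) (r : V) (t : BT X) : Prop :=
  ∀ B Q, (B, Q) ∈ (ch t).2 → ∃ h, Full T S (insert B Q) h ∧ h r = B

lemma fstepF {T : UnrootedBinaryTree V X} {p1 c1 p2 c2 : V} {S S1 S2 : Set V} {t1 t2 : BT X}
    (h1 : Rep T p1 c1 S1 t1) (h2 : Rep T p2 c2 S2 t2) (hd : Disjoint S1 S2)
    (J : Join T S S1 S2 c1 c2) (f1 : FwdF T S1 t1) (g1 : FwdG T S1 c1 t1)
    (f2 : FwdF T S2 t2) (g2 : FwdG T S2 c2 t2) : FwdF T S (.node t1 t2) := by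
  intro P hP
  have q1 := ch_part t1 h1.valid
  have q2 := ch_part t2 h2.valid
  have hdA := lv_disj h1 h2 hd
  rcases mem_ch1_node.1 hP with ⟨P1, m1, P2, m2, rfl⟩ | ⟨B1, Q1, B2, Q2, m1, m2, rfl⟩
  · obtain ⟨k1, F1⟩ := f1 _ m1
    obtain ⟨k2, F2⟩ := f2 _ m2
    obtain ⟨h, hh, -⟩ := glue_id hd hdA (fun x => (h1.mem x).2) (fun x => (h2.mem x).2)
      (q1.1 _ m1) (q2.1 _ m2) h1.good.rm h2.good.rm J F1 F2 _ (Or.inl rfl)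
    exact ⟨h, hh⟩
  · obtain ⟨k1, F1, e1⟩ := g1 _ _ m1
    obtain ⟨k2, F2, e2⟩ := g2 _ _ m2
    obtain ⟨h, hh, -⟩ := glue_merge hd hdA (fun x => (h1.mem x).2) (fun x => (h2.mem x).2)
      (q1.2 _ _ m1).2 (q2.2 _ _ m2).2 (q1.2 _ _ m1).1 (q2.2 _ _ m2).1
      h1.good.rm h2.good.rm J F1 F2 e1 e2
    exact ⟨h, hh⟩

lemma Rep.fwd {T : UnrootedBinaryTree V X} {p r : V} {S : Set V} {t : BT X}
    (h : Rep T p r S t) : FwdF T S t ∧ FwdG T S r t := by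
  induction h with
  | leaf p x g =>
    have key : Full T {T.label x} {{x}} (fun _ => {x}) := by
      refine ⟨by simp, by simp, ?_⟩
      intro u hu v hv _
      rw [Set.mem_singleton_iff.1 hu, Set.mem_singleton_iff.1 hv]
    constructor
    · intro P hP
      simp only [ch, Finset.mem_singleton] at hP
      subst hP
      exact ⟨_, key⟩
    · intro B Q hP
      simp only [ch, Finset.mem_singleton, Prod.mk.injEq] at hP
      obtain ⟨rfl, rfl⟩ := hP
      exact ⟨_, key, rfl⟩
  | node p r c1 c2 S1 S2 t1 t2 g h1 h2 hd hl ih1 ih2 =>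
    have q1 := ch_part t1 h1.valid
    have q2 := ch_part t2 h2.valid
    have hdA := lv_disj h1 h2 hd
    have J : Join T (insert r (S1 ∪ S2)) S1 S2 c1 c2 :=
      Or.inr ⟨r, h1.good.pn, h2.good.pn, rfl, h1.good.adj.symm, h2.good.adj.symm⟩
    obtain ⟨f1, g1⟩ := ih1
    obtain ⟨f2, g2⟩ := ih2
    refine ⟨fstepF h1 h2 hd J f1 g1 f2 g2, ?_⟩
    intro B Q hP
    rcases mem_ch2_node.1 hP with ⟨Q1, Q2, m1, m2, rfl⟩ | ⟨Q1, Q2, m1, m2, rfl⟩ |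
        ⟨B1, Q1, B2, Q2, m1, m2, rfl, rfl⟩
    · obtain ⟨k1, F1, e1⟩ := g1 _ _ m1
      obtain ⟨k2, F2⟩ := f2 _ m2
      obtain ⟨h, hh, hr⟩ := glue_id hd hdA (fun x => (h1.mem x).2) (fun x => (h2.mem x).2)
        (q1.2 _ _ m1).2 (q2.1 _ m2) h1.good.rm h2.good.rm J F1 F2 B (Or.inl e1.symm)
      exact ⟨h, by rwa [Finset.insert_union] at hh, hr r h1.good.pn h2.good.pn⟩
    · obtain ⟨k1, F1⟩ := f1 _ m1
      obtain ⟨k2, F2, e2⟩ := g2 _ _ m2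
      obtain ⟨h, hh, hr⟩ := glue_id hd hdA (fun x => (h1.mem x).2) (fun x => (h2.mem x).2)
        (q1.1 _ m1) (q2.2 _ _ m2).2 h1.good.rm h2.good.rm J F1 F2 B (Or.inr e2.symm)
      exact ⟨h, by rwa [Finset.union_insert] at hh, hr r h1.good.pn h2.good.pn⟩
    · obtain ⟨k1, F1, e1⟩ := g1 _ _ m1
      obtain ⟨k2, F2, e2⟩ := g2 _ _ m2
      obtain ⟨h, hh, hr⟩ := glue_merge hd hdA (fun x => (h1.mem x).2) (fun x => (h2.mem x).2)
        (q1.2 _ _ m1).2 (q2.2 _ _ m2).2 (q1.2 _ _ m1).1 (q2.2 _ _ m2).1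
        h1.good.rm h2.good.rm J F1 F2 e1 e2
      exact ⟨h, hh, hr r h1.good.pn h2.good.pn⟩

/-- component of `r` in the tree with `p` removed -/
def comp (T : UnrootedBinaryTree V X) (p r : V) : Set V :=
  {v | ∃ w : T.graph.Walk r v, p ∉ w.support}

lemma comp_adj {T : UnrootedBinaryTree V X} {p r a : V} (hpr : T.graph.Adj r p)
    (ha : a ∈ comp T p r) (hap : T.graph.Adj a p) : a = r := by
  obtain ⟨w, hw⟩ := ha
  have hb : p ∉ w.bypass.support := fun h => hw (w.support_bypass_subset_support h)
  have q1 : (SimpleGraph.Walk.cons hpr.symm w.bypass).IsPath :=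
    (SimpleGraph.Walk.cons_isPath_iff _ _).2 ⟨w.bypass_isPath, hb⟩
  have q2 : (SimpleGraph.Walk.cons hap.symm SimpleGraph.Walk.nil).IsPath := by
    simp [SimpleGraph.Walk.cons_isPath_iff, hap.symm.ne]
  have := T.isTree.isAcyclic.path_unique ⟨_, q1⟩ ⟨_, q2⟩
  have := congrArg (fun q => q.1.length) this
  simp only [SimpleGraph.Walk.length_cons, SimpleGraph.Walk.length_nil] at this
  exact (SimpleGraph.Walk.eq_of_length_eq_zero (p := w.bypass) (by omega)).symm

lemma comp_good {T : UnrootedBinaryTree V X} {p r : V} (hpr : T.graph.Adj r p) :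
    Good T p r (comp T p r) := by
  refine ⟨hpr, ?_, ?_, ?_⟩
  · rintro ⟨w, hw⟩
    exact hw w.end_mem_support
  · exact ⟨.nil, by simpa using hpr.ne.symm⟩
  · intro a ha b hb hab
    have hbp : b = p := by
      by_contra hne
      obtain ⟨w, hw⟩ := ha
      exact hb ⟨w.concat hab, by
        rw [SimpleGraph.Walk.support_concat]
        simp [hw, Ne.symm hne]⟩
    subst hbp
    exact ⟨comp_adj hpr ha hab, rfl⟩

lemma comp_mem_cases {T : UnrootedBinaryTree V X} {p r v : V} (hv : v ∈ comp T p r) :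
    v = r ∨ ∃ c, c ≠ p ∧ T.graph.Adj c r ∧ v ∈ comp T r c := by
  obtain ⟨w, hw⟩ := hv
  have hb : p ∉ w.bypass.support := fun h => hw (w.support_bypass_subset_support h)
  have hp := w.bypass_isPath
  generalize w.bypass = q at hb hp
  cases q with
  | nil => exact Or.inl rfl
  | cons hadj q =>
    rename_i c
    right
    rw [SimpleGraph.Walk.cons_isPath_iff] at hp
    refine ⟨c, ?_, hadj.symm, q, hp.2⟩
    rintro rfl
    exact hb (by simp)

lemma comp_sub {T : UnrootedBinaryTree V X} {p r c : V} (hpr : T.graph.Adj r p)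
    (hc : T.graph.Adj c r) (hcp : c ≠ p) : comp T r c ⊆ comp T p r := by
  rintro v ⟨w, hw⟩
  have hpw : p ∉ w.support := by
    intro h
    have : p ∈ comp T r c := ⟨w.takeUntil p h, fun h' =>
      hw (w.support_takeUntil_subset_support h h')⟩
    exact hcp (comp_adj hc this hpr.symm).symm
  exact ⟨.cons hc.symm w, by simp [hpw, hpr.ne.symm]⟩

lemma comp_disj {T : UnrootedBinaryTree V X} {r c1 c2 : V}
    (h1 : T.graph.Adj c1 r) (h2 : T.graph.Adj c2 r) (hne : c1 ≠ c2) :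
    Disjoint (comp T r c1) (comp T r c2) := by
  rw [Set.disjoint_left]
  rintro v ⟨w, hw⟩ ⟨w', hw'⟩
  have : c2 ∈ comp T r c1 := ⟨w.append w'.reverse, by
    simp [SimpleGraph.Walk.mem_support_append_iff, hw, hw']⟩
  exact hne (comp_adj h1 this h2).symm

lemma comp_leaf {T : UnrootedBinaryTree V X} {p r : V} (hpr : T.graph.Adj r p)
    (hdeg : vdeg T.graph r = 1) : comp T p r = {r} := by
  obtain ⟨a, ha⟩ := Set.ncard_eq_one.1 hdeg
  have hn : ∀ c, T.graph.Adj r c → c = a := fun c hc => by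
    have : c ∈ T.graph.neighborSet r := hc
    rwa [ha] at this
  ext v
  constructor
  · intro hv
    rcases comp_mem_cases hv with h | ⟨c, hc, hadj, -⟩
    · exact h
    · exact absurd ((hn c hadj.symm).trans (hn p hpr).symm) hc
  · rintro rfl
    exact (comp_good hpr).rm

lemma rep_exists [Finite V] (T : UnrootedBinaryTree V X) (N : ℕ) :
    ∀ p r, T.graph.Adj r p → (comp T p r).ncard < N → ∃ t, Rep T p r (comp T p r) t := by
  induction N with
  | zero => intro p r _ h; omega
  | succ N ih =>
    intro p r hpr hN
    rcases T.degOneOrThree r with hdeg | hdeg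
    · obtain ⟨x, rfl⟩ := T.leaf_label r hdeg
      have g := comp_good hpr
      rw [comp_leaf hpr hdeg] at g ⊢
      exact ⟨_, .leaf p x g⟩
    · obtain ⟨c1, c2, h12, h1, h2, hset⟩ : ∃ c1 c2, c1 ≠ c2 ∧ c1 ≠ p ∧ c2 ≠ p ∧
          T.graph.neighborSet r = {p, c1, c2} := by
        have hmem : p ∈ T.graph.neighborSet r := hpr
        have h2 : (T.graph.neighborSet r \ {p}).ncard = 2 := by
          rw [Set.ncard_sdiff_singleton_of_mem hmem]
          unfold vdeg at hdeg
          omega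
        obtain ⟨c1, c2, hne, he⟩ := Set.ncard_eq_two.1 h2
        have m1 : c1 ∈ T.graph.neighborSet r \ {p} := by rw [he]; simp
        have m2 : c2 ∈ T.graph.neighborSet r \ {p} := by rw [he]; simp
        refine ⟨c1, c2, hne, m1.2, m2.2, ?_⟩
        rw [← he, Set.insert_sdiff_singleton, Set.insert_eq_of_mem hmem]
      have a1 : T.graph.Adj c1 r := by
        have : c1 ∈ T.graph.neighborSet r := by rw [hset]; simp
        exact SimpleGraph.Adj.symm this
      have a2 : T.graph.Adj c2 r := by
        have : c2 ∈ T.graph.neighborSet r := by rw [hset]; simp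
        exact SimpleGraph.Adj.symm this
      have s1 := comp_sub hpr a1 h1
      have s2 := comp_sub hpr a2 h2
      have g := comp_good hpr
      have lt : ∀ c, T.graph.Adj c r → comp T r c ⊆ comp T p r → (comp T r c).ncard < N := by
        intro c hc hs
        have : (comp T r c).ncard < (comp T p r).ncard :=
          Set.ncard_lt_ncard ⟨hs, fun h => (comp_good hc).pn (h g.rm)⟩ (Set.toFinite _)
        omega
      obtain ⟨t1, R1⟩ := ih r c1 a1 (lt c1 a1 s1)
      obtain ⟨t2, R2⟩ := ih r c2 a2 (lt c2 a2 s2)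
      have he : comp T p r = insert r (comp T r c1 ∪ comp T r c2) := by
        ext v
        constructor
        · intro hv
          rcases comp_mem_cases hv with rfl | ⟨c, hc, hadj, hm⟩
          · simp
          · have : c ∈ T.graph.neighborSet r := hadj.symm
            rw [hset] at this
            rcases this with rfl | rfl | rfl
            · exact absurd rfl hc
            · simp [hm]
            · simp [hm]
        · rintro (rfl | hv | hv)
          · exact g.rm
          · exact s1 hv
          · exact s2 hv
      rw [he] at g ⊢
      refine ⟨_, .node p r c1 c2 _ _ t1 t2 g R1 R2 (comp_disj a1 a2 h12) ?_⟩
      rintro x rfl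
      have := T.label_leaf x
      omega

lemma full_convex {T : UnrootedBinaryTree V X} {A : Finset X} {P : Finset (Finset X)}
    {h : V → Finset X} (hP : Part A P) (F : Full T Set.univ P h) : IsConvexChar T P := by
  refine ⟨h, fun v => F.1 v trivial, fun x B hB hx => F.2.1 B hB x hx, fun B hB => ?_⟩
  obtain ⟨x, hx⟩ := hP.1 B hB
  have : Nonempty {v : V | h v = B} := ⟨⟨T.label x, F.2.1 B hB x hx⟩⟩
  rw [SimpleGraph.connected_iff]
  refine ⟨?_, this⟩
  rintro ⟨u, hu⟩ ⟨v, hv⟩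
  have hu' : h u = B := hu
  have hv' : h v = B := hv
  obtain ⟨w⟩ := F.2.2 u trivial v trivial (hu'.trans hv'.symm)
  clear hu' hv'
  induction w with
  | nil => exact .refl _
  | cons hadj w ih =>
    rename_i a b c
    have hb : h b = B := by rw [← hadj.2.2.2]; exact hu
    have e : (T.graph.induce {v : V | h v = B}).Adj ⟨a, hu⟩ ⟨b, hb⟩ := hadj.1
    exact e.reachable.trans (ih hb hv)

lemma convex_hd {T : UnrootedBinaryTree V X} {P : Finset (Finset X)}
    (hc : IsConvexChar T P) : HD T P := by
  obtain ⟨h, -, hl, hcon⟩ := hc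
  have key : ∀ B ∈ P, ∀ v, InHull T B v → h v = B := by
    rintro B hB v ⟨x, hx, y, hy, hb⟩
    obtain ⟨w⟩ := (hcon B hB).preconnected ⟨T.label x, hl x B hB hx⟩ ⟨T.label y, hl y B hB hy⟩
    have : v ∈ w.support.map (SimpleGraph.Embedding.induce (G := T.graph) _).toHom := by
      rw [← SimpleGraph.Walk.support_map]
      exact hb _
    rw [List.mem_map] at this
    obtain ⟨⟨u, hu⟩, -, rfl⟩ := this
    exact hu
  intro B hB C hC hne v h1 h2
  exact hne ((key B hB v h1).symm.trans (key C hC v h2))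

lemma main [Finite V] [Fintype X] (T : UnrootedBinaryTree V X) (x0 : X) :
    ∃ t : BT X, Valid t ∧ lv t = Finset.univ ∧
      ∀ P, P ∈ (ch t).1 ↔ IsCharacter P ∧ IsConvexChar T P := by
  have hdeg := T.label_leaf x0
  obtain ⟨q, hq⟩ := Set.ncard_eq_one.1 hdeg
  have hadj : T.graph.Adj (T.label x0) q := by
    have : q ∈ T.graph.neighborSet (T.label x0) := by rw [hq]; simp
    exact this
  obtain ⟨t1, R1⟩ := rep_exists T _ (T.label x0) q hadj.symm (Nat.lt_succ_self _)
  have g2 := comp_good (T := T) hadj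
  rw [comp_leaf hadj hdeg] at g2
  have R2 : Rep T q (T.label x0) {T.label x0} (.leaf x0) := .leaf q x0 g2
  have hd : Disjoint (comp T (T.label x0) q) {T.label x0} := by
    rw [Set.disjoint_singleton_right]
    exact R1.good.pn
  have hS : (Set.univ : Set V) = comp T (T.label x0) q ∪ {T.label x0} := by
    symm
    rw [Set.eq_univ_iff_forall]
    intro v
    obtain ⟨w⟩ := T.isTree.connected.preconnected (T.label x0) v
    have hp := w.bypass_isPath
    generalize w.bypass = w' at hp
    cases w' with
    | nil => simp
    | cons ha w' =>
      rename_i c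
      have : c ∈ T.graph.neighborSet (T.label x0) := ha
      rw [hq, Set.mem_singleton_iff] at this
      subst this
      rw [SimpleGraph.Walk.cons_isPath_iff] at hp
      exact Or.inl ⟨w', hp.2⟩
  have J : Join T Set.univ (comp T (T.label x0) q) {T.label x0} q (T.label x0) :=
    Or.inl ⟨hS, hadj.symm⟩
  have hdA := lv_disj R1 R2 hd
  have hval : Valid (.node t1 (.leaf x0)) := ⟨R1.valid, R2.valid, hdA⟩
  have hlv : lv (.node t1 (.leaf x0)) = Finset.univ := by
    rw [Finset.eq_univ_iff_forall]
    intro x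
    simp only [lv, Finset.mem_union]
    have : T.label x ∈ comp T (T.label x0) q ∪ {T.label x0} := by rw [← hS]; trivial
    rcases this with h | h
    · exact Or.inl ((R1.mem x).1 h)
    · exact Or.inr ((R2.mem x).1 h)
  have hpc : ∀ P : Finset (Finset X), Part Finset.univ P ↔ IsCharacter P := by
    intro P
    simp [Part, IsCharacter]
  refine ⟨_, hval, hlv, fun P => ⟨fun hP => ?_, fun hP => ?_⟩⟩
  · have hpart := (ch_part _ hval).1 P hP
    obtain ⟨h, F⟩ := fstepF R1 R2 hd J R1.fwd.1 R1.fwd.2 R2.fwd.1 R2.fwd.2 P hP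
    refine ⟨(hpc P).1 (hlv ▸ hpart), full_convex hpart F⟩
  · have := stepF hdA R1.bwd.1 R1.bwd.2 R2.bwd.1 R2.bwd.2 (R1.sep R2 hd).1 (R1.sep R2 hd).2
    exact this P (by
      have h2 := (hpc P).2 hP.1
      rw [← hlv] at h2
      exact h2) (convex_hd hP.2)

end

end ConvexCount

/-- the total number of convex characters on a tree with `n` taxa is `F(2n-1)`. -/
theorem g1_eq_fib {V X : Type} [Finite V] [Finite X]
    (T : UnrootedBinaryTree V X) (n : ℕ) (hn : Nat.card X = n) (hn2 : 2 ≤ n) :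
    gTotal T 1 = Nat.fib (2 * n - 1) := by
  classical
  have := Fintype.ofFinite X
  have hne : Nonempty X := by
    by_contra h
    rw [not_nonempty_iff] at h
    rw [Nat.card_of_isEmpty] at hn
    omega
  obtain ⟨t, hv, hlv, hP⟩ := ConvexCount.main T hne.some
  have hcard := ConvexCount.lv_card t hv
  rw [hlv, Finset.card_univ, ← Nat.card_eq_fintype_card, hn] at hcard
  have hch := (ConvexCount.ch_card t hv).1
  rw [show 2 * ConvexCount.size t + 1 = 2 * n - 1 by omega] at hch
  rw [← hch]
  unfold gTotal
  have hr : ∀ P ∈ (ConvexCount.ch t).1, P.card ∈ Finset.Icc 1 (Nat.card X) := by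
    intro P hPm
    obtain ⟨⟨h1, h2, h3⟩, -⟩ := (hP P).1 hPm
    rw [Finset.mem_Icc]
    constructor
    · obtain ⟨B, hB, -⟩ := h3 hne.some
      exact Finset.card_pos.2 ⟨B, hB⟩
    · rw [Nat.card_eq_fintype_card, ← Finset.card_univ]
      choose f hf using h1
      refine Finset.card_le_card_of_injOn
        (fun B => if hB : B ∈ P then f B hB else hne.some) (fun _ _ => Finset.mem_univ _) ?_
      intro B hB C hC e
      have hB' : B ∈ P := hB
      have hC' : C ∈ P := hC
      simp only [hB', hC', dif_pos] at e
      by_contra hBC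
      exact Finset.disjoint_left.1 (h2 B hB' C hC' hBC) (hf B hB') (e ▸ hf C hC')
  rw [Finset.card_eq_sum_card_fiberwise (f := Finset.card) (t := Finset.Icc 1 (Nat.card X)) hr]
  refine Finset.sum_congr rfl fun r _ => ?_
  unfold gCount
  refine Nat.subtype_card _ fun P => ?_
  rw [Finset.mem_filter, hP]
  constructor
  · rintro ⟨⟨h1, h2⟩, h3⟩
    exact ⟨h1, h2, h3, fun B hB => Finset.card_pos.2 (h1.1 B hB)⟩
  · rintro ⟨h1, h2, h3, -⟩
    exact ⟨⟨h1, h2⟩, h3⟩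
end

section
/- Let T be an unrooted binary phylogenetic tree on n ≥ 2 taxa. Then the number of convex characters on T in which every state appears on at least two taxa equals the Fibonacci number F(n−1). -/
open SimpleGraph

/-- A finite rooted tree in which the root has one child and each other vertex has zero or two
children, presented by a parent map. -/
structure PT (V : Type) where
  r : V
  par : V → V
  dep : V → ℕ
  hdep : ∀ v, v ≠ r → dep (par v) < dep v
  kids : ∀ v, v ≠ r → (∀ w, w ≠ r → par w ≠ v) ∨
    ∃ a b, a ≠ b ∧ a ≠ r ∧ b ≠ r ∧ par a = v ∧ par b = v ∧ ∀ w, w ≠ r → par w = v → w = a ∨ w = b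
  rootkid : ∃ c, c ≠ r ∧ par c = r ∧ ∀ w, w ≠ r → par w = r → w = c

namespace PT

variable {V : Type} (R : PT V)

/-- `w` is a descendant of `v`. -/
def Le (w v : V) : Prop := Relation.ReflTransGen (fun a b => a ≠ R.r ∧ b = R.par a) w v

def IsLeaf (v : V) : Prop := ∀ w, w ≠ R.r → R.par w ≠ v

variable {R}

lemma Le.refl (v : V) : R.Le v v := Relation.ReflTransGen.refl

lemma Le.trans {a b c : V} (h : R.Le a b) (h' : R.Le b c) : R.Le a c :=
  Relation.ReflTransGen.trans h h'

lemma le_par {v : V} (h : v ≠ R.r) : R.Le v (R.par v) :=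
  Relation.ReflTransGen.single ⟨h, rfl⟩

lemma Le.head {w v : V} (h : R.Le w v) : w = v ∨ (w ≠ R.r ∧ R.Le (R.par w) v) := by
  rcases Relation.ReflTransGen.cases_head h with h | ⟨c, ⟨h1, h2⟩, h3⟩
  · exact Or.inl h
  · subst h2; exact Or.inr ⟨h1, h3⟩

lemma Le.tail {w v : V} (h : R.Le w v) : w = v ∨ ∃ u, u ≠ R.r ∧ R.par u = v ∧ R.Le w u := by
  rcases Relation.ReflTransGen.cases_tail h with h | ⟨c, h3, ⟨h1, h2⟩⟩
  · exact Or.inl h.symm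
  · exact Or.inr ⟨c, h1, h2.symm, h3⟩

lemma Le.dep_le {w v : V} (h : R.Le w v) : R.dep v ≤ R.dep w := by
  induction h with
  | refl => exact le_rfl
  | tail _ h ih => obtain ⟨h1, rfl⟩ := h; exact (R.hdep _ h1).le.trans ih

lemma Le.antisymm {w v : V} (h : R.Le w v) (h' : R.Le v w) : w = v := by
  rcases h.head with h1 | ⟨h1, h2⟩
  · exact h1
  · have := h2.dep_le
    have := R.hdep _ h1
    have := h'.dep_le
    omega

lemma Le.total {w a b : V} (h : R.Le w a) (h' : R.Le w b) : R.Le a b ∨ R.Le b a := by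
  refine Relation.ReflTransGen.total_of_right_unique ?_ h h'
  rintro x y z ⟨_, rfl⟩ ⟨_, rfl⟩
  rfl

lemma le_root (v : V) : R.Le v R.r := by
  induction hn : R.dep v using Nat.strong_induction_on generalizing v with
  | _ n ih =>
    by_cases h : v = R.r
    · subst h; exact Le.refl _
    · exact (le_par h).trans (ih _ (hn ▸ R.hdep v h) _ rfl)

lemma root_le {v : V} (h : R.Le R.r v) : v = R.r := by
  rcases h.head with h | ⟨h, _⟩
  · exact h.symm
  · exact absurd rfl h

lemma not_par_le {v : V} (hv : v ≠ R.r) : ¬ R.Le (R.par v) v := by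
  intro h
  have := h.dep_le
  have := R.hdep v hv
  omega

lemma sib_disj {a b w : V} (hab : a ≠ b) (ha : a ≠ R.r) (hb : b ≠ R.r) (h : R.par a = R.par b)
    (h1 : R.Le w a) (h2 : R.Le w b) : False := by
  rcases h1.total h2 with h3 | h3
  · rcases h3.head with h4 | ⟨_, h4⟩
    · exact hab h4
    · exact not_par_le hb (h ▸ h4)
  · rcases h3.head with h4 | ⟨_, h4⟩
    · exact hab h4.symm
    · exact not_par_le ha (h ▸ h4)

/-- the local validity condition at `v` -/
def OK (R : PT V) (E : Finset V) (v : V) : Prop :=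
  (R.IsLeaf v → v ∈ E) ∧
  ∀ a b, a ≠ b → a ≠ R.r → b ≠ R.r → R.par a = v → R.par b = v →
    (v ∈ E → a ∈ E ∨ b ∈ E) ∧ (a ∈ E → v ∈ E ∨ b ∈ E)

def Valid (R : PT V) (E : Finset V) : Prop :=
  R.r ∉ E ∧ (∀ c, c ≠ R.r → R.par c = R.r → c ∈ E) ∧ ∀ v, v ≠ R.r → R.OK E v

open Classical in
/-- go up along `E` -/
noncomputable def top (R : PT V) (E : Finset V) (v : V) : V :=
  if h : v ∈ E ∧ v ≠ R.r then top R E (R.par v) else v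
termination_by R.dep v
decreasing_by exact R.hdep v h.2

lemma top_mem {E : Finset V} {v : V} (h : v ∈ E) (h' : v ≠ R.r) :
    R.top E v = R.top E (R.par v) := by
  rw [top, dif_pos ⟨h, h'⟩]

lemma top_not_mem {E : Finset V} {v : V} (h : v ∉ E) : R.top E v = v := by
  rw [top, dif_neg (by tauto)]

lemma top_root {E : Finset V} : R.top E R.r = R.r := by
  rw [top, dif_neg (by tauto)]

lemma par_induct {p : V → Prop} (h0 : p R.r) (h1 : ∀ v, v ≠ R.r → p (R.par v) → p v) (v : V) :
    p v := by
  induction hn : R.dep v using Nat.strong_induction_on generalizing v with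
  | _ n ih =>
    by_cases h : v = R.r
    · subst h; exact h0
    · exact h1 v h (ih _ (hn ▸ R.hdep v h) _ rfl)

lemma le_top (E : Finset V) (v : V) : R.Le v (R.top E v) := by
  induction v using par_induct (R := R) with
  | h0 => rw [top_root]; exact Le.refl _
  | h1 v hv ih =>
    by_cases h : v ∈ E
    · rw [top_mem h hv]; exact (le_par hv).trans ih
    · rw [top_not_mem h]; exact Le.refl _

lemma top_spec {E : Finset V} (hr : R.r ∉ E) (v : V) : R.top E v ∉ E := by
  induction v using par_induct (R := R) with
  | h0 => rw [top_root]; exact hr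
  | h1 v hv ih =>
    by_cases h : v ∈ E
    · rw [top_mem h hv]; exact ih
    · rwa [top_not_mem h]

/-- the top stays below any ancestor not in `E`. -/
lemma top_le {E : Finset V} {w v : V} (h : R.Le w v) (hv : v ∉ E) : R.Le (R.top E w) v := by
  induction w using par_induct (R := R) with
  | h0 => rw [top_root]; exact h
  | h1 w hw ih =>
    by_cases h' : w ∈ E
    · rw [top_mem h' hw]
      rcases h.head with rfl | ⟨_, h2⟩
      · exact absurd h' hv
      · exact ih h2
    · rwa [top_not_mem h']

/-- Induction from leaves towards the root. -/
lemma down_induct [Finite V] {p : V → Prop}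
    (h : ∀ v, (∀ w, w ≠ R.r → R.par w = v → p w) → p v) (v : V) : p v := by
  have hwf : WellFounded (fun a b : V => R.dep b < R.dep a) := by
    have : IsTrans V (fun a b : V => R.dep b < R.dep a) := ⟨fun a b c h1 h2 => h2.trans h1⟩
    have : Std.Irrefl (fun a b : V => R.dep b < R.dep a) := ⟨fun a => lt_irrefl _⟩
    exact Finite.wellFounded_of_trans_of_irrefl _
  induction v using hwf.induction with
  | _ v ih =>
    refine h v fun w hw hp => ih w ?_
    subst hp
    exact R.hdep w hw

lemma descend [Finite V] {E : Finset V} (hE : ∀ v, v ≠ R.r → R.OK E v) (v : V) (hv : v ≠ R.r)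
    (hvE : v ∈ E) :
    ∃ x, x ≠ R.r ∧ R.IsLeaf x ∧ R.Le x v ∧ R.top E x = R.top E v := by
  induction v using down_induct (R := R) with
  | h v ih =>
    rcases R.kids v hv with hl | ⟨a, b, hab, ha, hb, hpa, hpb, hk⟩
    · exact ⟨v, hv, hl, Le.refl _, rfl⟩
    · rcases ((hE v hv).2 a b hab ha hb hpa hpb).1 hvE with h | h
      · obtain ⟨x, h1, h2, h3, h4⟩ := ih a ha hpa ha h
        refine ⟨x, h1, h2, h3.trans (hpa ▸ le_par ha), ?_⟩
        rw [h4, top_mem h ha, hpa]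
      · obtain ⟨x, h1, h2, h3, h4⟩ := ih b hb hpb hb h
        refine ⟨x, h1, h2, h3.trans (hpb ▸ le_par hb), ?_⟩
        rw [h4, top_mem h hb, hpb]

def Lf (R : PT V) (v : V) : Prop := v = R.r ∨ R.IsLeaf v

lemma outside [Finite V] {E : Finset V} (hE : R.Valid E) (v : V) (hv : v ≠ R.r) (hvE : v ∈ E) :
    ∃ y, R.Lf y ∧ ¬ R.Le y v ∧ R.top E y = R.top E v := by
  induction v using par_induct (R := R) with
  | h0 => exact absurd rfl hv
  | h1 v _ ih =>
    by_cases hs : R.par v = R.r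
    · exact ⟨R.r, Or.inl rfl, fun h => hv (root_le h), by rw [top_mem hvE hv, hs]⟩
    · rcases R.kids _ hs with hl | ⟨a, b, hab, ha, hb, hpa, hpb, hk⟩
      · exact absurd rfl (hl v hv)
      · obtain ⟨c, hcv, hc, hpc⟩ : ∃ c, v ≠ c ∧ c ≠ R.r ∧ R.par c = R.par v := by
          rcases hk v hv rfl with h | h
          · exact ⟨b, by rwa [h], hb, hpb⟩
          · exact ⟨a, by rw [h]; exact hab.symm, ha, hpa⟩
        rcases ((hE.2.2 _ hs).2 v c hcv hv hc rfl hpc).2 hvE with h | h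
        · obtain ⟨y, h1, h2, h3⟩ := ih hs h
          exact ⟨y, h1, fun h => h2 (h.trans (le_par hv)), by rw [h3, top_mem hvE hv]⟩
        · obtain ⟨y, h1, h2, h3, h4⟩ := descend hE.2.2 c hc h
          refine ⟨y, Or.inr h2, fun h5 => sib_disj hcv hv hc hpc.symm h5 h3, ?_⟩
          rw [h4, top_mem h hc, top_mem hvE hv, hpc]

/-- `E` is recovered from the partition. -/
lemma mem_iff_straddle [Finite V] {E : Finset V} (hE : R.Valid E) (v : V) (hv : v ≠ R.r) :
    v ∈ E ↔ ∃ x y, R.Lf x ∧ R.Lf y ∧ R.top E x = R.top E y ∧ R.Le x v ∧ ¬ R.Le y v := by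
  constructor
  · intro h
    obtain ⟨x, h1, h2, h3, h4⟩ := descend hE.2.2 v hv h
    obtain ⟨y, g1, g2, g3⟩ := outside hE v hv h
    exact ⟨x, y, Or.inr h2, g1, h4.trans g3.symm, h3, g2⟩
  · rintro ⟨x, y, _, _, h, h1, h2⟩
    by_contra h3
    have := top_le h1 h3
    rw [h] at this
    exact h2 ((le_top E y).trans this)

/-! ### counting -/

open Classical in
noncomputable def desc [Fintype V] (R : PT V) (v : V) : Finset V := Finset.univ.filter (R.Le · v)

open Classical in
noncomputable def leaves [Fintype V] (R : PT V) (v : V) : Finset V :=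
  Finset.univ.filter fun w => R.Le w v ∧ R.IsLeaf w

open Classical in
noncomputable def InS [Fintype V] (R : PT V) (v : V) : Finset (Finset V) :=
  Finset.univ.filter fun E => (∀ w ∈ E, R.Le w v) ∧ (∀ w, R.Le w v → R.OK E w) ∧ v ∈ E

open Classical in
noncomputable def OutS [Fintype V] (R : PT V) (v : V) : Finset (Finset V) :=
  Finset.univ.filter fun E => (∀ w ∈ E, R.Le w v) ∧ (∀ w, R.Le w v → R.OK E w) ∧ v ∉ E

lemma OK_congr {E E' : Finset V} {v : V} (h0 : v ∈ E ↔ v ∈ E')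
    (h : ∀ a, a ≠ R.r → R.par a = v → (a ∈ E ↔ a ∈ E')) : R.OK E v ↔ R.OK E' v := by
  unfold OK
  constructor
  · rintro ⟨h1, h2⟩
    refine ⟨fun g => h0.1 (h1 g), fun a b hab ha hb hpa hpb => ?_⟩
    rw [← h0, ← h a ha hpa, ← h b hb hpb]
    exact h2 a b hab ha hb hpa hpb
  · rintro ⟨h1, h2⟩
    refine ⟨fun g => h0.2 (h1 g), fun a b hab ha hb hpa hpb => ?_⟩
    rw [h0, h a ha hpa, h b hb hpb]
    exact h2 a b hab ha hb hpa hpb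

lemma leaf_le {v w : V} (hl : R.IsLeaf v) (h : R.Le w v) : w = v := by
  rcases h.tail with h | ⟨u, hu, hp, _⟩
  · exact h
  · exact absurd hp (hl u hu)

lemma count_leaf [Fintype V] {v : V} (hl : R.IsLeaf v) :
    R.InS v = {{v}} ∧ R.OutS v = ∅ ∧ R.leaves v = {v} := by
  refine ⟨?_, ?_, ?_⟩
  · ext E
    simp only [InS, Finset.mem_filter, Finset.mem_univ, true_and, Finset.mem_singleton]
    constructor
    · rintro ⟨h1, h2, h3⟩
      ext w
      rw [Finset.mem_singleton]
      exact ⟨fun h => leaf_le hl (h1 w h), fun h => h ▸ h3⟩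
    · rintro rfl
      refine ⟨fun w hw => ?_, fun w hw => ?_, by simp⟩
      · rw [Finset.mem_singleton] at hw; rw [hw]; exact Le.refl _
      · obtain rfl := leaf_le hl hw
        exact ⟨fun _ => by simp, fun a b _ ha _ hpa => absurd hpa (hl a ha)⟩
  · ext E
    simp only [OutS, Finset.mem_filter, Finset.mem_univ, true_and, Finset.notMem_empty, iff_false]
    rintro ⟨h1, h2, h3⟩
    exact h3 ((h2 v (Le.refl _)).1 hl)
  · ext w
    simp only [leaves, Finset.mem_filter, Finset.mem_univ, true_and, Finset.mem_singleton]
    exact ⟨fun h => leaf_le hl h.1, fun h => by subst h; exact ⟨Le.refl _, hl⟩⟩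

end PT

namespace PT

variable {V : Type} {R : PT V}

def SS (R : PT V) (E : Finset V) (v : V) : Prop :=
  (∀ w ∈ E, R.Le w v) ∧ (∀ w, R.Le w v → R.OK E w)

lemma mem_InS [Fintype V] {E : Finset V} {v : V} : E ∈ R.InS v ↔ R.SS E v ∧ v ∈ E := by
  simp [InS, SS, and_assoc]

lemma mem_OutS [Fintype V] {E : Finset V} {v : V} : E ∈ R.OutS v ↔ R.SS E v ∧ v ∉ E := by
  simp [OutS, SS, and_assoc]

/-- `v` has exactly the children `a` and `b`. -/
structure Fork (R : PT V) (v a b : V) : Prop where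
  ne : a ≠ b
  ha : a ≠ R.r
  hb : b ≠ R.r
  pa : R.par a = v
  pb : R.par b = v
  all : ∀ w, w ≠ R.r → R.par w = v → w = a ∨ w = b

namespace Fork

variable {v a b : V}

lemma symm (F : R.Fork v a b) : R.Fork v b a :=
  ⟨F.ne.symm, F.hb, F.ha, F.pb, F.pa, fun w h h' => (F.all w h h').symm⟩

lemma lea (F : R.Fork v a b) : R.Le a v := F.pa ▸ le_par F.ha

lemma leb (F : R.Fork v a b) : R.Le b v := F.symm.lea

lemma not_lea (F : R.Fork v a b) : ¬ R.Le v a := fun h => not_par_le F.ha (F.pa.symm ▸ h)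

lemma not_leb (F : R.Fork v a b) : ¬ R.Le v b := F.symm.not_lea

lemma disj (F : R.Fork v a b) {w : V} (h : R.Le w a) (h' : R.Le w b) : False :=
  sib_disj F.ne F.ha F.hb (F.pa.trans F.pb.symm) h h'

lemma le_iff (F : R.Fork v a b) {w : V} : R.Le w v ↔ w = v ∨ R.Le w a ∨ R.Le w b := by
  constructor
  · intro h
    rcases h.tail with h | ⟨u, hu, hp, hw⟩
    · exact Or.inl h
    · rcases F.all u hu hp with rfl | rfl
      · exact Or.inr (Or.inl hw)
      · exact Or.inr (Or.inr hw)
  · rintro (rfl | h | h)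
    · exact Le.refl _
    · exact h.trans F.lea
    · exact h.trans F.leb

lemma ok_iff (F : R.Fork v a b) {E : Finset V} : R.OK E v ↔
    (v ∈ E → a ∈ E ∨ b ∈ E) ∧ (a ∈ E → v ∈ E ∨ b ∈ E) ∧ (b ∈ E → v ∈ E ∨ a ∈ E) := by
  constructor
  · intro h
    have h1 := h.2 a b F.ne F.ha F.hb F.pa F.pb
    have h2 := h.2 b a F.ne.symm F.hb F.ha F.pb F.pa
    exact ⟨h1.1, h1.2, h2.2⟩
  · rintro ⟨h1, h2, h3⟩
    refine ⟨fun h => absurd F.pa (h a F.ha), fun x y hxy hx hy hpx hpy => ?_⟩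
    rcases F.all x hx hpx with rfl | rfl <;> rcases F.all y hy hpy with rfl | rfl
    · exact absurd rfl hxy
    · exact ⟨h1, h2⟩
    · exact ⟨fun h => (h1 h).symm, h3⟩
    · exact absurd rfl hxy

open Classical in
lemma ok_filter {E : Finset V} {w : V} (h : R.Le w a) :
    R.OK (E.filter (R.Le · a)) w ↔ R.OK E w := by
  refine OK_congr (by simp [h]) fun u hu hp => ?_
  have : R.Le u a := (le_par hu).trans (hp ▸ h)
  simp [this]

open Classical in
lemma ss_iff (F : R.Fork v a b) {E : Finset V} : R.SS E v ↔
    (∀ w ∈ E, R.Le w v) ∧ R.OK E v ∧ R.SS (E.filter (R.Le · a)) a ∧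
      R.SS (E.filter (R.Le · b)) b := by
  constructor
  · rintro ⟨h1, h2⟩
    refine ⟨h1, h2 v (Le.refl _), ⟨by simp, fun w hw => ?_⟩, ⟨by simp, fun w hw => ?_⟩⟩
    · exact (ok_filter hw).2 (h2 w (hw.trans F.lea))
    · exact (ok_filter hw).2 (h2 w (hw.trans F.leb))
  · rintro ⟨h1, h2, h3, h4⟩
    refine ⟨h1, fun w hw => ?_⟩
    rcases F.le_iff.1 hw with rfl | h | h
    · exact h2
    · exact (ok_filter h).1 (h3.2 w h)
    · exact (ok_filter h).1 (h4.2 w h)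

open Classical in
lemma filter_a (F : R.Fork v a b) {E₁ E₂ E₀ : Finset V} (h1 : ∀ w ∈ E₁, R.Le w a)
    (h2 : ∀ w ∈ E₂, R.Le w b) (h0 : ∀ w ∈ E₀, w = v) :
    (E₀ ∪ (E₁ ∪ E₂)).filter (R.Le · a) = E₁ := by
  ext w
  simp only [Finset.mem_filter, Finset.mem_union]
  constructor
  · rintro ⟨h | h | h, h'⟩
    · exact absurd (h0 w h ▸ h') F.not_lea
    · exact h
    · exact (F.disj h' (h2 w h)).elim
  · intro h; exact ⟨Or.inr (Or.inl h), h1 w h⟩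

open Classical in
/-- the general counting bijection -/
lemma card_gen [Fintype V] (F : R.Fork v a b) (E₀ : Finset V) (h0 : ∀ w ∈ E₀, w = v)
    (A : Finset (Finset V)) (B : Finset (Finset V × Finset V))
    (hA : ∀ E, E ∈ A ↔ R.SS E v ∧ (v ∈ E ↔ v ∈ E₀))
    (hB : ∀ p, p ∈ B ↔ R.SS p.1 a ∧ R.SS p.2 b ∧
      (v ∈ E₀ → a ∈ p.1 ∨ b ∈ p.2) ∧ (a ∈ p.1 → v ∈ E₀ ∨ b ∈ p.2) ∧
      (b ∈ p.2 → v ∈ E₀ ∨ a ∈ p.1)) : A.card = B.card := by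
  refine Finset.card_nbij' (fun E => (E.filter (R.Le · a), E.filter (R.Le · b)))
    (fun p => E₀ ∪ (p.1 ∪ p.2)) ?_ ?_ ?_ ?_
  · intro E hE
    rw [Finset.mem_coe, hA, F.ss_iff, F.ok_iff] at hE
    rw [Finset.mem_coe, hB]
    obtain ⟨⟨h1, h2, h3, h4⟩, h5⟩ := hE
    refine ⟨h3, h4, ?_⟩
    simpa [Le.refl, h5] using h2
  · intro p hp
    rw [Finset.mem_coe, hB] at hp
    rw [Finset.mem_coe, hA, F.ss_iff, F.ok_iff]
    obtain ⟨h1, h2, h3⟩ := hp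
    have e1 : (E₀ ∪ (p.1 ∪ p.2)).filter (R.Le · a) = p.1 := F.filter_a h1.1 h2.1 h0
    have e2 : (E₀ ∪ (p.1 ∪ p.2)).filter (R.Le · b) = p.2 := by
      rw [Finset.union_comm p.1]; exact F.symm.filter_a h2.1 h1.1 h0
    have m1 : v ∈ E₀ ∪ (p.1 ∪ p.2) ↔ v ∈ E₀ := by
      simp only [Finset.mem_union]
      constructor
      · rintro (h | h | h)
        · exact h
        · exact absurd (h1.1 v h) F.not_lea
        · exact absurd (h2.1 v h) F.not_leb
      · exact Or.inl
    have m2 : a ∈ E₀ ∪ (p.1 ∪ p.2) ↔ a ∈ p.1 := by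
      conv_rhs => rw [← e1]
      simp [Le.refl]
    have m3 : b ∈ E₀ ∪ (p.1 ∪ p.2) ↔ b ∈ p.2 := by
      conv_rhs => rw [← e2]
      simp [Le.refl]
    refine ⟨⟨?_, ?_, ?_, ?_⟩, m1⟩
    · intro w hw
      simp only [Finset.mem_union] at hw
      rw [F.le_iff]
      rcases hw with h | h | h
      · exact Or.inl (h0 w h)
      · exact Or.inr (Or.inl (h1.1 w h))
      · exact Or.inr (Or.inr (h2.1 w h))
    · rw [m1, m2, m3]; exact h3
    · rw [e1]; exact h1
    · rw [e2]; exact h2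
  · intro E hE
    rw [Finset.mem_coe, hA] at hE
    ext w
    simp only [Finset.mem_union, Finset.mem_filter]
    constructor
    · rintro (h | h | h)
      · obtain rfl := h0 w h
        exact hE.2.2 h
      · exact h.1
      · exact h.1
    · intro h
      rcases F.le_iff.1 (hE.1.1 w h) with rfl | h' | h'
      · exact Or.inl (hE.2.1 h)
      · exact Or.inr (Or.inl ⟨h, h'⟩)
      · exact Or.inr (Or.inr ⟨h, h'⟩)
  · intro p hp
    rw [Finset.mem_coe, hB] at hp
    obtain ⟨h1, h2, h3⟩ := hp
    refine Prod.ext (F.filter_a h1.1 h2.1 h0) ?_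
    change (E₀ ∪ (p.1 ∪ p.2)).filter (R.Le · b) = p.2
    rw [Finset.union_comm p.1]; exact F.symm.filter_a h2.1 h1.1 h0

lemma InOut_disj [Fintype V] (u : V) : Disjoint (R.InS u) (R.OutS u) := by
  rw [Finset.disjoint_left]
  intro E h h'
  exact (mem_OutS.1 h').2 (mem_InS.1 h).2

open Classical in
lemma card_in [Fintype V] (F : R.Fork v a b) : (R.InS v).card =
    (R.InS a).card * (R.InS b).card + (R.InS a).card * (R.OutS b).card +
      (R.OutS a).card * (R.InS b).card := by
  rw [F.card_gen {v} (by simp) (R.InS v)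
    ((R.InS a ×ˢ R.InS b ∪ R.InS a ×ˢ R.OutS b) ∪ R.OutS a ×ˢ R.InS b)
    (fun E => by simp [mem_InS]) ?_]
  · rw [Finset.card_union_of_disjoint, Finset.card_union_of_disjoint]
    · simp only [Finset.card_product]
    · exact Finset.disjoint_product.2 (Or.inr (InOut_disj b))
    · rw [Finset.disjoint_union_left]
      exact ⟨Finset.disjoint_product.2 (Or.inl (InOut_disj a)),
        Finset.disjoint_product.2 (Or.inl (InOut_disj a))⟩
  · rintro ⟨p, q⟩
    simp only [Finset.mem_union, Finset.mem_product, mem_InS, mem_OutS, Finset.mem_singleton]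
    tauto

open Classical in
lemma card_out [Fintype V] (F : R.Fork v a b) : (R.OutS v).card =
    (R.InS a).card * (R.InS b).card + (R.OutS a).card * (R.OutS b).card := by
  rw [F.card_gen ∅ (by simp) (R.OutS v)
    (R.InS a ×ˢ R.InS b ∪ R.OutS a ×ˢ R.OutS b)
    (fun E => by simp [mem_OutS]) ?_]
  · rw [Finset.card_union_of_disjoint]
    · simp only [Finset.card_product]
    · exact Finset.disjoint_product.2 (Or.inr (InOut_disj b))
  · rintro ⟨p, q⟩
    simp only [Finset.mem_union, Finset.mem_product, mem_InS, mem_OutS, Finset.notMem_empty]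
    tauto

open Classical in
lemma card_leaves [Fintype V] (F : R.Fork v a b) :
    (R.leaves v).card = (R.leaves a).card + (R.leaves b).card := by
  rw [← Finset.card_union_of_disjoint]
  · congr 1
    ext w
    simp only [leaves, Finset.mem_filter, Finset.mem_univ, true_and, Finset.mem_union, F.le_iff]
    constructor
    · rintro ⟨rfl | h | h, h'⟩
      · exact absurd F.pa (h' a F.ha)
      · exact Or.inl ⟨h, h'⟩
      · exact Or.inr ⟨h, h'⟩
    · tauto
  · rw [Finset.disjoint_left]
    simp only [leaves, Finset.mem_filter, Finset.mem_univ, true_and]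
    exact fun w h h' => F.disj h.1 h'.1

end Fork

lemma count [Fintype V] (v : V) (hv : v ≠ R.r) : ∃ m, (R.leaves v).card = m + 1 ∧
    (R.InS v).card = Nat.fib (m + 1) ∧ (R.OutS v).card = Nat.fib m := by
  induction v using down_induct (R := R) with
  | h v ih =>
    rcases R.kids v hv with hl | ⟨a, b, hab, ha, hb, hpa, hpb, hk⟩
    · obtain ⟨h1, h2, h3⟩ := count_leaf (R := R) (v := v) hl
      exact ⟨0, by simp [h3], by simp [h1], by simp [h2]⟩
    · have F : R.Fork v a b := ⟨hab, ha, hb, hpa, hpb, hk⟩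
      obtain ⟨m, a1, a2, a3⟩ := ih a ha hpa ha
      obtain ⟨k, b1, b2, b3⟩ := ih b hb hpb hb
      refine ⟨m + k + 1, ?_, ?_, ?_⟩
      · rw [F.card_leaves, a1, b1]; ring
      · rw [F.card_in, a2, a3, b2, b3, show m + k + 1 + 1 = m + (k + 1) + 1 by ring, Nat.fib_add,
          Nat.fib_add_two]
        ring
      · rw [F.card_out, a2, a3, b2, b3, Nat.fib_add]
        ring

open Classical in
lemma count_valid [Fintype V] :
    (Finset.univ.filter fun E : Finset V => R.Valid E).card =
      Nat.fib ((Finset.univ.filter fun v => R.Lf v).card - 1) := by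
  obtain ⟨c, hc, hpc, hk⟩ := R.rootkid
  obtain ⟨m, h1, h2, _⟩ := count (R := R) c hc
  have hle : ∀ w, R.Le w c ↔ w ≠ R.r := by
    intro w
    constructor
    · rintro h rfl
      exact hc (root_le h)
    · intro h
      rcases (le_root (R := R) w).tail with h' | ⟨u, hu, hp, hw⟩
      · exact absurd h' h
      · rwa [← hk u hu hp]
  have e1 : (Finset.univ.filter fun E : Finset V => R.Valid E) = R.InS c := by
    ext E
    rw [mem_InS, Finset.mem_filter]
    simp only [Finset.mem_univ, true_and, Valid, SS, hle]
    constructor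
    · rintro ⟨g1, g2, g3⟩
      exact ⟨⟨fun w hw h => g1 (h ▸ hw), g3⟩, g2 c hc hpc⟩
    · rintro ⟨⟨g1, g2⟩, g3⟩
      exact ⟨fun h => g1 _ h rfl, fun d hd hpd => hk d hd hpd ▸ g3, g2⟩
  have e2 : (Finset.univ.filter fun v => R.Lf v) = insert R.r (R.leaves c) := by
    ext w
    rw [Finset.mem_filter, Finset.mem_insert, leaves, Finset.mem_filter]
    simp only [hle, Lf, Finset.mem_univ, true_and]
    tauto
  have e3 : R.r ∉ R.leaves c := by
    simp [leaves, hle]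
  rw [e1, e2, Finset.card_insert_of_notMem e3, h2, h1]
  simp

end PT

namespace PT

variable {V : Type} {R : PT V}

lemma fork_of {v a b : V} (hv : v ≠ R.r) (hab : a ≠ b) (ha : a ≠ R.r) (hb : b ≠ R.r)
    (hpa : R.par a = v) (hpb : R.par b = v) : R.Fork v a b := by
  refine ⟨hab, ha, hb, hpa, hpb, ?_⟩
  rcases R.kids v hv with hl | ⟨c, d, _, _, _, _, _, hk⟩
  · exact absurd hpa (hl a ha)
  · intro w hw hpw
    rcases hk a ha hpa with rfl | rfl <;> rcases hk b hb hpb with rfl | rfl <;>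
      rcases hk w hw hpw with rfl | rfl <;> simp_all

variable {X : Type} (R)

/-- Compatibility of a phylogenetic tree with a parent presentation. -/
structure Compat (T : UnrootedBinaryTree V X) : Prop where
  adj : ∀ u v, T.graph.Adj u v ↔ (u ≠ R.r ∧ R.par u = v) ∨ (v ≠ R.r ∧ R.par v = u)
  lf : ∀ v, R.Lf v ↔ ∃ x, T.label x = v

open Classical in
noncomputable def blk [Fintype X] (T : UnrootedBinaryTree V X) (E : Finset V) (t : V) : Finset X :=
  Finset.univ.filter fun y => R.top E (T.label y) = t

open Classical in
noncomputable def toP [Fintype X] (T : UnrootedBinaryTree V X) (E : Finset V) :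
    Finset (Finset X) :=
  Finset.univ.image fun x => R.blk T E (R.top E (T.label x))

open Classical in
noncomputable def toE [Fintype V] (T : UnrootedBinaryTree V X) (P : Finset (Finset X)) :
    Finset V :=
  Finset.univ.filter fun v => v ≠ R.r ∧ ∃ B ∈ P, ∃ x ∈ B, ∃ y ∈ B,
    R.Le (T.label x) v ∧ ¬ R.Le (T.label y) v

def Good (T : UnrootedBinaryTree V X) (P : Finset (Finset X)) : Prop :=
  IsCharacter P ∧ IsConvexChar T P ∧ ∀ B ∈ P, 2 ≤ B.card

variable {R} {T : UnrootedBinaryTree V X}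

lemma mem_blk [Fintype X] {E : Finset V} {t : V} {y : X} :
    y ∈ R.blk T E t ↔ R.top E (T.label y) = t := by
  simp [blk]

lemma mem_toP [Fintype X] {E : Finset V} {B : Finset X} :
    B ∈ R.toP T E ↔ ∃ x, R.blk T E (R.top E (T.label x)) = B := by
  simp [toP]

lemma mem_toE [Fintype V] {P : Finset (Finset X)} {v : V} :
    v ∈ R.toE T P ↔ v ≠ R.r ∧ ∃ B ∈ P, ∃ x ∈ B, ∃ y ∈ B,
      R.Le (T.label x) v ∧ ¬ R.Le (T.label y) v := by
  simp [toE]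

lemma toP_char [Fintype X] (E : Finset V) : IsCharacter (R.toP T E) := by
  refine ⟨?_, ?_, ?_⟩
  · intro B hB
    obtain ⟨x, rfl⟩ := mem_toP.1 hB
    exact ⟨x, mem_blk.2 rfl⟩
  · intro B hB B' hB' hne
    obtain ⟨x, rfl⟩ := mem_toP.1 hB
    obtain ⟨y, rfl⟩ := mem_toP.1 hB'
    rw [Finset.disjoint_left]
    intro z hz hz'
    rw [mem_blk] at hz hz'
    exact hne (by rw [← hz, ← hz'])
  · intro x
    exact ⟨_, mem_toP.2 ⟨x, rfl⟩, mem_blk.2 rfl⟩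

lemma toP_two [Fintype X] [Finite V] (C : R.Compat T) {E : Finset V} (hE : R.Valid E) :
    ∀ B ∈ R.toP T E, 2 ≤ B.card := by
  intro B hB
  obtain ⟨x, rfl⟩ := mem_toP.1 hB
  suffices h : ∃ y, R.Lf y ∧ y ≠ T.label x ∧ R.top E y = R.top E (T.label x) by
    obtain ⟨y, hy, hne, ht⟩ := h
    obtain ⟨y, rfl⟩ := (C.lf y).1 hy
    have : 1 < (R.blk T E (R.top E (T.label x))).card :=
      Finset.one_lt_card.2 ⟨x, mem_blk.2 rfl, y, mem_blk.2 ht, fun h => hne (by rw [h])⟩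
    exact this
  by_cases hr : T.label x = R.r
  · obtain ⟨c, hc, hpc, hk⟩ := R.rootkid
    have hcE := hE.2.1 c hc hpc
    obtain ⟨y, h1, h2, h3, h4⟩ := descend hE.2.2 c hc hcE
    refine ⟨y, Or.inr h2, by rwa [hr], ?_⟩
    rw [h4, hr, top_mem hcE hc, hpc]
  · have hl : R.IsLeaf (T.label x) := ((C.lf _).2 ⟨x, rfl⟩).resolve_left hr
    obtain ⟨y, h1, h2, h3⟩ := outside hE _ hr ((hE.2.2 _ hr).1 hl)
    exact ⟨y, h1, fun h => h2 (h ▸ Le.refl _), h3⟩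

lemma toP_convex [Fintype X] [Fintype V] (C : R.Compat T) {E : Finset V} (hE : R.Valid E) :
    IsConvexChar T (R.toP T E) := by
  classical
  let I : Finset V := Finset.univ.filter fun v =>
    v ≠ R.r ∧ v ∉ E ∧ ∀ w, w ≠ R.r → R.par w = v → w ∉ E
  have hI : ∀ v, v ∈ I ↔ v ≠ R.r ∧ v ∉ E ∧ ∀ w, w ≠ R.r → R.par w = v → w ∉ E := by
    intro v; simp [I]
  let E' := E ∪ I
  have hE' : ∀ v, v ∈ E' ↔ v ∈ E ∨ v ∈ I := fun v => Finset.mem_union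
  have hr' : R.r ∉ E' := by
    rw [hE', hI]
    rintro (h | h)
    · exact hE.1 h
    · exact h.1 rfl
  have hA : ∀ t, t ∉ E' → ∃ x, R.top E (T.label x) = t := by
    intro t ht
    by_cases hr : t = R.r
    · subst hr
      obtain ⟨x, hx⟩ := (C.lf R.r).1 (Or.inl rfl)
      exact ⟨x, by rw [hx, top_root]⟩
    · rw [hE', hI] at ht
      push Not at ht
      obtain ⟨w, hw, hpw, hwE⟩ := ht.2 hr ht.1
      obtain ⟨y, h1, h2, h3, h4⟩ := descend hE.2.2 w hw hwE
      obtain ⟨x, rfl⟩ := (C.lf y).1 (Or.inr h2)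
      exact ⟨x, by rw [h4, top_mem hwE hw, hpw, top_not_mem ht.1]⟩
  have hB : ∀ v, v ∉ I → R.top E' v = R.top E v := by
    intro v
    induction v using par_induct (R := R) with
    | h0 => intro _; rw [top_root, top_root]
    | h1 v hv ih =>
      intro hvI
      by_cases h : v ∈ E
      · rw [top_mem h hv, top_mem ((hE' v).2 (Or.inl h)) hv]
        refine ih fun h2 => ?_
        exact ((hI _).1 h2).2.2 v hv rfl h
      · rw [top_not_mem h, top_not_mem]
        rw [hE']; tauto
  have hBx : ∀ x, R.top E' (T.label x) = R.top E (T.label x) := by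
    intro x
    refine hB _ fun h => ?_
    rw [hI] at h
    exact h.2.1 ((hE.2.2 _ h.1).1 (((C.lf _).2 ⟨x, rfl⟩).resolve_left h.1))
  refine ⟨fun v => R.blk T E (R.top E' v), ?_, ?_, ?_⟩
  · intro v
    obtain ⟨x, hx⟩ := hA _ (top_spec hr' v)
    exact mem_toP.2 ⟨x, by rw [hx]⟩
  · intro x B hB hx
    obtain ⟨z, rfl⟩ := mem_toP.1 hB
    rw [mem_blk] at hx
    simp only [hBx, hx]
  · intro B hB
    obtain ⟨z, rfl⟩ := mem_toP.1 hB
    set t := R.top E (T.label z) with htdef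
    have ht' : t ∉ E' := by rw [htdef, ← hBx]; exact top_spec hr' _
    have hS : {v : V | R.blk T E (R.top E' v) = R.blk T E t} = {v | R.top E' v = t} := by
      ext v
      simp only [Set.mem_setOf_eq]
      constructor
      · intro h
        have : z ∈ R.blk T E (R.top E' v) := by rw [h]; exact mem_blk.2 rfl
        exact (mem_blk.1 this).symm
      · intro h; rw [h]
    change (T.graph.induce {v : V | R.blk T E (R.top E' v) = R.blk T E t}).Connected
    rw [hS]
    have htS : t ∈ {v | R.top E' v = t} := top_not_mem ht'
    have key : ∀ v (hv : v ∈ {v | R.top E' v = t}),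
        (T.graph.induce {v | R.top E' v = t}).Reachable ⟨v, hv⟩ ⟨t, htS⟩ := by
      intro v
      induction v using par_induct (R := R) with
      | h0 =>
        intro hv
        have : R.r = t := by rw [← (show R.top E' R.r = t from hv), top_root]
        have e : (⟨R.r, hv⟩ : {v | R.top E' v = t}) = ⟨t, htS⟩ := Subtype.ext this
        rw [e]
      | h1 v hvr ih =>
        intro hv
        by_cases h : v ∈ E'
        · have hp : R.par v ∈ {v | R.top E' v = t} := by
            have : R.top E' v = t := hv
            rwa [top_mem h hvr] at this
          refine SimpleGraph.Reachable.trans (SimpleGraph.Adj.reachable ?_) (ih hp)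
          rw [SimpleGraph.comap_adj]
          exact (C.adj _ _).2 (Or.inl ⟨hvr, rfl⟩)
        · have : v = t := by rw [← (show R.top E' v = t from hv), top_not_mem h]
          have e : (⟨v, hv⟩ : {v | R.top E' v = t}) = ⟨t, htS⟩ := Subtype.ext this
          rw [e]
    haveI : Nonempty {v | R.top E' v = t} := ⟨⟨t, htS⟩⟩
    exact SimpleGraph.Connected.mk fun a b => (key a.1 a.2).trans (key b.1 b.2).symm

lemma toP_good [Fintype X] [Fintype V] (C : R.Compat T) {E : Finset V} (hE : R.Valid E) :
    Good T (R.toP T E) := ⟨toP_char E, toP_convex C hE, toP_two C hE⟩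

lemma toE_toP [Fintype X] [Fintype V] (C : R.Compat T) {E : Finset V} (hE : R.Valid E) :
    R.toE T (R.toP T E) = E := by
  ext v
  rw [mem_toE]
  by_cases hv : v = R.r
  · subst hv
    simp [hE.1]
  · rw [mem_iff_straddle hE v hv]
    constructor
    · rintro ⟨_, B, hB, x, hx, y, hy, h1, h2⟩
      obtain ⟨z, rfl⟩ := mem_toP.1 hB
      rw [mem_blk] at hx hy
      exact ⟨_, _, (C.lf _).2 ⟨x, rfl⟩, (C.lf _).2 ⟨y, rfl⟩, hx.trans hy.symm, h1, h2⟩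
    · rintro ⟨x, y, hx, hy, h, h1, h2⟩
      obtain ⟨x, rfl⟩ := (C.lf x).1 hx
      obtain ⟨y, rfl⟩ := (C.lf y).1 hy
      exact ⟨hv, _, mem_toP.2 ⟨x, rfl⟩, x, mem_blk.2 rfl, y, mem_blk.2 h.symm, h1, h2⟩

lemma exists_mate {P : Finset (Finset X)} (hP : Good T P) (x : X) :
    ∃ B ∈ P, x ∈ B ∧ ∃ y ∈ B, y ≠ x := by
  obtain ⟨B, hB, hx⟩ := hP.1.2.2 x
  obtain ⟨y, hy, hne⟩ := Finset.exists_mem_ne (hP.2.2 B hB) x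
  exact ⟨B, hB, hx, y, hy, hne⟩

lemma toE_valid [Fintype V] (C : R.Compat T) {P : Finset (Finset X)} (hP : Good T P) :
    R.Valid (R.toE T P) := by
  refine ⟨fun h => (mem_toE.1 h).1 rfl, ?_, ?_⟩
  · intro c hc hpc
    obtain ⟨x, hx⟩ := (C.lf R.r).1 (Or.inl rfl)
    obtain ⟨B, hB, hxB, y, hy, hne⟩ := exists_mate hP x
    refine mem_toE.2 ⟨hc, B, hB, y, hy, x, hxB, ?_, ?_⟩
    · have hyr : T.label y ≠ R.r := fun h => hne (T.label_inj (h.trans hx.symm))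
      rcases (le_root (R := R) (T.label y)).tail with h | ⟨u, hu, hpu, hle⟩
      · exact absurd h hyr
      · obtain ⟨d, _, _, hk⟩ := R.rootkid
        rwa [hk c hc hpc, ← hk u hu hpu]
    · rw [hx]; exact fun h => hc (root_le h)
  · intro v hv
    refine ⟨?_, ?_⟩
    · intro hl
      obtain ⟨x, rfl⟩ := (C.lf v).1 (Or.inr hl)
      obtain ⟨B, hB, hxB, y, hy, hne⟩ := exists_mate hP x
      exact mem_toE.2 ⟨hv, B, hB, x, hxB, y, hy, Le.refl _,
        fun h => hne (T.label_inj (leaf_le hl h))⟩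
    · intro a b hab ha hb hpa hpb
      have F : R.Fork v a b := fork_of hv hab ha hb hpa hpb
      have hnl : ∀ x, T.label x ≠ v := by
        intro x hx
        rcases (C.lf v).2 ⟨x, hx⟩ with h | h
        · exact hv h
        · exact h a ha hpa
      refine ⟨fun h => ?_, fun h => ?_⟩
      · obtain ⟨_, B, hB, x, hx, y, hy, h1, h2⟩ := mem_toE.1 h
        rcases F.le_iff.1 h1 with h3 | h3 | h3
        · exact absurd h3 (hnl x)
        · exact Or.inl (mem_toE.2 ⟨ha, B, hB, x, hx, y, hy, h3, fun g => h2 (g.trans F.lea)⟩)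
        · exact Or.inr (mem_toE.2 ⟨hb, B, hB, x, hx, y, hy, h3, fun g => h2 (g.trans F.leb)⟩)
      · obtain ⟨_, B, hB, x, hx, y, hy, h1, h2⟩ := mem_toE.1 h
        by_cases h3 : R.Le (T.label y) v
        · rcases F.le_iff.1 h3 with h4 | h4 | h4
          · exact absurd h4 (hnl y)
          · exact absurd h4 h2
          · exact Or.inr (mem_toE.2 ⟨hb, B, hB, y, hy, x, hx, h4, fun g => F.disj h1 g⟩)
        · exact Or.inl (mem_toE.2 ⟨hv, B, hB, x, hx, y, hy, h1.trans F.lea, h3⟩)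

/-- A state straddling the edge above `v` is the state of both ends of that edge. -/
lemma convex_step (C : R.Compat T) {S : Set V} (hS : (T.graph.induce S).Connected)
    {x y v : V} (hx : x ∈ S) (hy : y ∈ S) (hxv : R.Le x v) (hyv : ¬ R.Le y v) :
    v ∈ S ∧ R.par v ∈ S := by
  obtain ⟨p⟩ := hS.preconnected ⟨x, hx⟩ ⟨y, hy⟩
  obtain ⟨d, _, h1, h2⟩ := p.exists_boundary_dart {w | R.Le w.1 v} hxv hyv
  have h1' : R.Le d.fst.1 v := h1
  have h2' : ¬ R.Le d.snd.1 v := h2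
  have hadj : T.graph.Adj d.fst.1 d.snd.1 := d.adj
  rcases (C.adj _ _).1 hadj with ⟨h3, h4⟩ | ⟨h3, h4⟩
  · rcases h1'.head with h5 | ⟨_, h5⟩
    · have e1 : v = d.fst.1 := h5.symm
      rw [e1, h4]
      exact ⟨d.fst.2, d.snd.2⟩
    · rw [h4] at h5; exact absurd h5 h2'
  · exact absurd ((le_par h3).trans (h4.symm ▸ h1')) h2'

lemma toP_toE [Fintype X] [Fintype V] (C : R.Compat T) {P : Finset (Finset X)}
    (hP : Good T P) : R.toP T (R.toE T P) = P := by
  have hV := toE_valid C hP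
  obtain ⟨hc, ⟨h, hh1, hh2, hh3⟩, h2⟩ := hP
  have hstep : ∀ v, v ∈ R.toE T P → h v = h (R.par v) := by
    intro v hv
    obtain ⟨_, B, hB, x, hx, y, hy, h1, h2⟩ := mem_toE.1 hv
    have := convex_step C (hh3 B hB) (hh2 x B hB hx) (hh2 y B hB hy) h1 h2
    exact this.1.trans this.2.symm
  have htop : ∀ v, h v = h (R.top (R.toE T P) v) := by
    intro v
    induction v using par_induct (R := R) with
    | h0 => rw [top_root]
    | h1 v hv ih =>
      by_cases hvE : v ∈ R.toE T P
      · rw [top_mem hvE hv, ← ih, hstep v hvE]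
      · rw [top_not_mem hvE]
  have half : ∀ B ∈ P, ∀ x ∈ B, ∀ y ∈ B,
      R.Le (R.top (R.toE T P) (T.label y)) (R.top (R.toE T P) (T.label x)) := by
    intro B hB x hx y hy
    have hn := top_spec hV.1 (T.label x)
    refine top_le ?_ hn
    by_cases hr : R.top (R.toE T P) (T.label x) = R.r
    · rw [hr]; exact le_root _
    · by_contra hcon
      exact hn (mem_toE.2 ⟨hr, B, hB, x, hx, y, hy, le_top _ _, hcon⟩)
  have key : ∀ B ∈ P, ∀ x ∈ B,
      R.blk T (R.toE T P) (R.top (R.toE T P) (T.label x)) = B := by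
    intro B hB x hx
    ext y
    rw [mem_blk]
    constructor
    · intro e
      obtain ⟨B', hB', hy⟩ := hc.2.2 y
      have e1 := hh2 x B hB hx
      have e2 := hh2 y B' hB' hy
      rw [htop] at e1 e2
      rw [← e1, ← e, e2]
      exact hy
    · intro hy
      exact (half B hB x hx y hy).antisymm (half B hB y hy x hx)
  ext B
  rw [mem_toP]
  constructor
  · rintro ⟨x, rfl⟩
    obtain ⟨B, hB, hx⟩ := hc.2.2 x
    rw [key B hB x hx]; exact hB
  · intro hB
    obtain ⟨x, hx⟩ := hc.1 B hB
    exact ⟨x, key B hB x hx⟩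

open Classical in
lemma card_good [Fintype X] [Fintype V] (C : R.Compat T) :
    (Finset.univ.filter fun P => Good T P).card = Nat.fib (Nat.card X - 1) := by
  have e : (Finset.univ.filter fun v => R.Lf v).card = Nat.card X := by
    rw [Nat.card_eq_fintype_card, ← Finset.card_univ,
      ← Finset.card_image_of_injective Finset.univ T.label_inj]
    congr 1
    ext v
    simp [C.lf]
  rw [← e, ← count_valid (R := R)]
  refine Finset.card_nbij' (R.toE T) (R.toP T) ?_ ?_ ?_ ?_
  · intro P hP
    simp only [Finset.coe_filter, Finset.mem_univ, true_and, Set.mem_setOf_eq] at hP ⊢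
    exact toE_valid C hP
  · intro E hE
    simp only [Finset.coe_filter, Finset.mem_univ, true_and, Set.mem_setOf_eq] at hE ⊢
    exact toP_good C hE
  · intro P hP
    simp only [Finset.coe_filter, Finset.mem_univ, true_and, Set.mem_setOf_eq] at hP
    exact toP_toE C hP
  · intro E hE
    simp only [Finset.coe_filter, Finset.mem_univ, true_and, Set.mem_setOf_eq] at hE
    exact toE_toP C hE

end PT

lemma exists_parent {V : Type} {G : SimpleGraph V} (hG : G.IsTree) (r v : V) (hv : v ≠ r) :
    ∃ w, G.Adj v w ∧ G.dist v r = G.dist w r + 1 ∧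
      ∀ w', G.Adj v w' → G.dist v r = G.dist w' r + 1 → w' = w := by
  obtain ⟨p, hp, hl⟩ := hG.connected.exists_path_of_dist v r
  cases p with
  | nil => exact absurd rfl hv
  | @cons _ w _ hadj q =>
    have key : ∀ w', G.Adj v w' → G.dist v r = G.dist w' r + 1 → w' = w := by
      intro w' hadj' hd
      obtain ⟨q', hq'⟩ := hG.connected.exists_walk_length_eq_dist w' r
      have hp' : (SimpleGraph.Walk.cons hadj' q').IsPath :=
        SimpleGraph.Walk.isPath_of_length_eq_dist _ (by
          rw [SimpleGraph.Walk.length_cons, hq', hd])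
      have := (hG.existsUnique_path v r).unique hp hp'
      have h2 := congrArg SimpleGraph.Walk.snd this
      simpa using h2.symm
    refine ⟨w, hadj, ?_, key⟩
    have h1 : G.dist w r ≤ q.length := SimpleGraph.dist_le q
    have h2 := hG.dist_eq_dist_add_one_of_adj r hadj
    rw [SimpleGraph.Walk.length_cons] at hl
    rw [SimpleGraph.dist_comm (u := r) (v := v), SimpleGraph.dist_comm (u := r) (v := w)] at h2
    omega

lemma exists_compat {V X : Type} [Finite V] (T : UnrootedBinaryTree V X) (x₀ : X) :
    ∃ R : PT V, R.Compat T := by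
  classical
  set r := T.label x₀ with hrdef
  have hr1 : vdeg T.graph r = 1 := T.label_leaf x₀
  have hex : ∀ v, ∃ w, v ≠ r → (T.graph.Adj v w ∧ T.graph.dist v r = T.graph.dist w r + 1 ∧
      ∀ w', T.graph.Adj v w' → T.graph.dist v r = T.graph.dist w' r + 1 → w' = w) := by
    intro v
    by_cases hv : v = r
    · exact ⟨v, fun h => absurd hv h⟩
    · obtain ⟨w, hw⟩ := exists_parent T.isTree r v hv
      exact ⟨w, fun _ => hw⟩
  choose par hpar using hex
  have hadj : ∀ u v, T.graph.Adj u v ↔ (u ≠ r ∧ par u = v) ∨ (v ≠ r ∧ par v = u) := by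
    intro u v
    constructor
    · intro h
      have hd := T.isTree.dist_eq_dist_add_one_of_adj r h
      rw [SimpleGraph.dist_comm (u := r) (v := v), SimpleGraph.dist_comm (u := r) (v := u)] at hd
      rcases hd with hd | hd
      · have hu : u ≠ r := by rintro rfl; simp at hd
        exact Or.inl ⟨hu, ((hpar u hu).2.2 v h hd).symm⟩
      · have hu : v ≠ r := by rintro rfl; simp at hd
        exact Or.inr ⟨hu, ((hpar v hu).2.2 u h.symm hd).symm⟩
    · rintro (⟨h, rfl⟩ | ⟨h, rfl⟩)
      · exact (hpar _ h).1
      · exact (hpar _ h).1.symm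
  let K : V → Set V := fun v => {w | w ≠ r ∧ par w = v}
  have hK : ∀ v w, w ∈ K v ↔ w ≠ r ∧ par w = v := fun v w => Iff.rfl
  have hKr : (K r).ncard = 1 := by
    rw [← hr1, vdeg]
    congr 1
    ext w
    rw [hK, SimpleGraph.mem_neighborSet, hadj]
    tauto
  have hKv : ∀ v, v ≠ r → vdeg T.graph v = (K v).ncard + 1 := by
    intro v hv
    have hn : par v ∉ K v := by
      rw [hK]
      rintro ⟨h1, h2⟩
      have e1 := (hpar v hv).2.1
      have e2 := (hpar _ h1).2.1
      rw [h2] at e2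
      omega
    rw [vdeg, ← Set.ncard_insert_of_notMem hn (Set.toFinite _)]
    congr 1
    ext w
    rw [Set.mem_insert_iff, hK, SimpleGraph.mem_neighborSet, hadj]
    constructor
    · rintro (⟨_, h⟩ | h)
      · exact Or.inl h.symm
      · exact Or.inr h
    · rintro (h | h)
      · exact Or.inl ⟨hv, h.symm⟩
      · exact Or.inr h
  let R : PT V :=
    { r := r
      par := par
      dep := fun v => T.graph.dist v r
      hdep := fun v hv => by
        have := (hpar v hv).2.1
        change T.graph.dist (par v) r < T.graph.dist v r
        omega
      kids := by
        intro v hv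
        have h0 := hKv v hv
        rcases T.degOneOrThree v with h | h
        · left
          have h1 : (K v).ncard = 0 := by omega
          rw [Set.ncard_eq_zero (Set.toFinite _)] at h1
          intro w hw hp
          have : w ∈ K v := ⟨hw, hp⟩
          rw [h1] at this
          exact this
        · right
          have h1 : (K v).ncard = 2 := by omega
          obtain ⟨a, b, hab, he⟩ := Set.ncard_eq_two.1 h1
          have ha : a ∈ K v := by rw [he]; simp
          have hb : b ∈ K v := by rw [he]; simp
          refine ⟨a, b, hab, ha.1, hb.1, ha.2, hb.2, fun w hw hp => ?_⟩
          have : w ∈ K v := ⟨hw, hp⟩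
          rw [he] at this
          simpa using this
      rootkid := by
        obtain ⟨c, he⟩ := Set.ncard_eq_one.1 hKr
        have hc : c ∈ K r := by rw [he]; simp
        refine ⟨c, hc.1, hc.2, fun w hw hp => ?_⟩
        have : w ∈ K r := ⟨hw, hp⟩
        rw [he] at this
        simpa using this }
  refine ⟨R, hadj, ?_⟩
  intro v
  have h1 : (∃ x, T.label x = v) ↔ vdeg T.graph v = 1 :=
    ⟨by rintro ⟨x, rfl⟩; exact T.label_leaf x, T.leaf_label v⟩
  rw [h1]
  by_cases hv : v = r
  · exact ⟨fun _ => hv ▸ hr1, fun _ => Or.inl hv⟩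
  · have h0 : vdeg T.graph v = 1 ↔ K v = ∅ := by
      rw [hKv v hv, ← Set.ncard_eq_zero (Set.toFinite _)]; omega
    rw [h0]
    constructor
    · rintro (h | h)
      · exact absurd h hv
      · exact Set.eq_empty_iff_forall_notMem.2 fun w hw => h w hw.1 hw.2
    · intro h
      refine Or.inr fun w hw hp => ?_
      have : w ∈ K v := ⟨hw, hp⟩
      rw [h] at this
      exact this

/-- A character has at most as many states as there are taxa. -/
lemma char_card_le {X : Type} [Fintype X] {P : Finset (Finset X)} (hP : IsCharacter P) :
    P.card ≤ Fintype.card X := by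
  classical
  have hc : ∀ B : P, ∃ x, x ∈ B.1 := fun B => hP.1 B.1 B.2
  choose f hf using hc
  have hinj : Function.Injective f := by
    intro B B' h
    by_contra hne
    have := hP.2.1 B.1 B.2 B'.1 B'.2 (fun e => hne (Subtype.ext e))
    exact Finset.disjoint_left.1 this (hf B) (h ▸ hf B')
  simpa using Fintype.card_le_of_injective f hinj

lemma gTotal_eq {V X : Type} [Fintype X] [Nonempty X] (T : UnrootedBinaryTree V X)
    [DecidablePred fun P => PT.Good T P] :
    gTotal T 2 = (Finset.univ.filter fun P => PT.Good T P).card := by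
  classical
  have hmaps : ∀ P ∈ Finset.univ.filter (fun P => PT.Good T P),
      P.card ∈ Finset.Icc 1 (Nat.card X) := by
    intro P hP
    have hG := (Finset.mem_filter.1 hP).2
    rw [Finset.mem_Icc, Nat.card_eq_fintype_card]
    refine ⟨?_, char_card_le hG.1⟩
    obtain ⟨B, hB, _⟩ := hG.1.2.2 (Classical.arbitrary X)
    exact Finset.card_pos.2 ⟨B, hB⟩
  rw [Finset.card_eq_sum_card_fiberwise hmaps, gTotal]
  refine Finset.sum_congr rfl fun k _ => ?_
  rw [gCount, Nat.card_eq_fintype_card, Fintype.card_subtype, Finset.filter_filter]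
  congr 1
  ext P
  rw [Finset.mem_filter, Finset.mem_filter]
  simp only [Finset.mem_univ, true_and, PT.Good]
  tauto

/-- the number of convex characters in which every state appears on
at least two taxa is `F(n-1)`. -/
theorem g2_eq_fib {V X : Type} [Finite V] [Finite X]
    (T : UnrootedBinaryTree V X) (n : ℕ) (hn : Nat.card X = n) (hn2 : 2 ≤ n) :
    gTotal T 2 = Nat.fib (n - 1) := by
  classical
  haveI := Fintype.ofFinite V
  haveI := Fintype.ofFinite X
  subst hn
  haveI : Nonempty X := (Nat.card_pos_iff.1 (by omega)).1
  obtain ⟨R, C⟩ := exists_compat T (Classical.arbitrary X)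
  rw [gTotal_eq, ← PT.card_good C]
end

section
/- Let T be an unrooted binary phylogenetic tree on a taxon set X, and let x, y be two leaves of T forming a cherry (i.e., x and y have a common neighbour). If f is a convex character on T in which every state appears on at least two taxa, then x and y lie in the same state (block) of f. -/
open SimpleGraph

/-- A leaf whose state has at least two taxa forces its state on its neighbour. -/
theorem leaf_neighbor_state {V X : Type}
    (T : UnrootedBinaryTree V X) (x : X) (u : V)
    (hx : T.graph.Adj (T.label x) u) (h : V → Finset X) (B : Finset X) (hxB : x ∈ B)
    (hlab : ∀ z ∈ B, h (T.label z) = B)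
    (hc : (T.graph.induce {v : V | h v = B}).Connected)
    (hk : 2 ≤ B.card) : h u = B := by
  obtain ⟨z, hz, hzx⟩ := Finset.exists_mem_ne (by omega : 1 < B.card) x
  obtain ⟨a, ha⟩ : ∃ a : {v : V | h v = B}, a.1 = T.label x := ⟨⟨T.label x, hlab x hxB⟩, rfl⟩
  obtain ⟨b, hb⟩ : ∃ b : {v : V | h v = B}, b.1 = T.label z := ⟨⟨T.label z, hlab z hz⟩, rfl⟩
  have hab : a ≠ b := fun e => hzx (T.label_inj (by rw [← ha, ← hb, e]))
  obtain ⟨p⟩ := hc.preconnected a b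
  cases p with
  | nil => exact absurd rfl hab
  | @cons _ w _ hadj _ =>
    have hw : T.graph.Adj (T.label x) w.1 := ha ▸ hadj
    obtain ⟨c, hc'⟩ := Set.ncard_eq_one.mp (T.label_leaf x)
    have h1 : u ∈ T.graph.neighborSet (T.label x) := hx
    have h2 : w.1 ∈ T.graph.neighborSet (T.label x) := hw
    rw [hc', Set.mem_singleton_iff] at h1 h2
    rw [h1, ← h2]
    exact w.2

/-- if `x, y` form a cherry and `f` is a convex character in which each
state appears on at least two taxa, then `x` and `y` lie in the same state. -/
theorem cherry_same_state {V X : Type} [Finite V] [Finite X]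
    (T : UnrootedBinaryTree V X) (x y : X) (u : V) (hxy : x ≠ y)
    (hx : T.graph.Adj (T.label x) u) (hy : T.graph.Adj (T.label y) u)
    (P : Finset (Finset X)) (hP : IsCharacter P) (hconv : IsConvexChar T P)
    (hk : ∀ B ∈ P, 2 ≤ B.card) :
    ∃ B ∈ P, x ∈ B ∧ y ∈ B := by
  obtain ⟨h, _, hl, hc⟩ := hconv
  obtain ⟨B, hB, hxB⟩ := hP.2.2 x
  obtain ⟨C, hC, hyC⟩ := hP.2.2 y
  have h1 := leaf_neighbor_state T x u hx h B hxB (fun z hz => hl z B hB hz) (hc B hB) (hk B hB)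
  have h2 := leaf_neighbor_state T y u hy h C hyC (fun z hz => hl z C hC hz) (hc C hC) (hk C hC)
  have e : C = B := h2.symm.trans h1
  exact ⟨B, hB, hxB, e ▸ hyC⟩
end

section
/- There exist two unrooted binary phylogenetic trees T₁ and T₂ on the same set of 9 taxa such that g_3(T₁) ≠ g_3(T₂); specifically, one can choose such trees with g_3(T₁) = 5 and g_3(T₂) = 6. Hence, unlike the cases k = 1 and k = 2, the number of convex characters in which each state appears on at least 3 taxa depends on the topology of the tree. -/
open SimpleGraph

namespace G3

/-- graph given by a parent function -/
def mk (par : Fin 16 → Fin 16) : SimpleGraph (Fin 16) where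
  Adj a b := a ≠ b ∧ (par a = b ∨ par b = a)
  symm := ⟨fun _ _ h => ⟨h.1.symm, h.2.symm⟩⟩
  loopless := ⟨fun _ h => h.1 rfl⟩

instance (par : Fin 16 → Fin 16) : DecidableRel (mk par).Adj := fun a b =>
  inferInstanceAs (Decidable (a ≠ b ∧ (par a = b ∨ par b = a)))

def lab (x : Fin 9) : Fin 16 := ⟨x.1 + 7, by omega⟩

def climb (par : Fin 16 → Fin 16) (v : Fin 16) : ℕ → Fin 16 → Fin 16
  | 0, w => w
  | n + 1, w => if par w = v ∧ w ≠ 0 then w else climb par v n (par w)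

def br (par : Fin 16 → Fin 16) (v w : Fin 16) : Fin 16 := climb par v 8 w

/-- top-connectedness gives connectedness -/
lemma conn_of_top (par : Fin 16 → Fin 16) (hpar : ∀ v, v ≠ 0 → par v < v)
    (S : Set (Fin 16)) (t : Fin 16) (ht : t ∈ S)
    (h : ∀ v ∈ S, v ≠ t → v ≠ 0 ∧ par v ∈ S) : ((mk par).induce S).Connected := by
  have key : ∀ n : ℕ, ∀ v : Fin 16, v.1 = n → ∀ hv : v ∈ S,
      ((mk par).induce S).Reachable ⟨v, hv⟩ ⟨t, ht⟩ := by
    intro n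
    induction n using Nat.strong_induction_on with
    | _ n ih =>
      intro v hn hv
      by_cases hvt : v = t
      · subst hvt; exact Reachable.refl _
      · obtain ⟨h0, hp⟩ := h v hv hvt
        have hlt := hpar v h0
        have h1 := ih (par v).1 (by rw [← hn]; exact hlt) (par v) rfl hp
        refine Reachable.trans (Adj.reachable ?_) h1
        exact ⟨hlt.ne', Or.inl rfl⟩
  have : Nonempty S := ⟨⟨t, ht⟩⟩
  refine ⟨?_⟩
  rintro ⟨a, ha⟩ ⟨b, hb⟩
  exact (key _ a rfl ha).trans (key _ b rfl hb).symm

lemma conn_mk (par : Fin 16 → Fin 16) (hpar : ∀ v, v ≠ 0 → par v < v) :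
    (mk par).Connected := by
  have := conn_of_top par hpar Set.univ 0 trivial (fun v _ h => ⟨h, trivial⟩)
  exact (SimpleGraph.induceUnivIso (mk par)).connected_iff.1 this

lemma vdeg_mk (par : Fin 16 → Fin 16) (v : Fin 16) :
    vdeg (mk par) v = (Finset.univ.filter (fun w => (mk par).Adj v w)).card := by
  unfold vdeg
  rw [← Set.ncard_coe_finset]
  congr 1
  ext w
  simp

/-- separation: a connected class meeting two branches at `v` contains `v`. -/
lemma sep (par : Fin 16 → Fin 16) (v : Fin 16)
    (hbr : ∀ a b, (mk par).Adj a b → a ≠ v → b ≠ v → br par v a = br par v b)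
    (S : Set (Fin 16)) (hS : ((mk par).induce S).Connected) (x y : Fin 16)
    (hx : x ∈ S) (hy : y ∈ S) (hxy : br par v x ≠ br par v y) : v ∈ S := by
  by_contra hv
  apply hxy
  obtain ⟨p⟩ := hS.preconnected ⟨x, hx⟩ ⟨y, hy⟩
  have : ∀ (a b : S), ((mk par).induce S).Walk a b → br par v a.1 = br par v b.1 := by
    intro a b p
    induction p with
    | nil => rfl
    | @cons a b c hab _ ih =>
      rw [← ih]
      exact hbr _ _ hab (fun h => hv (h ▸ a.2)) (fun h => hv (h ▸ b.2))
  exact this _ _ p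

/-- mask `m` meets mask `l` -/
def occ (m l : ℕ) : Bool := !(Nat.beq (Nat.land m l) 0)

def two (m : ℕ) (t : ℕ × ℕ × ℕ) : Bool :=
  match occ m t.1, occ m t.2.1, occ m t.2.2 with
  | true, true, _ => true
  | true, false, b => b
  | false, true, b => b
  | false, false, _ => false

def atMostOne : Bool → Bool → Bool → Bool
  | true, true, _ => false
  | true, false, b => !b
  | false, true, b => !b
  | false, false, _ => true

def ok1 (m0 m1 m2 : ℕ) (t : ℕ × ℕ × ℕ) : Bool :=
  atMostOne (two m0 t) (two m1 t) (two m2 t)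

abbrev Table := List (Fin 16 × ℕ × ℕ × ℕ)

def ok (tb : Table) (m0 m1 m2 : ℕ) : Bool := tb.all (fun t => ok1 m0 m1 m2 t.2)

/-- the mask of the leaves below `k` having colour `c` -/
def M (f : Fin 9 → Fin 3) (c : Fin 3) : ℕ → ℕ
  | 0 => 0
  | k + 1 => if f (Fin.ofNat 9 k) = c then Nat.lor (M f c k) (Nat.pow 2 k) else M f c k

lemma testBit_M (f : Fin 9 → Fin 3) (c : Fin 3) (k x : ℕ) :
    (M f c k).testBit x = true ↔ x < k ∧ f (Fin.ofNat 9 x) = c := by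
  induction k with
  | zero => simp [M]
  | succ k ih =>
    unfold M
    split
    · rename_i h
      change (M f c k ||| 2 ^ k).testBit x = true ↔ _
      rw [Nat.testBit_lor, Bool.or_eq_true, ih, Nat.testBit_two_pow]
      simp only [decide_eq_true_eq]
      constructor
      · rintro (⟨h1, h2⟩ | rfl)
        · exact ⟨by omega, h2⟩
        · exact ⟨by omega, h⟩
      · rintro ⟨h1, h2⟩
        by_cases hx : k = x
        · exact Or.inr hx
        · exact Or.inl ⟨by omega, h2⟩
    · rename_i h
      rw [ih]
      constructor
      · rintro ⟨h1, h2⟩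
        exact ⟨by omega, h2⟩
      · rintro ⟨h1, h2⟩
        by_cases hx : k = x
        · subst hx; exact absurd h2 h
        · exact ⟨by omega, h2⟩

def sz (f : Fin 9 → Fin 3) (c : Fin 3) : ℕ := (Finset.univ.filter (fun x => f x = c)).card

def charOf (f : Fin 9 → Fin 3) : Finset (Finset (Fin 9)) :=
  Finset.univ.image (fun x => Finset.univ.filter (fun y => f y = f x))

lemma two_spec {f : Fin 9 → Fin 3} {t : ℕ × ℕ × ℕ} {c : Fin 3} {k : ℕ} (hk : k ≤ 9)
    (h : two (M f c k) t = true) : ∃ x y : Fin 9, f x = c ∧ f y = c ∧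
      ((t.1.testBit x = true ∧ t.2.1.testBit y = true) ∨
       (t.1.testBit x = true ∧ t.2.2.testBit y = true) ∨
       (t.2.1.testBit x = true ∧ t.2.2.testBit y = true)) := by
  have ho : ∀ l, occ (M f c k) l = true → ∃ x : Fin 9, l.testBit x = true ∧ f x = c := by
    intro l hl
    have hl' : M f c k &&& l ≠ 0 := by
      intro h0
      change (!(Nat.beq (M f c k &&& l) 0)) = true at hl
      rw [h0] at hl
      simp at hl
    obtain ⟨x, hx⟩ := Nat.exists_testBit_of_ne_zero hl'
    rw [Nat.testBit_land, Bool.and_eq_true, testBit_M] at hx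
    obtain ⟨⟨h1, h2⟩, h3⟩ := hx
    refine ⟨Fin.ofNat 9 x, ?_, h2⟩
    have : (Fin.ofNat 9 x).1 = x := Nat.mod_eq_of_lt (by omega)
    rw [this]
    exact h3
  unfold two at h
  split at h
  · rename_i h1 h2
    obtain ⟨x, hx, hx'⟩ := ho _ h1
    obtain ⟨y, hy, hy'⟩ := ho _ h2
    exact ⟨x, y, hx', hy', Or.inl ⟨hx, hy⟩⟩
  · rename_i h1 h2
    obtain ⟨x, hx, hx'⟩ := ho _ h1
    obtain ⟨y, hy, hy'⟩ := ho _ h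
    exact ⟨x, y, hx', hy', Or.inr (Or.inl ⟨hx, hy⟩)⟩
  · rename_i h1 h2
    obtain ⟨x, hx, hx'⟩ := ho _ h2
    obtain ⟨y, hy, hy'⟩ := ho _ h
    exact ⟨x, y, hx', hy', Or.inr (Or.inr ⟨hx, hy⟩)⟩
  · simp at h

lemma ok1_of {m : Fin 3 → ℕ} {t : ℕ × ℕ × ℕ} (d : Fin 3)
    (h : ∀ c, two (m c) t = true → c = d) : ok1 (m 0) (m 1) (m 2) t = true := by
  have h0 := h 0
  have h1 := h 1
  have h2 := h 2
  unfold ok1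
  clear h
  generalize two (m 0) t = a at *
  generalize two (m 1) t = b at *
  generalize two (m 2) t = c at *
  revert d a b c
  decide

/-- all pairs from the two leaf masks lie in different branches at `v` -/
def Sep (par : Fin 16 → Fin 16) (v : Fin 16) (l l' : ℕ) : Prop :=
  ∀ x : Fin 9, l.testBit x = true → ∀ y : Fin 9, l'.testBit y = true →
    br par v (lab x) ≠ br par v (lab y)

instance (par : Fin 16 → Fin 16) (v : Fin 16) (l l' : ℕ) :
    Decidable (Sep par v l l') :=
  inferInstanceAs (Decidable (∀ x : Fin 9, l.testBit x = true → ∀ y : Fin 9, l'.testBit y = true →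
    br par v (lab x) ≠ br par v (lab y)))

/-- table is correct -/
def TableOK (par : Fin 16 → Fin 16) (tb : Table) : Prop :=
  ∀ t ∈ tb, Sep par t.1 t.2.1 t.2.2.1 ∧ Sep par t.1 t.2.1 t.2.2.2 ∧ Sep par t.1 t.2.2.1 t.2.2.2

instance (par : Fin 16 → Fin 16) (tb : Table) : Decidable (TableOK par tb) :=
  inferInstanceAs (Decidable (∀ t ∈ tb,
    Sep par t.1 t.2.1 t.2.2.1 ∧ Sep par t.1 t.2.1 t.2.2.2 ∧ Sep par t.1 t.2.2.1 t.2.2.2))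

/-- colouring data certifying convexity of `charOf (hc ∘ lab)` with tops `tp`. -/
def CertOK (par : Fin 16 → Fin 16) (hc : Fin 16 → Fin 3) (tp : Fin 3 → Fin 16) : Prop :=
  (∀ v, ∃ x, hc (lab x) = hc v) ∧
  (∀ v, hc (tp (hc v)) = hc v) ∧
  (∀ v, v ≠ tp (hc v) → v ≠ 0 ∧ hc (par v) = hc v) ∧
  (∀ x, 3 ≤ sz (fun y => hc (lab y)) (hc (lab x)))

instance (par : Fin 16 → Fin 16) (hc : Fin 16 → Fin 3) (tp : Fin 3 → Fin 16) :
    Decidable (CertOK par hc tp) :=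
  inferInstanceAs (Decidable ((∀ v, ∃ x, hc (lab x) = hc v) ∧
    (∀ v, hc (tp (hc v)) = hc v) ∧
    (∀ v, v ≠ tp (hc v) → v ≠ 0 ∧ hc (par v) = hc v) ∧
    (∀ x, 3 ≤ sz (fun y => hc (lab y)) (hc (lab x)))))

lemma charOf_isChar (f : Fin 9 → Fin 3) : IsCharacter (charOf f) := by
  refine ⟨?_, ?_, ?_⟩
  · intro B hB
    simp only [charOf, Finset.mem_image, Finset.mem_univ, true_and] at hB
    obtain ⟨x, rfl⟩ := hB
    exact ⟨x, by simp⟩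
  · intro B hB B' hB' hne
    simp only [charOf, Finset.mem_image, Finset.mem_univ, true_and] at hB hB'
    obtain ⟨x, rfl⟩ := hB
    obtain ⟨y, rfl⟩ := hB'
    rw [Finset.disjoint_left]
    intro z hz hz'
    simp only [Finset.mem_filter, Finset.mem_univ, true_and] at hz hz'
    exact hne (by rw [← hz, ← hz'])
  · intro x
    exact ⟨_, Finset.mem_image_of_mem _ (Finset.mem_univ x), by simp⟩

lemma suff (par : Fin 16 → Fin 16) (hpar : ∀ v, v ≠ 0 → par v < v)
    (T : UnrootedBinaryTree (Fin 16) (Fin 9)) (hT : T.graph = mk par) (hl : T.label = lab)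
    (hc : Fin 16 → Fin 3) (tp : Fin 3 → Fin 16) (h : CertOK par hc tp) :
    IsConvexChar T (charOf (fun x => hc (lab x))) ∧
      ∀ B ∈ charOf (fun x => hc (lab x)), 3 ≤ B.card := by
  obtain ⟨h1, h2, h3, h4⟩ := h
  constructor
  · refine ⟨fun v => Finset.univ.filter (fun y => hc (lab y) = hc v), ?_, ?_, ?_⟩
    · intro v
      obtain ⟨x, hx⟩ := h1 v
      simp only [charOf, Finset.mem_image, Finset.mem_univ, true_and]
      exact ⟨x, by rw [hx]⟩
    · intro x B hB hx
      simp only [charOf, Finset.mem_image, Finset.mem_univ, true_and] at hB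
      obtain ⟨z, rfl⟩ := hB
      simp only [Finset.mem_filter, Finset.mem_univ, true_and] at hx
      show Finset.univ.filter (fun y => hc (lab y) = hc (T.label x)) = _
      rw [hl, hx]
    · intro B hB
      simp only [charOf, Finset.mem_image, Finset.mem_univ, true_and] at hB
      obtain ⟨z, rfl⟩ := hB
      have hS : {v : Fin 16 | Finset.univ.filter (fun y => hc (lab y) = hc v) =
          Finset.univ.filter (fun y => hc (lab y) = hc (lab z))} =
          {v | hc v = hc (lab z)} := by
        ext v
        simp only [Set.mem_ofPred_eq]
        constructor
        · intro h
          have : z ∈ Finset.univ.filter (fun y => hc (lab y) = hc v) := by rw [h]; simp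
          exact (Finset.mem_filter.1 this).2.symm
        · intro h; rw [h]
      rw [hS, hT]
      refine conn_of_top par hpar _ (tp (hc (lab z))) (h2 (lab z)) ?_
      intro v hv hne
      simp only [Set.mem_ofPred_eq] at hv ⊢
      rw [← hv] at hne ⊢
      exact h3 v hne
  · intro B hB
    simp only [charOf, Finset.mem_image, Finset.mem_univ, true_and] at hB
    obtain ⟨z, rfl⟩ := hB
    exact h4 z

lemma nec (par : Fin 16 → Fin 16)
    (hbr : ∀ v a b, (mk par).Adj a b → a ≠ v → b ≠ v → br par v a = br par v b)
    (tb : Table) (htb : TableOK par tb)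
    (T : UnrootedBinaryTree (Fin 16) (Fin 9)) (hT : T.graph = mk par) (hl : T.label = lab)
    (P : Finset (Finset (Fin 9))) (hP : IsCharacter P) (hcv : IsConvexChar T P)
    (h3 : ∀ B ∈ P, 3 ≤ B.card) :
    ∃ f : Fin 9 → Fin 3, P = charOf f ∧
      (∀ k ≤ 9, ok tb (M f 0 k) (M f 1 k) (M f 2 k) = true) ∧ ∀ c, sz f c = 0 ∨ 3 ≤ sz f c := by
  obtain ⟨hne, hdis, hcov⟩ := hP
  obtain ⟨h, hh1, hh2, hh3⟩ := hcv
  have hcard : P.card ≤ 3 := by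
    have e1 : (P.biUnion id).card = ∑ B ∈ P, B.card :=
      Finset.card_biUnion (fun B hB B' hB' hn => hdis B hB B' hB' hn)
    have e2 : (P.biUnion id).card ≤ 9 := by
      simpa using Finset.card_le_univ (P.biUnion id)
    have e3 : P.card • 3 ≤ ∑ B ∈ P, B.card := Finset.card_nsmul_le_sum _ _ _ h3
    simp only [smul_eq_mul] at e3
    omega
  obtain ⟨e⟩ : Nonempty (P ↪ Fin 3) := by
    apply Function.Embedding.nonempty_of_card_le
    simpa using hcard
  let hc : Fin 16 → Fin 3 := fun v => e ⟨h v, hh1 v⟩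
  have hhc : ∀ u v, hc u = hc v ↔ h u = h v := by
    intro u v
    simp only [hc, e.injective.eq_iff, Subtype.mk.injEq]
  have hmem : ∀ x, x ∈ h (lab x) := by
    intro x
    obtain ⟨B, hB, hx⟩ := hcov x
    have := hh2 x B hB hx
    rw [hl] at this
    rwa [this]
  have hmem2 : ∀ x v, x ∈ h v ↔ h (lab x) = h v := by
    intro x v
    constructor
    · intro hx
      have := hh2 x _ (hh1 v) hx
      rwa [hl] at this
    · intro hx; rw [← hx]; exact hmem x
  have hblk : ∀ v, Finset.univ.filter (fun y => hc (lab y) = hc v) = h v := by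
    intro v
    ext y
    simp [hhc, hmem2]
  have hPf : P = charOf (fun x => hc (lab x)) := by
    ext B
    simp only [charOf, Finset.mem_image, Finset.mem_univ, true_and, hblk]
    constructor
    · intro hB
      obtain ⟨x, hx⟩ := hne B hB
      refine ⟨x, ?_⟩
      have := hh2 x B hB hx
      rwa [hl] at this
    · rintro ⟨x, rfl⟩
      exact hh1 _
  refine ⟨fun x => hc (lab x), hPf, ?_, ?_⟩
  · intro k hk
    unfold ok
    rw [List.all_eq_true]
    intro t ht
    apply ok1_of (m := fun c => M _ c k) (hc t.1)
    intro c hc2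
    obtain ⟨x, y, hx, hy, hxy⟩ := two_spec hk hc2
    have hb : br par t.1 (lab x) ≠ br par t.1 (lab y) := by
      obtain ⟨t1, t2, t3⟩ := htb t ht
      rcases hxy with ⟨a, b⟩ | ⟨a, b⟩ | ⟨a, b⟩
      · exact t1 x a y b
      · exact t2 x a y b
      · exact t3 x a y b
    have hcon := hh3 (h (lab x)) (hh1 _)
    rw [hT] at hcon
    have := sep par t.1 (hbr t.1) _ hcon (lab x) (lab y) rfl
      ((hhc _ _).1 (hy.trans hx.symm)) hb
    rw [← hx]
    exact ((hhc _ _).2 this).symm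
  · intro c
    by_cases hcc : ∃ x, hc (lab x) = c
    · obtain ⟨x, rfl⟩ := hcc
      right
      have := h3 _ (hh1 (lab x))
      rw [← hblk] at this
      exact this
    · left
      simp only [not_exists] at hcc
      simp [sz, hcc]

def mkTree (par : Fin 16 → Fin 16) (hpar : ∀ v, v ≠ 0 → par v < v)
    (hd : ∀ v, (Finset.univ.filter (fun w => (mk par).Adj v w)).card = if v < 7 then 3 else 1) :
    UnrootedBinaryTree (Fin 16) (Fin 9) where
  graph := mk par
  isTree := by
    rw [isTree_iff_connected_and_card]
    refine ⟨conn_mk par hpar, ?_⟩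
    have hs := (mk par).sum_degrees_eq_twice_card_edges
    have hdeg : ∀ v, (mk par).degree v = if v < 7 then 3 else 1 := by
      intro v
      rw [← hd v, ← card_neighborFinset_eq_degree, neighborFinset_eq_filter]
    have h30 : ∑ v : Fin 16, (if v < 7 then 3 else 1) = 30 := by decide
    rw [Finset.sum_congr rfl (fun v _ => hdeg v), h30] at hs
    rw [Nat.card_eq_fintype_card, ← edgeFinset_card, Nat.card_eq_fintype_card, Fintype.card_fin]
    omega
  degOneOrThree v := by
    rw [vdeg_mk, hd]
    split <;> simp
  label := lab
  label_inj a b h := by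
    simp only [lab, Fin.mk.injEq] at h
    ext; omega
  label_leaf x := by
    rw [vdeg_mk, hd, if_neg]
    simp [lab, Fin.lt_def]
  leaf_label v h := by
    rw [vdeg_mk, hd] at h
    split at h
    · omega
    · rename_i h7
      have : 7 ≤ v.1 := by simpa [Fin.lt_def] using h7
      exact ⟨⟨v.1 - 7, by omega⟩, by ext; simp only [lab]; omega⟩

abbrev Cert := (Fin 16 → Fin 3) × (Fin 3 → Fin 16)

def listOf (cs : List Cert) : Finset (Finset (Finset (Fin 9))) :=
  (cs.map (fun c => charOf (fun x => c.1 (lab x)))).toFinset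

lemma total (par : Fin 16 → Fin 16) (hpar : ∀ v, v ≠ 0 → par v < v)
    (hbr : ∀ v a b, (mk par).Adj a b → a ≠ v → b ≠ v → br par v a = br par v b)
    (tb : Table) (htb : TableOK par tb)
    (T : UnrootedBinaryTree (Fin 16) (Fin 9)) (hT : T.graph = mk par) (hl : T.label = lab)
    (cs : List Cert) (hcs : ∀ c ∈ cs, CertOK par c.1 c.2)
    (hall : ∀ f : Fin 9 → Fin 3, (∀ k ≤ 9, ok tb (M f 0 k) (M f 1 k) (M f 2 k) = true) →
      (∀ c, sz f c = 0 ∨ 3 ≤ sz f c) →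
      charOf f ∈ listOf cs) :
    gTotal T 3 = ∑ r ∈ Finset.Icc 1 9, ((listOf cs).filter (fun P => P.card = r)).card := by
  unfold gTotal
  rw [Nat.card_eq_fintype_card, Fintype.card_fin]
  refine Finset.sum_congr rfl fun r _ => ?_
  unfold gCount
  rw [← Nat.card_eq_finsetCard]
  refine Nat.card_congr (Equiv.subtypeEquivRight fun P => ?_)
  rw [Finset.mem_filter]
  constructor
  · rintro ⟨h1, h2, h3, h4⟩
    obtain ⟨f, rfl, hf, hs⟩ := nec par hbr tb htb T hT hl P h1 h2 h4
    exact ⟨hall f hf hs, h3⟩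
  · rintro ⟨h1, h3⟩
    simp only [listOf, List.mem_toFinset, List.mem_map] at h1
    obtain ⟨c, hc, rfl⟩ := h1
    obtain ⟨h5, h6⟩ := suff par hpar T hT hl c.1 c.2 (hcs c hc)
    exact ⟨charOf_isChar _, h5, h3, h6⟩

def par1 : Fin 16 → Fin 16 := ![0,0,0,0,1,2,3,1,2,3,4,4,5,5,6,6]
def par2 : Fin 16 → Fin 16 := ![0,0,1,2,3,4,5,0,0,1,2,3,4,5,6,6]

def tb1 : Table :=
  [(0, 25, 98, 388),
   (1, 1, 24, 486),
   (2, 2, 96, 413),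
   (3, 4, 384, 123),
   (4, 8, 16, 487),
   (5, 32, 64, 415),
   (6, 128, 256, 127)]

def tb2 : Table :=
  [(0, 1, 2, 508),
   (1, 3, 4, 504),
   (2, 7, 8, 496),
   (3, 15, 16, 480),
   (4, 31, 32, 448),
   (5, 63, 64, 384),
   (6, 127, 128, 256)]

def cs1 : List Cert :=
  [(![0,0,0,0,0,0,0,0,0,0,0,0,0,0,0,0], ![0,0,0]),
   (![0,1,0,0,1,0,0,1,0,0,1,1,0,0,0,0], ![0,1,0]),
   (![0,0,1,0,0,1,0,0,1,0,0,0,1,1,0,0], ![0,2,0]),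
   (![0,0,0,1,0,0,1,0,0,1,0,0,0,0,1,1], ![0,3,0]),
   (![0,1,2,0,1,2,0,1,2,0,1,1,2,2,0,0], ![0,1,2])]

def cs2 : List Cert :=
  [(![0,0,0,0,0,0,0,0,0,0,0,0,0,0,0,0], ![0,0,0]),
   (![0,0,1,1,1,1,1,0,0,0,1,1,1,1,1,1], ![0,2,0]),
   (![0,0,0,1,1,1,1,0,0,0,0,1,1,1,1,1], ![0,3,0]),
   (![0,0,0,0,1,1,1,0,0,0,0,0,1,1,1,1], ![0,4,0]),
   (![0,0,0,0,0,1,1,0,0,0,0,0,0,1,1,1], ![0,5,0]),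
   (![0,0,1,1,1,2,2,0,0,0,1,1,1,2,2,2], ![0,2,5])]

/-- decode masks into a colouring -/
def dec (m0 m1 : ℕ) (x : Fin 9) : Fin 3 :=
  if m0.testBit x = true then 0 else if m1.testBit x = true then 1 else 2

lemma dec_M (f : Fin 9 → Fin 3) : dec (M f 0 9) (M f 1 9) = f := by
  funext x
  have hx : Fin.ofNat 9 x.1 = x := by ext; exact Nat.mod_eq_of_lt x.2
  unfold dec
  simp only [testBit_M, x.2, true_and, hx]
  generalize f x = c
  revert c
  decide

/-- the property that a good colouring is listed -/
def Good (cs : List Cert) (f : Fin 9 → Fin 3) : Prop :=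
  (∀ c, sz f c = 0 ∨ 3 ≤ sz f c) → charOf f ∈ listOf cs

instance (cs : List Cert) (f : Fin 9 → Fin 3) : Decidable (Good cs f) :=
  inferInstanceAs (Decidable (_ → _))

/-- depth first search over all colourings -/
def dfs (tb : Table) (cs : List Cert) : ℕ → ℕ → ℕ → ℕ → ℕ → Bool
  | 0, _, m0, m1, m2 => !(ok tb m0 m1 m2) || decide (Good cs (dec m0 m1))
  | n + 1, k, m0, m1, m2 => !(ok tb m0 m1 m2) ||
      (dfs tb cs n (k + 1) (Nat.lor m0 (Nat.pow 2 k)) m1 m2 &&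
      (dfs tb cs n (k + 1) m0 (Nat.lor m1 (Nat.pow 2 k)) m2 &&
       dfs tb cs n (k + 1) m0 m1 (Nat.lor m2 (Nat.pow 2 k))))

lemma dfs_spec (tb : Table) (cs : List Cert) (f : Fin 9 → Fin 3)
    (h : ∀ k ≤ 9, ok tb (M f 0 k) (M f 1 k) (M f 2 k) = true) (n : ℕ) :
    ∀ k, n + k = 9 → dfs tb cs n k (M f 0 k) (M f 1 k) (M f 2 k) = true → Good cs f := by
  induction n with
  | zero =>
    intro k hk hd
    obtain rfl : k = 9 := by omega
    unfold dfs at hd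
    rw [h 9 le_rfl, dec_M] at hd
    simpa using hd
  | succ n ih =>
    intro k hk hd
    unfold dfs at hd
    rw [h k (by omega)] at hd
    simp only [Bool.not_true, Bool.false_or, Bool.and_eq_true] at hd
    obtain ⟨d0, d1, d2⟩ := hd
    apply ih (k + 1) (by omega)
    have hc : ∀ c : Fin 3, c = 0 ∨ c = 1 ∨ c = 2 := by decide
    rcases hc (f (Fin.ofNat 9 k)) with e | e | e <;> simp only [M, e]
    · exact d0
    · exact d1
    · exact d2

lemma all1 : dfs tb1 cs1 9 0 0 0 0 = true := by decide +kernel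

lemma all2 : dfs tb2 cs2 9 0 0 0 0 = true := by decide +kernel

lemma hpar1 : ∀ v, v ≠ 0 → par1 v < v := by decide +kernel
lemma hpar2 : ∀ v, v ≠ 0 → par2 v < v := by decide +kernel
lemma hbr1 : ∀ v a b, (mk par1).Adj a b → a ≠ v → b ≠ v → br par1 v a = br par1 v b := by
  decide +kernel
lemma hbr2 : ∀ v a b, (mk par2).Adj a b → a ≠ v → b ≠ v → br par2 v a = br par2 v b := by
  decide +kernel
lemma htb1 : TableOK par1 tb1 := by decide +kernel
lemma htb2 : TableOK par2 tb2 := by decide +kernel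
lemma hcs1 : ∀ c ∈ cs1, CertOK par1 c.1 c.2 := by
  have h : (cs1.all fun c => decide (CertOK par1 c.1 c.2)) = true := by decide +kernel
  simpa only [List.all_eq_true, decide_eq_true_eq] using h
lemma hcs2 : ∀ c ∈ cs2, CertOK par2 c.1 c.2 := by
  have h : (cs2.all fun c => decide (CertOK par2 c.1 c.2)) = true := by decide +kernel
  simpa only [List.all_eq_true, decide_eq_true_eq] using h

def T1 : UnrootedBinaryTree (Fin 16) (Fin 9) :=
  mkTree par1 hpar1 (by decide +kernel)
def T2 : UnrootedBinaryTree (Fin 16) (Fin 9) :=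
  mkTree par2 hpar2 (by decide +kernel)

lemma sum1 : ∑ r ∈ Finset.Icc 1 9, ((listOf cs1).filter (fun P => P.card = r)).card = 5 := by
  decide +kernel
lemma sum2 : ∑ r ∈ Finset.Icc 1 9, ((listOf cs2).filter (fun P => P.card = r)).card = 6 := by
  decide +kernel

lemma g1 : gTotal T1 3 = 5 :=
  (total par1 hpar1 hbr1 tb1 htb1 T1 rfl rfl cs1 hcs1
    (fun f hf => dfs_spec tb1 cs1 f hf 9 0 rfl all1)).trans sum1

lemma g2 : gTotal T2 3 = 6 :=
  (total par2 hpar2 hbr2 tb2 htb2 T2 rfl rfl cs2 hcs2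
    (fun f hf => dfs_spec tb2 cs2 f hf 9 0 rfl all2)).trans sum2

end G3

/-- there are two unrooted binary trees on the same set of 9 taxa with
`g₃(T₁) = 5` and `g₃(T₂) = 6`, so `g₃` depends on topology. -/
theorem g3_depends_on_topology :
    ∃ (V₁ V₂ X : Type) (T₁ : UnrootedBinaryTree V₁ X) (T₂ : UnrootedBinaryTree V₂ X),
      Finite V₁ ∧ Finite V₂ ∧ Nat.card X = 9 ∧
      gTotal T₁ 3 = 5 ∧ gTotal T₂ 3 = 6 := by
  exact ⟨Fin 16, Fin 16, Fin 9, G3.T1, G3.T2, inferInstance, inferInstance, by simp, G3.g1, G3.g2⟩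
end

section
/- Let T₁ and T₂ be two unrooted binary phylogenetic trees on the same taxon set X with |X| = n ≥ 2. The number of partitions of X into nonempty subsets whose minimal connecting subtrees are pairwise vertex-disjoint in T₁ and also pairwise vertex-disjoint in T₂ (in particular, the number of agreement forests of T₁ and T₂) is at most the Fibonacci number F(2n−1). -/
open SimpleGraph

section helpers

/-- The bounds on partial partitions inside `S`. -/
def Bdd {X : Type} [DecidableEq X] (Q : Finset (Finset X) → Prop) (S : Finset X) : Prop :=
  ∃ (m : ℕ) (A : Finset (Finset (Finset X))) (B : Finset (Finset X × Finset (Finset X))),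
    S.card = m + 1 ∧ A.card ≤ Nat.fib (2 * m + 1) ∧ B.card ≤ Nat.fib (2 * m + 2) ∧
    (∀ P, Q P → (∀ C ∈ P, ∀ x ∈ C, x ∈ S → C ⊆ S) → P.filter (· ⊆ S) ∈ A) ∧
    (∀ P, Q P → ∀ C ∈ P, (∃ x ∈ C, x ∈ S) → ¬ C ⊆ S → (C ∩ S, P.filter (· ⊆ S)) ∈ B)

theorem bdd_leaf {X : Type} [DecidableEq X] (Q : Finset (Finset X) → Prop)
    (hQ : ∀ P, Q P → IsCharacter P) (x : X) : Bdd Q {x} := by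
  classical
  refine ⟨0, {{{x}}}, {({x}, ∅)}, by simp, by simp, by simp, ?_, ?_⟩
  · intro P hP h
    obtain ⟨hne, hdis, hcov⟩ := hQ P hP
    obtain ⟨C, hC, hxC⟩ := hcov x
    have hCx : C = {x} := by
      have := h C hC x hxC (by simp)
      exact Finset.Subset.antisymm this (by simpa using hxC)
    rw [Finset.mem_singleton]
    ext D
    simp only [Finset.mem_filter, Finset.mem_singleton]
    constructor
    · rintro ⟨hD, hDx⟩
      rcases Finset.subset_singleton_iff.1 hDx with h0 | h0
      · exact absurd h0 (hne D hD).ne_empty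
      · exact h0
    · rintro rfl
      subst hCx
      exact ⟨hC, subset_rfl⟩
  · rintro P hP C hC ⟨y, hyC, hyx⟩ hn
    obtain ⟨hne, hdis, hcov⟩ := hQ P hP
    have hy : y = x := by simpa using hyx
    subst hy
    rw [Finset.mem_singleton, Prod.mk.injEq]
    refine ⟨?_, ?_⟩
    · ext z; simp only [Finset.mem_inter, Finset.mem_singleton]
      constructor
      · exact fun h => h.2
      · rintro rfl; exact ⟨hyC, rfl⟩
    · rw [Finset.filter_eq_empty_iff]
      intro D hD hDx
      rcases Finset.subset_singleton_iff.1 hDx with h0 | h0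
      · exact absurd h0 (hne D hD).ne_empty
      · subst h0
        have hne' : ({y} : Finset X) ≠ C := by
          rintro rfl; exact hn subset_rfl
        have := hdis _ hD _ hC hne'
        rw [Finset.disjoint_left] at this
        exact this (by simp) hyC

theorem bdd_combine {X : Type} [DecidableEq X] (Q : Finset (Finset X) → Prop)
    (hQ : ∀ P, Q P → IsCharacter P) (S₁ S₂ : Finset X) (hd : Disjoint S₁ S₂)
    (h₁ : Bdd Q S₁) (h₂ : Bdd Q S₂)
    (hc : ∀ P, Q P → ∀ B ∈ P, ∀ B' ∈ P,
      ((∃ x ∈ B, x ∈ S₁) ∧ ¬ B ⊆ S₁ ∨ (∃ x ∈ B, x ∈ S₂) ∧ ¬ B ⊆ S₂) →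
      ((∃ x ∈ B', x ∈ S₁) ∧ ¬ B' ⊆ S₁ ∨ (∃ x ∈ B', x ∈ S₂) ∧ ¬ B' ⊆ S₂) → B = B') :
    Bdd Q (S₁ ∪ S₂) := by
  classical
  obtain ⟨a, A₁, B₁, hS₁, hA₁, hB₁, f₁, g₁⟩ := h₁
  obtain ⟨b, A₂, B₂, hS₂, hA₂, hB₂, f₂, g₂⟩ := h₂
  have hd' := Finset.disjoint_left.1 hd
  -- description of the blocks inside the union, when `C` crosses
  have key : ∀ P, Q P → ∀ C ∈ P,
      ((∃ x ∈ C, x ∈ S₁) ∧ ¬ C ⊆ S₁ ∨ (∃ x ∈ C, x ∈ S₂) ∧ ¬ C ⊆ S₂) →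
      ∀ D ∈ P, D ⊆ S₁ ∪ S₂ → D ≠ C → D ⊆ S₁ ∨ D ⊆ S₂ := by
    intro P hP C hC hcr D hD hDS hDC
    obtain ⟨z, hz⟩ := (hQ P hP).1 D hD
    by_contra hcon
    push Not at hcon
    apply hDC
    refine hc P hP D hD C hC ?_ hcr
    rcases Finset.mem_union.1 (hDS hz) with h | h
    · exact Or.inl ⟨⟨z, hz, h⟩, hcon.1⟩
    · exact Or.inr ⟨⟨z, hz, h⟩, hcon.2⟩
  refine ⟨a + b + 1,
    Finset.image₂ (fun p q => p ∪ q) A₁ A₂ ∪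
      Finset.image₂ (fun p q => insert (p.1 ∪ q.1) (p.2 ∪ q.2)) B₁ B₂,
    Finset.image₂ (fun p q => (p.1, p.2 ∪ q)) B₁ A₂ ∪
      (Finset.image₂ (fun p q => (q.1, p ∪ q.2)) A₁ B₂ ∪
      Finset.image₂ (fun p q => (p.1 ∪ q.1, p.2 ∪ q.2)) B₁ B₂), ?_, ?_, ?_, ?_, ?_⟩
  · rw [Finset.card_union_of_disjoint hd]; omega
  · refine (Finset.card_union_le _ _).trans ?_
    have e : Nat.fib (2 * (a + b + 1) + 1) =
        Nat.fib (2*a+1) * Nat.fib (2*b+1) + Nat.fib (2*a+2) * Nat.fib (2*b+2) := by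
      rw [← Nat.fib_add]; congr 1; ring
    rw [e]
    exact add_le_add ((Finset.card_image₂_le _ _ _).trans (Nat.mul_le_mul hA₁ hA₂))
      ((Finset.card_image₂_le _ _ _).trans (Nat.mul_le_mul hB₁ hB₂))
  · have e : Nat.fib (2 * (a + b + 1) + 2) =
        Nat.fib (2*a+2) * Nat.fib (2*b+1) + (Nat.fib (2*a+1) * Nat.fib (2*b+2)
          + Nat.fib (2*a+2) * Nat.fib (2*b+2)) := by
      rw [← add_mul, ← Nat.fib_add_two, ← Nat.fib_add]; congr 1; ring
    rw [e]
    refine (Finset.card_union_le _ _).trans (add_le_add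
      ((Finset.card_image₂_le _ _ _).trans (Nat.mul_le_mul hB₁ hA₂))
      ((Finset.card_union_le _ _).trans (add_le_add 
      ((Finset.card_image₂_le _ _ _).trans (Nat.mul_le_mul hA₁ hB₂))
      ((Finset.card_image₂_le _ _ _).trans (Nat.mul_le_mul hB₁ hB₂)))))
  · intro P hP h
    obtain ⟨hne, hdis, hcov⟩ := hQ P hP
    by_cases hcr : ∃ C ∈ P, ((∃ x ∈ C, x ∈ S₁) ∧ ¬ C ⊆ S₁ ∨ (∃ x ∈ C, x ∈ S₂) ∧ ¬ C ⊆ S₂)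
    · obtain ⟨C, hC, hcr⟩ := hcr
      have hCS : C ⊆ S₁ ∪ S₂ := by
        rcases hcr with ⟨⟨x, hx, hx'⟩, -⟩ | ⟨⟨x, hx, hx'⟩, -⟩
        · exact h C hC x hx (Finset.mem_union_left _ hx')
        · exact h C hC x hx (Finset.mem_union_right _ hx')
      have h12 : ((∃ x ∈ C, x ∈ S₁) ∧ ¬ C ⊆ S₁) ∧ ((∃ x ∈ C, x ∈ S₂) ∧ ¬ C ⊆ S₂) := by
        rcases hcr with ⟨⟨x, hx, hx'⟩, hn⟩ | ⟨⟨x, hx, hx'⟩, hn⟩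
        · obtain ⟨y, hy, hy'⟩ := Finset.not_subset.1 hn
          have := Finset.mem_union.1 (hCS hy)
          exact ⟨⟨⟨x, hx, hx'⟩, hn⟩, ⟨y, hy, by tauto⟩, fun hh => hd' hx' (hh hx)⟩
        · obtain ⟨y, hy, hy'⟩ := Finset.not_subset.1 hn
          have := Finset.mem_union.1 (hCS hy)
          exact ⟨⟨⟨y, hy, by tauto⟩, fun hh => hd' (hh hx) hx'⟩, ⟨⟨x, hx, hx'⟩, hn⟩⟩
      refine Finset.mem_union_right _ (Finset.mem_image₂.2
        ⟨_, g₁ P hP C hC h12.1.1 h12.1.2, _, g₂ P hP C hC h12.2.1 h12.2.2, ?_⟩)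
      dsimp only
      rw [← Finset.inter_union_distrib_left, Finset.inter_eq_left.2 hCS]
      ext D
      simp only [Finset.mem_insert, Finset.mem_union, Finset.mem_filter]
      constructor
      · rintro (rfl | ⟨h3, h4⟩ | ⟨h3, h4⟩)
        · exact ⟨hC, hCS⟩
        · exact ⟨h3, h4.trans Finset.subset_union_left⟩
        · exact ⟨h3, h4.trans Finset.subset_union_right⟩
      · rintro ⟨h3, h4⟩
        by_cases hDC : D = C
        · exact Or.inl hDC
        · have := key P hP C hC hcr D h3 h4 hDC
          tauto
    · push Not at hcr
      refine Finset.mem_union_left _ (Finset.mem_image₂.2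
        ⟨_, f₁ P hP (fun C hC x hx hx' => (hcr C hC).1 ⟨x, hx, hx'⟩),
         _, f₂ P hP (fun C hC x hx hx' => (hcr C hC).2 ⟨x, hx, hx'⟩), ?_⟩)
      ext D
      simp only [Finset.mem_union, Finset.mem_filter]
      constructor
      · rintro (⟨h3, h4⟩ | ⟨h3, h4⟩)
        · exact ⟨h3, h4.trans Finset.subset_union_left⟩
        · exact ⟨h3, h4.trans Finset.subset_union_right⟩
      · rintro ⟨h3, h4⟩
        obtain ⟨z, hz⟩ := hne D h3
        rcases Finset.mem_union.1 (h4 hz) with h | h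
        · exact Or.inl ⟨h3, (hcr D h3).1 ⟨z, hz, h⟩⟩
        · exact Or.inr ⟨h3, (hcr D h3).2 ⟨z, hz, h⟩⟩
  · intro P hP C hC hx hn
    obtain ⟨hne, hdis, hcov⟩ := hQ P hP
    have hn1 : ¬ C ⊆ S₁ := fun hh => hn (hh.trans Finset.subset_union_left)
    have hn2 : ¬ C ⊆ S₂ := fun hh => hn (hh.trans Finset.subset_union_right)
    have hcr : ((∃ x ∈ C, x ∈ S₁) ∧ ¬ C ⊆ S₁ ∨ (∃ x ∈ C, x ∈ S₂) ∧ ¬ C ⊆ S₂) := by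
      obtain ⟨x, hx, hx'⟩ := hx
      rcases Finset.mem_union.1 hx' with h | h
      · exact Or.inl ⟨⟨x, hx, h⟩, hn1⟩
      · exact Or.inr ⟨⟨x, hx, h⟩, hn2⟩
    have hfil : P.filter (· ⊆ S₁) ∪ P.filter (· ⊆ S₂) = P.filter (· ⊆ S₁ ∪ S₂) := by
      ext D
      simp only [Finset.mem_union, Finset.mem_filter]
      constructor
      · rintro (⟨h3, h4⟩ | ⟨h3, h4⟩)
        · exact ⟨h3, h4.trans Finset.subset_union_left⟩
        · exact ⟨h3, h4.trans Finset.subset_union_right⟩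
      · rintro ⟨h3, h4⟩
        have := key P hP C hC hcr D h3 h4 (by rintro rfl; exact hn h4)
        tauto
    by_cases hx1 : ∃ x ∈ C, x ∈ S₁
    · by_cases hx2 : ∃ x ∈ C, x ∈ S₂
      · refine Finset.mem_union_right _ (Finset.mem_union_right _ (Finset.mem_image₂.2
          ⟨_, g₁ P hP C hC hx1 hn1, _, g₂ P hP C hC hx2 hn2, ?_⟩))
        dsimp only
        rw [hfil, ← Finset.inter_union_distrib_left]
      · refine Finset.mem_union_left _ (Finset.mem_image₂.2
          ⟨_, g₁ P hP C hC hx1 hn1, _, f₂ P hP ?_, ?_⟩)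
        · intro D hD x hx hx'
          by_contra hcon
          have := hc P hP C hC D hD hcr (Or.inr ⟨⟨x, hx, hx'⟩, hcon⟩)
          subst this
          exact hx2 ⟨x, hx, hx'⟩
        · dsimp only
          rw [hfil, Prod.mk.injEq]
          refine ⟨?_, rfl⟩
          ext z
          simp only [Finset.mem_inter, Finset.mem_union]
          push Not at hx2
          have := hx2 z
          tauto
    · refine Finset.mem_union_right _ (Finset.mem_union_left _ (Finset.mem_image₂.2
          ⟨_, f₁ P hP ?_, _, g₂ P hP C hC (hcr.resolve_left (fun hh => hx1 hh.1)).1 hn2, ?_⟩))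
      · intro D hD x hx hx'
        by_contra hcon
        have := hc P hP C hC D hD hcr (Or.inl ⟨⟨x, hx, hx'⟩, hcon⟩)
        subst this
        exact hx1 ⟨x, hx, hx'⟩
      · dsimp only
        rw [hfil, Prod.mk.injEq]
        refine ⟨?_, rfl⟩
        ext z
        simp only [Finset.mem_inter, Finset.mem_union]
        push Not at hx1
        have := hx1 z
        tauto

/-- `a` and `b` are joined by a walk avoiding `v`. -/
def Avoid {V : Type} (G : SimpleGraph V) (v a b : V) : Prop :=
  ∃ p : G.Walk a b, v ∉ p.support

theorem Avoid.symm {V : Type} {G : SimpleGraph V} {v a b : V} (h : Avoid G v a b) :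
    Avoid G v b a := by
  obtain ⟨p, hp⟩ := h
  exact ⟨p.reverse, by simpa using hp⟩

theorem Avoid.trans {V : Type} {G : SimpleGraph V} {v a b c : V} (h : Avoid G v a b)
    (h' : Avoid G v b c) : Avoid G v a c := by
  obtain ⟨p, hp⟩ := h
  obtain ⟨q, hq⟩ := h'
  refine ⟨p.append q, ?_⟩
  rw [Walk.mem_support_append_iff]
  tauto

theorem Avoid.path {V : Type} {G : SimpleGraph V} {v a b : V} (h : Avoid G v a b) :
    ∃ p : G.Walk a b, p.IsPath ∧ v ∉ p.support := by
  classical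
  obtain ⟨p, hp⟩ := h
  exact ⟨p.bypass, p.bypass_isPath, fun hh => hp (p.support_bypass_subset_support hh)⟩

theorem Avoid.ne {V : Type} {G : SimpleGraph V} {v a b : V} (h : Avoid G v a b) : b ≠ v := by
  obtain ⟨p, hp⟩ := h
  rintro rfl
  exact hp p.end_mem_support

theorem avoid_exists {V : Type} {G : SimpleGraph V} (hG : G.IsTree) {v z : V} (h : z ≠ v) :
    ∃ c, G.Adj v c ∧ Avoid G v c z := by
  obtain ⟨p, hp, -⟩ := hG.existsUnique_path v z
  cases p with
  | nil => exact absurd rfl h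
  | cons hadj q =>
    rw [Walk.cons_isPath_iff] at hp
    exact ⟨_, hadj, q, hp.2⟩

theorem avoid_unique {V : Type} {G : SimpleGraph V} (hG : G.IsTree) {v c d : V}
    (hc : G.Adj v c) (hd : G.Adj v d) (h : Avoid G v c d) : c = d := by
  by_contra hne
  obtain ⟨p, hp, hv⟩ := h.path
  have hq : (Walk.cons hc.symm (Walk.cons hd Walk.nil)).IsPath := by
    simp [Walk.cons_isPath_iff, hd.ne, hc.ne.symm, hne]
  have := (hG.existsUnique_path c d).unique hp hq
  subst this
  simp at hv

theorem avoid_swap {V : Type} {G : SimpleGraph V} (hG : G.IsTree) {u v z : V}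
    (hc : G.Adj u v) (h : Avoid G u v z) (h' : Avoid G v u z) : False := by
  obtain ⟨p, hp, hu⟩ := h.path
  obtain ⟨q, hq, hv⟩ := h'.path
  have hq' : (Walk.cons hc p).IsPath := by
    simp [Walk.cons_isPath_iff, hp, hu]
  have := (hG.existsUnique_path u z).unique hq hq'
  subst this
  simp at hv

theorem avoid_step {V : Type} {G : SimpleGraph V} (hG : G.IsTree) {u v c z : V}
    (hu : G.Adj u v) (hc : G.Adj v c) (hcu : c ≠ u) (h : Avoid G v c z) : Avoid G u v z := by
  classical
  obtain ⟨p, hv⟩ := h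
  refine ⟨Walk.cons hc p, ?_⟩
  rw [Walk.support_cons, List.mem_cons]
  rintro (h1 | h1)
  · exact hu.ne h1
  · apply hcu
    apply avoid_unique hG hc hu.symm
    exact ⟨p.takeUntil u h1, fun hh => hv (p.support_takeUntil_subset_support h1 hh)⟩

theorem bdd_side {V X : Type} [Finite V] [Fintype X] [DecidableEq X] (T : UnrootedBinaryTree V X)
    (Q : Finset (Finset X) → Prop) (hQ : ∀ P, Q P → IsCharacter P)
    (hT : ∀ P, Q P → ∀ B ∈ P, ∀ B' ∈ P, B ≠ B' →
        Disjoint (connSubtree T (B : Set X)) (connSubtree T (B' : Set X))) :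
    ∀ (k : ℕ) (u v : V), T.graph.Adj u v → {z | Avoid T.graph u v z}.ncard = k →
    ∀ S : Finset X, (∀ x, x ∈ S ↔ Avoid T.graph u v (T.label x)) → Bdd Q S := by
  classical
  intro k
  induction k using Nat.strong_induction_on with
  | _ k ih =>
  intro u v huv hk S hS
  rcases T.degOneOrThree v with h1 | h3
  · obtain ⟨x, rfl⟩ := T.leaf_label v h1
    have : S = {x} := by
      ext y
      rw [hS, Finset.mem_singleton]
      constructor
      · intro h
        by_contra hne
        have hne' : T.label y ≠ T.label x := fun hh => hne (T.label_inj hh)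
        obtain ⟨c, hc, hcz⟩ := avoid_exists T.isTree hne'
        obtain ⟨w, hw⟩ := Set.ncard_eq_one.1 h1
        have e1 : c ∈ T.graph.neighborSet (T.label x) := hc
        have e2 : u ∈ T.graph.neighborSet (T.label x) := huv.symm
        rw [hw] at e1 e2
        have : c = u := by rw [Set.mem_singleton_iff.1 e1, Set.mem_singleton_iff.1 e2]
        subst this
        exact avoid_swap T.isTree huv h hcz
      · rintro rfl
        exact ⟨Walk.nil, by simpa using huv.ne⟩
    rw [this]
    exact bdd_leaf Q hQ x
  · have hlab : ∀ x, T.label x ≠ v := by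
      rintro x rfl
      have := T.label_leaf x
      omega
    obtain ⟨c, d, hcd, hnb⟩ : ∃ c d, c ≠ d ∧ T.graph.neighborSet v = {u, c, d} ∧ c ≠ u ∧ d ≠ u := by
      have hu : u ∈ T.graph.neighborSet v := huv.symm
      have h2 : (T.graph.neighborSet v \ {u}).ncard = 2 := by
        rw [Set.ncard_sdiff_singleton_of_mem hu]
        have : (T.graph.neighborSet v).ncard = 3 := h3
        omega
      obtain ⟨c, d, hcd, he⟩ := Set.ncard_eq_two.1 h2
      have hc : c ∈ T.graph.neighborSet v \ {u} := by rw [he]; simp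
      have hd : d ∈ T.graph.neighborSet v \ {u} := by rw [he]; simp
      refine ⟨c, d, hcd, ?_, hc.2, hd.2⟩
      rw [← he, Set.insert_sdiff_singleton, Set.insert_eq_of_mem hu]
    obtain ⟨hnb, hcu, hdu⟩ := hnb
    have hc : T.graph.Adj v c := by
      change c ∈ T.graph.neighborSet v; rw [hnb]; simp
    have hd : T.graph.Adj v d := by
      change d ∈ T.graph.neighborSet v; rw [hnb]; simp
    have hsub : ∀ w, T.graph.Adj v w → w ≠ u →
        {z | Avoid T.graph v w z}.ncard < k := by
      intro w hw hwu
      rw [← hk]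
      apply Set.ncard_lt_ncard _ (Set.toFinite _)
      refine ⟨fun z hz => avoid_step T.isTree huv hw hwu hz, fun hh => ?_⟩
      have : v ∈ {z | Avoid T.graph u v z} := ⟨Walk.nil, by simpa using huv.ne⟩
      exact (hh this).ne rfl
    let S₁ : Finset X := Finset.univ.filter (fun x => Avoid T.graph v c (T.label x))
    let S₂ : Finset X := Finset.univ.filter (fun x => Avoid T.graph v d (T.label x))
    have hS₁ : ∀ x, x ∈ S₁ ↔ Avoid T.graph v c (T.label x) := by simp [S₁]
    have hS₂ : ∀ x, x ∈ S₂ ↔ Avoid T.graph v d (T.label x) := by simp [S₂]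
    have hSS : S = S₁ ∪ S₂ := by
      ext x
      rw [Finset.mem_union, hS, hS₁, hS₂]
      constructor
      · intro h
        obtain ⟨w, hw, hwz⟩ := avoid_exists T.isTree (hlab x)
        have hw' : w ∈ T.graph.neighborSet v := hw
        rw [hnb] at hw'
        rcases hw' with rfl | rfl | rfl
        · exact (avoid_swap T.isTree huv h hwz).elim
        · exact Or.inl hwz
        · exact Or.inr hwz
      · rintro (h | h)
        · exact avoid_step T.isTree huv hc hcu h
        · exact avoid_step T.isTree huv hd hdu h
    rw [hSS]
    have cross : ∀ (w : V) (B : Finset X) , 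
        (∃ x ∈ B, Avoid T.graph v w (T.label x)) → (∃ y ∈ B, ¬ Avoid T.graph v w (T.label y)) →
        v ∈ connSubtree T (B : Set X) := by
      rintro w B ⟨x, hx, hx'⟩ ⟨y, hy, hy'⟩
      obtain ⟨p, hp, -⟩ := T.isTree.existsUnique_path (T.label x) (T.label y)
      refine ⟨x, hx, y, hy, p, hp, ?_⟩
      by_contra hv
      exact hy' (hx'.trans ⟨p, hv⟩)
    have cross' : ∀ B : Finset X,
      ((∃ x ∈ B, x ∈ S₁) ∧ ¬ B ⊆ S₁ ∨ (∃ x ∈ B, x ∈ S₂) ∧ ¬ B ⊆ S₂) →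
        v ∈ connSubtree T (B : Set X) := by
      intro B h
      simp only [Finset.not_subset, hS₁, hS₂] at h
      rcases h with h | h
      · exact cross c B h.1 h.2
      · exact cross d B h.1 h.2
    apply bdd_combine Q hQ
    · rw [Finset.disjoint_left]
      intro x h1 h2
      rw [hS₁] at h1
      rw [hS₂] at h2
      exact hcd (avoid_unique T.isTree hc hd (h1.trans h2.symm))
    · exact ih _ (hsub c hc hcu) v c hc rfl S₁ hS₁
    · exact ih _ (hsub d hd hdu) v d hd rfl S₂ hS₂
    · intro P hP B hB B' hB' h h'
      by_contra hne
      exact Set.disjoint_left.1 (hT P hP B hB B' hB' hne) (cross' B h) (cross' B' h')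

end helpers

/-- the number of partitions of `X` whose minimal connecting subtrees are
pairwise vertex-disjoint in both `T₁` and `T₂` (in particular the number of agreement
forests) is at most `F(2n-1)`. -/
theorem agreement_forests_le_fib {V₁ V₂ X : Type} [Finite V₁] [Finite V₂] [Finite X]
    (T₁ : UnrootedBinaryTree V₁ X) (T₂ : UnrootedBinaryTree V₂ X) (n : ℕ)
    (hn : Nat.card X = n) (hn2 : 2 ≤ n) :
    Nat.card {P : Finset (Finset X) // IsCharacter P ∧
      (∀ B ∈ P, ∀ B' ∈ P, B ≠ B' →
        Disjoint (connSubtree T₁ (B : Set X)) (connSubtree T₁ (B' : Set X))) ∧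
      (∀ B ∈ P, ∀ B' ∈ P, B ≠ B' →
        Disjoint (connSubtree T₂ (B : Set X)) (connSubtree T₂ (B' : Set X)))} ≤
    Nat.fib (2 * n - 1) := by
  classical
  haveI := Fintype.ofFinite X
  let Q : Finset (Finset X) → Prop := fun P => IsCharacter P ∧
      (∀ B ∈ P, ∀ B' ∈ P, B ≠ B' →
        Disjoint (connSubtree T₁ (B : Set X)) (connSubtree T₁ (B' : Set X))) ∧
      (∀ B ∈ P, ∀ B' ∈ P, B ≠ B' →
        Disjoint (connSubtree T₂ (B : Set X)) (connSubtree T₂ (B' : Set X)))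
  have hQ : ∀ P, Q P → IsCharacter P := fun P h => h.1
  have hne : Nonempty X := by
    by_contra h
    rw [not_nonempty_iff] at h
    rw [Nat.card_of_isEmpty] at hn
    omega
  obtain ⟨x⟩ := hne
  obtain ⟨v, hv⟩ := Set.ncard_eq_one.1 (T₁.label_leaf x)
  have hadj : T₁.graph.Adj (T₁.label x) v := by
    change v ∈ T₁.graph.neighborSet _; rw [hv]; simp
  have hS : ∀ y, y ∈ (Finset.univ.erase x : Finset X) ↔
      Avoid T₁.graph (T₁.label x) v (T₁.label y) := by
    intro y
    rw [Finset.mem_erase]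
    constructor
    · rintro ⟨h, -⟩
      obtain ⟨c, hc, hcz⟩ := avoid_exists T₁.isTree (fun hh => h (T₁.label_inj hh))
      have hc' : c ∈ T₁.graph.neighborSet (T₁.label x) := hc
      rw [hv, Set.mem_singleton_iff] at hc'
      exact hc' ▸ hcz
    · intro h
      exact ⟨fun hh => h.ne (by rw [hh]), Finset.mem_univ _⟩
  have h2 := bdd_side T₁ Q hQ (fun P h => h.2.1) _ _ _ hadj rfl _ hS
  have h1 := bdd_leaf Q hQ x
  have h3 : Bdd Q ({x} ∪ Finset.univ.erase x) := by
    apply bdd_combine Q hQ _ _ _ h1 h2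
    · intro P hP
      have hx : ∀ B : Finset X, ((∃ y ∈ B, y ∈ ({x} : Finset X)) ∧ ¬ B ⊆ {x} ∨
          (∃ y ∈ B, y ∈ Finset.univ.erase x) ∧ ¬ B ⊆ Finset.univ.erase x) → x ∈ B := by
        rintro B (⟨⟨y, hy, hy'⟩, -⟩ | ⟨-, h⟩)
        · rw [Finset.mem_singleton] at hy'
          exact hy' ▸ hy
        · obtain ⟨y, hy, hy'⟩ := Finset.not_subset.1 h
          have : y = x := by simpa using hy'
          exact this ▸ hy
      intro B hB B' hB' h h'
      by_contra hne
      exact Finset.disjoint_left.1 ((hQ P hP).2.1 B hB B' hB' hne) (hx B h) (hx B' h')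
    · simp
  have hu : ({x} ∪ Finset.univ.erase x : Finset X) = Finset.univ := by
    ext y; simp [Classical.em]
  rw [hu] at h3
  obtain ⟨m, A, -, hm, hA, -, hf, -⟩ := h3
  have hnm : 2 * n - 1 = 2 * m + 1 := by
    rw [Finset.card_univ, ← Nat.card_eq_fintype_card] at hm
    omega
  rw [hnm]
  refine le_trans ?_ hA
  have hmem : ∀ P : {P // Q P}, P.1 ∈ A := by
    rintro ⟨P, hP⟩
    have := hf P hP (fun C _ _ _ _ => Finset.subset_univ C)
    simpa using this
  have := Nat.card_le_card_of_injective (fun P : {P // Q P} => (⟨P.1, hmem P⟩ : A))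
    (fun a b h => Subtype.ext (by simpa using h))
  rw [Nat.card_eq_fintype_card (α := A), Fintype.card_coe] at this
  exact this
end
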